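/- Let a, ν > 0. There exist constants c, C > 0 depending only on a and ν such that the following holds: for any T > 0 and any map z : [0,T] × ℝ² → ℝ² which is Schwartz-class in the space variable, continuously differentiable in time (with time derivatives of spatial integrals interchangeable), and satisfies the damped heat equation ∂_t z = νΔz − a z pointwise, one has for all 0 ≤ s ≤ t ≤ T: ∫_{ℝ²} ψ(t,x)²|z(t,x)|² dx + c ∫_s^t ( ∫_{ℝ²} ψ(r,x)²|z(r,x)|² dx + ∫_{ℝ²} ψ(r,x)²|∇z(r,x)|² dx ) dr ≤ ∫_{ℝ²} ψ(s,x)²|z(s,x)|² dx + C ∫_s^t ∫_{ℝ²} |z(r,x)|² dx dr. -/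

import Mathlib

open MeasureTheory Real Filter

noncomputable def φ (x : EuclideanSpace ℝ (Fin 2)) : ℝ := Real.sqrt (‖x‖ ^ 2 + 1)

noncomputable def ψ (t : ℝ) (x : EuclideanSpace ℝ (Fin 2)) : ℝ :=
  φ x * (1 - Real.exp (-t / φ x))

/-- The partial derivative `∂ᵢ f` of a vector-valued function on `ℝ²`. -/
noncomputable def pdv (i : Fin 2)
    (f : EuclideanSpace ℝ (Fin 2) → EuclideanSpace ℝ (Fin 2))
    (x : EuclideanSpace ℝ (Fin 2)) : EuclideanSpace ℝ (Fin 2) :=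
  fderiv ℝ f x (EuclideanSpace.single i 1)

section

open scoped Topology SchwartzMap Laplacian LineDeriv RealInnerProductSpace

abbrev Plane := EuclideanSpace ℝ (Fin 2)

/-- Cauchy-Schwarz inequality for real integrals. -/
lemma abs_integral_mul_le_sqrt {α : Type*} [MeasurableSpace α] {μ : Measure α} {f g : α → ℝ}
    (hf : MemLp f 2 μ) (hg : MemLp g 2 μ) :
    |∫ x, f x * g x ∂μ| ≤ √(∫ x, f x ^ 2 ∂μ) * √(∫ x, g x ^ 2 ∂μ) := by
  have h := integral_mul_norm_le_Lp_mul_Lq (μ := μ) (f := f) (g := g) (p := 2) (q := 2)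
    Real.HolderConjugate.two_two (by simpa using hf) (by simpa using hg)
  calc |∫ x, f x * g x ∂μ| ≤ ∫ x, ‖f x‖ * ‖g x‖ ∂μ := by
        rw [← Real.norm_eq_abs]
        refine (norm_integral_le_integral_norm _).trans (le_of_eq ?_)
        simp [norm_mul]
    _ ≤ _ := by
        refine h.trans (le_of_eq ?_)
        simp [Real.sqrt_eq_rpow]

/-- The heat kernel of the plane. -/
noncomputable def heatKernel (r : ℝ) (y : Plane) : ℝ :=
  (4 * π * r)⁻¹ * exp (-(‖y‖ ^ 2 / (4 * r)))

lemma heatKernel_pos {r : ℝ} (hr : 0 < r) (y : Plane) : 0 < heatKernel r y := by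
  unfold heatKernel; positivity

lemma continuous_heatKernel (r : ℝ) : Continuous (heatKernel r) := by
  unfold heatKernel; fun_prop

lemma heatKernel_neg (r : ℝ) (y : Plane) : heatKernel r (-y) = heatKernel r y := by
  simp [heatKernel]

lemma heatKernel_le_inv {r : ℝ} (hr : 0 < r) (y : Plane) : heatKernel r y ≤ (4 * π * r)⁻¹ := by
  unfold heatKernel
  refine mul_le_of_le_one_right (by positivity) ?_
  rw [Real.exp_le_one_iff]
  have : 0 ≤ ‖y‖ ^ 2 / (4 * r) := by positivity
  linarith

lemma integrable_exp_neg_mul_norm_sq {b : ℝ} (hb : 0 < b) :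
    Integrable (fun y : Plane ↦ exp (-b * ‖y‖ ^ 2)) := by
  by_contra h
  have h1 := GaussianFourier.integral_rexp_neg_mul_sq_norm (V := Plane) hb
  rw [integral_undef h] at h1
  have : 0 < (π / b) ^ (Module.finrank ℝ Plane / 2 : ℝ) := by positivity
  linarith

lemma integrable_heatKernel {r : ℝ} (hr : 0 < r) : Integrable (heatKernel r) := by
  have h := (integrable_exp_neg_mul_norm_sq (b := (4 * r)⁻¹) (by positivity)).const_mul
    (4 * π * r)⁻¹
  refine h.congr (ae_of_all _ fun y ↦ ?_)
  simp only [heatKernel]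
  congr 2
  field_simp

lemma integral_heatKernel {r : ℝ} (hr : 0 < r) : ∫ y, heatKernel r y = 1 := by
  have h := GaussianFourier.integral_rexp_neg_mul_sq_norm (V := Plane) (b := (4 * r)⁻¹)
    (by positivity)
  have h2 : ∀ y : Plane, heatKernel r y = (4 * π * r)⁻¹ * exp (-(4 * r)⁻¹ * ‖y‖ ^ 2) := by
    intro y
    simp only [heatKernel]
    congr 2
    field_simp
  simp_rw [h2]
  rw [integral_const_mul, h]
  simp
  field_simp

lemma integrable_heatKernel_sub {r : ℝ} (hr : 0 < r) (x : Plane) :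
    Integrable (fun y ↦ heatKernel r (x - y)) := (integrable_heatKernel hr).comp_sub_left x

lemma integral_heatKernel_sub {r : ℝ} (hr : 0 < r) (x : Plane) :
    ∫ y, heatKernel r (x - y) = 1 := by
  rw [integral_sub_left_eq_self (heatKernel r) volume x, integral_heatKernel hr]

lemma heatKernel_mul {r : ℝ} (hr : 0 < r) (x x' y : Plane) :
    heatKernel r (x - y) * heatKernel r (x' - y) =
      heatKernel (2 * r) (x - x') * heatKernel (r / 2) ((2⁻¹ : ℝ) • (x + x') - y) := by
  have key : ‖x - y‖ ^ 2 + ‖x' - y‖ ^ 2 =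
      ‖x - x'‖ ^ 2 / 2 + 2 * ‖(2⁻¹ : ℝ) • (x + x') - y‖ ^ 2 := by
    simp only [EuclideanSpace.norm_sq_eq, Fin.sum_univ_two, PiLp.sub_apply, PiLp.smul_apply,
      PiLp.add_apply, smul_eq_mul, Real.norm_eq_abs, sq_abs]
    ring
  unfold heatKernel
  rw [mul_mul_mul_comm, mul_mul_mul_comm (4 * π * (2 * r))⁻¹, ← exp_add, ← exp_add]
  congr 1
  · field_simp
  · congr 1
    have h1 : ‖x - y‖ ^ 2 = ‖x - x'‖ ^ 2 / 2 + 2 * ‖(2⁻¹ : ℝ) • (x + x') - y‖ ^ 2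
      - ‖x' - y‖ ^ 2 := by linarith
    rw [h1]
    field_simp
    ring

lemma memLp_heatKernel_sub {r : ℝ} (hr : 0 < r) (x : Plane) :
    MemLp (fun y ↦ heatKernel r (x - y)) 2 := by
  have hm : AEStronglyMeasurable (fun y ↦ heatKernel r (x - y)) :=
    ((continuous_heatKernel r).comp (continuous_const.sub continuous_id)).aestronglyMeasurable
  rw [memLp_two_iff_integrable_sq hm]
  simp_rw [pow_two, heatKernel_mul hr]
  exact (integrable_heatKernel_sub (by positivity) _).const_mul _

lemma integral_heatKernel_mul {r : ℝ} (hr : 0 < r) (x x' : Plane) :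
    ∫ y, heatKernel r (x - y) * heatKernel r (x' - y) = heatKernel (2 * r) (x - x') := by
  simp_rw [heatKernel_mul hr]
  rw [integral_const_mul, integral_heatKernel_sub (by positivity), mul_one]

lemma integral_heatKernel_sq {r : ℝ} (hr : 0 < r) (x : Plane) :
    ∫ y, heatKernel r (x - y) ^ 2 = (8 * π * r)⁻¹ := by
  simp_rw [pow_two]
  rw [integral_heatKernel_mul hr]
  simp [heatKernel]
  ring

lemma integral_heatKernel_sub_sq_le {r : ℝ} (hr : 0 < r) (x x' : Plane) :
    ∫ y, (heatKernel r (x - y) - heatKernel r (x' - y)) ^ 2 ≤ ‖x - x'‖ ^ 2 / (32 * π * r ^ 2) := by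
  have e : ∀ y, (heatKernel r (x - y) - heatKernel r (x' - y)) ^ 2 =
      heatKernel r (x - y) ^ 2 - 2 * (heatKernel r (x - y) * heatKernel r (x' - y)) +
        heatKernel r (x' - y) ^ 2 := fun y ↦ by ring
  simp_rw [e]
  have i1 := (memLp_heatKernel_sub hr x).integrable_sq
  have i2 := (memLp_heatKernel_sub hr x').integrable_sq
  have i3 : Integrable fun y ↦ 2 * (heatKernel r (x - y) * heatKernel r (x' - y)) :=
    ((memLp_heatKernel_sub hr x).integrable_mul (memLp_heatKernel_sub hr x')).const_mul 2
  have i4 : Integrable fun y ↦ heatKernel r (x - y) ^ 2 -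
    2 * (heatKernel r (x - y) * heatKernel r (x' - y)) := i1.sub i3
  rw [integral_add i4 i2, integral_sub i1 i3, integral_const_mul,
    integral_heatKernel_mul hr, integral_heatKernel_sq hr, integral_heatKernel_sq hr]
  unfold heatKernel
  have h1 := Real.add_one_le_exp (-(‖x - x'‖ ^ 2 / (4 * (2 * r))))
  have h2 : (4 * π * (2 * r))⁻¹ = (8 * π * r)⁻¹ := by congr 1; ring
  have h3 : ‖x - x'‖ ^ 2 / (32 * π * r ^ 2) = (8 * π * r)⁻¹ * 2 * (‖x - x'‖ ^ 2 / (4 * (2 * r))) := by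
    field_simp
    ring
  rw [h2, h3]
  have : 0 < (8 * π * r)⁻¹ := by positivity
  nlinarith

lemma heatKernel_le_of_le {r₁ r r₂ : ℝ} (h : 0 < r₁) (h₁ : r₁ ≤ r) (h₂ : r ≤ r₂) (y : Plane) :
    heatKernel r y ≤ r₂ / r₁ * heatKernel r₂ y := by
  have hr : 0 < r := h.trans_le h₁
  have hr2 : 0 < r₂ := hr.trans_le h₂
  unfold heatKernel
  rw [← mul_assoc]
  gcongr
  rw [show r₂ / r₁ * (4 * π * r₂)⁻¹ = (4 * π * r₁)⁻¹ by field_simp]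
  gcongr

lemma heatKernel_tail {r ρ : ℝ} (hr : 0 < r) (hρ : 0 ≤ ρ) {y : Plane} (hy : ρ ≤ ‖y‖) :
    heatKernel r y ≤ 2 * exp (-(ρ ^ 2 / (8 * r))) * heatKernel (2 * r) y := by
  have e : heatKernel r y = 2 * exp (-(‖y‖ ^ 2 / (8 * r))) * heatKernel (2 * r) y := by
    unfold heatKernel
    rw [show -(‖y‖ ^ 2 / (4 * r)) = -(‖y‖ ^ 2 / (8 * r)) + -(‖y‖ ^ 2 / (4 * (2 * r))) by
      field_simp; ring, exp_add]
    field_simp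
  rw [e]
  have := heatKernel_pos (r := 2 * r) (by positivity) y
  gcongr

lemma norm_add_smul_single_sq (w : Plane) (i : Fin 2) (t : ℝ) :
    ‖w + t • EuclideanSpace.single i (1 : ℝ)‖ ^ 2 = ‖w‖ ^ 2 + 2 * t * w i + t ^ 2 := by
  fin_cases i <;>
  · simp [EuclideanSpace.norm_sq_eq, Fin.sum_univ_two]
    ring

lemma hasLineDerivAt_heatKernel_sub (r : ℝ) (x y : Plane) (i : Fin 2) :
    HasLineDerivAt ℝ (fun y ↦ heatKernel r (x - y))
      ((x - y) i / (2 * r) * heatKernel r (x - y)) y (EuclideanSpace.single i 1) := by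
  unfold HasLineDerivAt heatKernel
  have e : ∀ t : ℝ, ‖x - (y + t • EuclideanSpace.single i (1 : ℝ))‖ ^ 2 =
      ‖x - y‖ ^ 2 - 2 * t * (x - y) i + t ^ 2 := by
    intro t
    have := norm_add_smul_single_sq (x - y) i (-t)
    rw [show x - (y + t • EuclideanSpace.single i (1 : ℝ)) =
      x - y + (-t) • EuclideanSpace.single i (1 : ℝ) by rw [neg_smul]; abel, this]
    ring
  simp_rw [e]
  have h1 : HasDerivAt (fun t : ℝ ↦ -((‖x - y‖ ^ 2 - 2 * t * (x - y) i + t ^ 2) / (4 * r)))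
      (-((0 - 2 * 1 * (x - y) i + 2 * 0) / (4 * r))) 0 := by
    refine ((((hasDerivAt_const _ _).sub (((hasDerivAt_id (0 : ℝ)).const_mul 2).mul_const _)).add
      ?_).div_const _).neg
    simpa using hasDerivAt_pow 2 (0 : ℝ)
  convert! (h1.exp).const_mul (4 * π * r)⁻¹ using 1
  norm_num
  ring

lemma hasLineDerivAt_coord_mul_heatKernel_sub (r : ℝ) (x y : Plane) (i : Fin 2) :
    HasLineDerivAt ℝ (fun y ↦ (x - y) i / (2 * r) * heatKernel r (x - y))
      (((x - y) i ^ 2 / (4 * r ^ 2) - 1 / (2 * r)) * heatKernel r (x - y)) y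
      (EuclideanSpace.single i 1) := by
  have h := hasLineDerivAt_heatKernel_sub r x y i
  unfold HasLineDerivAt at h ⊢
  have h1 : HasDerivAt (fun t : ℝ ↦ (x - (y + t • EuclideanSpace.single i (1 : ℝ))) i / (2 * r))
      (-1 / (2 * r)) 0 := by
    have : ∀ t : ℝ, (x - (y + t • EuclideanSpace.single i (1 : ℝ))) i / (2 * r) =
        (x i - (y i + t)) / (2 * r) := by intro t; simp
    simp_rw [this]
    exact (((hasDerivAt_id (0 : ℝ)).const_add (y i)).const_sub (x i)).div_const _
  convert! h1.mul h using 1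
  simp
  ring

/-- The time derivative of the heat kernel. -/
noncomputable def heatKernelDeriv (r : ℝ) (y : Plane) : ℝ :=
  (‖y‖ ^ 2 / (4 * r ^ 2) - 1 / r) * heatKernel r y

lemma hasDerivAt_heatKernel {r : ℝ} (hr : 0 < r) (y : Plane) :
    HasDerivAt (fun r ↦ heatKernel r y) (heatKernelDeriv r y) r := by
  unfold heatKernelDeriv heatKernel
  have h1 : HasDerivAt (fun r : ℝ ↦ (4 * π * r)⁻¹) (-(4 * π * 1) / (4 * π * r) ^ 2) r :=
    ((hasDerivAt_id r).const_mul (4 * π)).fun_inv (by simp; positivity)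
  have h2 : HasDerivAt (fun r : ℝ ↦ -(‖y‖ ^ 2 / (4 * r)))
      (-((0 * (4 * r) - ‖y‖ ^ 2 * (4 * 1)) / (4 * r) ^ 2)) r :=
    ((hasDerivAt_const _ _).div ((hasDerivAt_id r).const_mul 4) (by simp; positivity)).neg
  convert! h1.mul h2.exp using 1
  field_simp
  ring

lemma heatKernel_eq_two {r : ℝ} (hr : 0 < r) (y : Plane) :
    heatKernel r y = 2 * exp (-(‖y‖ ^ 2 / (8 * r))) * heatKernel (2 * r) y := by
  unfold heatKernel
  rw [show -(‖y‖ ^ 2 / (4 * r)) = -(‖y‖ ^ 2 / (8 * r)) + -(‖y‖ ^ 2 / (4 * (2 * r))) by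
    field_simp; ring, exp_add]
  field_simp

lemma poly_mul_heatKernel_le {r p : ℝ} (hr : 0 < r) {y : Plane}
    (hp : p ≤ 2 / r * (1 + ‖y‖ ^ 2 / (8 * r))) :
    p * heatKernel r y ≤ 4 / r * heatKernel (2 * r) y := by
  have h2 := heatKernel_pos (r := 2 * r) (by positivity) y
  have h3 := Real.add_one_le_exp (‖y‖ ^ 2 / (8 * r))
  calc p * heatKernel r y ≤ 2 / r * (1 + ‖y‖ ^ 2 / (8 * r)) * heatKernel r y := by
        have := heatKernel_pos hr y
        gcongr
    _ ≤ 2 / r * exp (‖y‖ ^ 2 / (8 * r)) * heatKernel r y := by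
        have := heatKernel_pos hr y
        gcongr
        linarith
    _ = 4 / r * heatKernel (2 * r) y := by
        rw [heatKernel_eq_two hr, exp_neg]
        have := exp_pos (‖y‖ ^ 2 / (8 * r))
        field_simp
        norm_num

lemma abs_heatKernelDeriv_le {r : ℝ} (hr : 0 < r) (y : Plane) :
    |heatKernelDeriv r y| ≤ 4 / r * heatKernel (2 * r) y := by
  unfold heatKernelDeriv
  rw [abs_mul, abs_of_pos (heatKernel_pos hr y)]
  refine poly_mul_heatKernel_le hr ?_
  have h : 0 ≤ ‖y‖ ^ 2 / (4 * r ^ 2) := by positivity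
  have h0 : 0 < 1 / r := by positivity
  have e : 2 / r * (1 + ‖y‖ ^ 2 / (8 * r)) = 2 * (1 / r) + ‖y‖ ^ 2 / (4 * r ^ 2) := by
    field_simp; ring
  rw [e, abs_le]
  constructor <;> linarith

lemma sq_coord_le (y : Plane) (i : Fin 2) : y i ^ 2 ≤ ‖y‖ ^ 2 := by
  have := EuclideanSpace.norm_sq_eq y
  simp only [Fin.sum_univ_two, Real.norm_eq_abs, sq_abs] at this
  rw [this]
  fin_cases i <;> simp <;> positivity

lemma abs_second_deriv_heatKernel_le {r : ℝ} (hr : 0 < r) (y : Plane) (i : Fin 2) :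
    |(y i ^ 2 / (4 * r ^ 2) - 1 / (2 * r)) * heatKernel r y| ≤ 4 / r * heatKernel (2 * r) y := by
  rw [abs_mul, abs_of_pos (heatKernel_pos hr y)]
  refine poly_mul_heatKernel_le hr ?_
  have h : 0 ≤ y i ^ 2 / (4 * r ^ 2) := by positivity
  have h' : y i ^ 2 / (4 * r ^ 2) ≤ ‖y‖ ^ 2 / (4 * r ^ 2) := by
    have := sq_coord_le y i
    gcongr
  have h0 : 0 < 1 / r := by positivity
  have h00 : 1 / (2 * r) = 1 / r / 2 := by field_simp
  have e : 2 / r * (1 + ‖y‖ ^ 2 / (8 * r)) = 2 * (1 / r) + ‖y‖ ^ 2 / (4 * r ^ 2) := by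
    field_simp; ring
  rw [e, h00, abs_le]
  constructor <;> linarith

lemma norm_mul_heatKernel_le {r : ℝ} (hr : 0 < r) (y : Plane) :
    ‖y‖ * heatKernel r y ≤ 4 * √r * heatKernel (2 * r) y := by
  have h : ‖y‖ / √r ≤ 2 * (1 + ‖y‖ ^ 2 / (8 * r)) := by
    have hs : 0 < √r := Real.sqrt_pos.2 hr
    have e : ‖y‖ ^ 2 / (8 * r) = (‖y‖ / √r) ^ 2 / 8 := by
      rw [div_pow, Real.sq_sqrt hr.le]; field_simp
    rw [e]
    nlinarith [sq_nonneg (‖y‖ / √r - 2)]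
  have h2 := poly_mul_heatKernel_le hr (p := ‖y‖ / √r / r) (y := y) (by
    rw [div_mul_eq_mul_div]; gcongr)
  have hs : 0 < √r := Real.sqrt_pos.2 hr
  have h3 := heatKernel_pos hr y
  rw [div_mul_eq_mul_div, div_mul_eq_mul_div, div_mul_eq_mul_div (4 : ℝ),
    div_le_div_iff_of_pos_right hr, div_le_iff₀ hs] at h2
  linarith

lemma SchwartzMap.exists_abs_le (g : 𝓢(Plane, ℝ)) : ∃ M, 0 ≤ M ∧ ∀ x, |g x| ≤ M := by
  obtain ⟨C, hC⟩ := g.decay 0 0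
  exact ⟨C, hC.1.le, fun x ↦ by simpa using hC.2 x⟩

lemma SchwartzMap.integrable_bdd_mul (g : 𝓢(Plane, ℝ)) {k : Plane → ℝ}
    (hk : AEStronglyMeasurable k) {M : ℝ} (hM : ∀ y, |k y| ≤ M) :
    Integrable (fun y ↦ k y * g y) :=
  g.integrable.bdd_mul hk (ae_of_all _ hM)

lemma continuous_heatKernelDeriv (r : ℝ) : Continuous (heatKernelDeriv r) := by
  unfold heatKernelDeriv heatKernel; fun_prop

lemma SchwartzMap.laplacian_apply_eq (g : 𝓢(Plane, ℝ)) (x : Plane) :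
    (Δ g) x = ∑ i : Fin 2, (∂_{EuclideanSpace.single i (1 : ℝ)}
      (∂_{EuclideanSpace.single i (1 : ℝ)} g)) x := by
  rw [SchwartzMap.laplacian_eq_sum (EuclideanSpace.basisFun (Fin 2) ℝ) g, sum_apply]
  simp

lemma SchwartzMap.hasLineDerivAt (g : 𝓢(Plane, ℝ)) (x v : Plane) :
    HasLineDerivAt ℝ g ((∂_{v} g) x) x v := by
  rw [SchwartzMap.lineDerivOp_apply_eq_fderiv]
  exact (g.differentiableAt.hasFDerivAt).hasLineDerivAt v

/-- Integration by parts: the heat kernel's time derivative is its Laplacian. -/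
lemma integral_heatKernelDeriv_mul {r : ℝ} (hr : 0 < r) (x : Plane) (g : 𝓢(Plane, ℝ)) :
    ∫ y, heatKernelDeriv r (x - y) * g y = ∫ y, heatKernel r (x - y) * (Δ g) y := by
  have hr2 : 0 < 2 * r := by positivity
  have b0 : ∀ y, |heatKernel r (x - y)| ≤ (4 * π * r)⁻¹ := fun y ↦ by
    rw [abs_of_pos (heatKernel_pos hr _)]; exact heatKernel_le_inv hr _
  have b1 : ∀ i y, |(x - y) i / (2 * r) * heatKernel r (x - y)| ≤
      4 * √r * (4 * π * (2 * r))⁻¹ / (2 * r) := fun i y ↦ by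
    rw [abs_mul, abs_of_pos (heatKernel_pos hr _), abs_div, abs_of_pos hr2, div_mul_eq_mul_div]
    refine div_le_div_of_nonneg_right ?_ (by positivity)
    have h1 : |(x - y) i| ≤ ‖x - y‖ :=
      abs_le_of_sq_le_sq' (sq_coord_le _ _) (norm_nonneg _) |> abs_le.2
    refine (mul_le_mul_of_nonneg_right h1 (heatKernel_pos hr _).le).trans
      ((norm_mul_heatKernel_le hr _).trans ?_)
    have := heatKernel_le_inv hr2 (x - y)
    gcongr
  have b2 : ∀ i y, |((x - y) i ^ 2 / (4 * r ^ 2) - 1 / (2 * r)) * heatKernel r (x - y)| ≤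
      4 / r * (4 * π * (2 * r))⁻¹ := fun i y ↦ by
    refine (abs_second_deriv_heatKernel_le hr _ i).trans ?_
    have := heatKernel_le_inv hr2 (x - y)
    gcongr
  have m0 : Continuous fun y ↦ heatKernel r (x - y) := by unfold heatKernel; fun_prop
  have m1 : ∀ i, Continuous fun y ↦ (x - y) i / (2 * r) * heatKernel r (x - y) := fun i ↦ by
    unfold heatKernel; simp only [PiLp.sub_apply]; fun_prop
  have m2 : ∀ i, Continuous fun y ↦ ((x - y) i ^ 2 / (4 * r ^ 2) - 1 / (2 * r)) *
      heatKernel r (x - y) := fun i ↦ by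
    unfold heatKernel; simp only [PiLp.sub_apply]; fun_prop
  have i0 := fun h : 𝓢(Plane, ℝ) ↦ h.integrable_bdd_mul m0.aestronglyMeasurable b0
  have i1 := fun (h : 𝓢(Plane, ℝ)) i ↦ h.integrable_bdd_mul (m1 i).aestronglyMeasurable (b1 i)
  have i2 := fun (h : 𝓢(Plane, ℝ)) i ↦ h.integrable_bdd_mul (m2 i).aestronglyMeasurable (b2 i)
  have key : ∀ i : Fin 2, ∫ y, heatKernel r (x - y) * (∂_{EuclideanSpace.single i (1 : ℝ)}
      (∂_{EuclideanSpace.single i (1 : ℝ)} g)) y =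
      ∫ y, ((x - y) i ^ 2 / (4 * r ^ 2) - 1 / (2 * r)) * heatKernel r (x - y) * g y := by
    intro i
    have s1 := integral_bilinear_hasLineDerivAt_right_eq_neg_left_of_integrable (μ := volume)
      (B := ContinuousLinearMap.mul ℝ ℝ) (v := EuclideanSpace.single i (1 : ℝ))
      (i1 (∂_{EuclideanSpace.single i (1 : ℝ)} g) i)
      (i0 (∂_{EuclideanSpace.single i (1 : ℝ)} (∂_{EuclideanSpace.single i (1 : ℝ)} g)))
      (i0 (∂_{EuclideanSpace.single i (1 : ℝ)} g))
      (fun y _ ↦ hasLineDerivAt_heatKernel_sub r x y i)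
      (fun y _ ↦ SchwartzMap.hasLineDerivAt _ y _)
    have s2 := integral_bilinear_hasLineDerivAt_right_eq_neg_left_of_integrable (μ := volume)
      (B := ContinuousLinearMap.mul ℝ ℝ) (v := EuclideanSpace.single i (1 : ℝ))
      (i2 g i) (i1 (∂_{EuclideanSpace.single i (1 : ℝ)} g) i) (i1 g i)
      (fun y _ ↦ hasLineDerivAt_coord_mul_heatKernel_sub r x y i)
      (fun y _ ↦ SchwartzMap.hasLineDerivAt _ y _)
    simp only [ContinuousLinearMap.mul_apply'] at s1 s2
    rw [s1, s2, neg_neg]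
  simp_rw [SchwartzMap.laplacian_apply_eq, Fin.sum_univ_two, mul_add]
  rw [integral_add (i0 _) (i0 _), key, key, ← integral_add (i2 g 0) (i2 g 1)]
  refine integral_congr_ae (ae_of_all _ fun y ↦ ?_)
  have e : ‖x - y‖ ^ 2 = (x - y) 0 ^ 2 + (x - y) 1 ^ 2 := by
    simp [EuclideanSpace.norm_sq_eq, Fin.sum_univ_two]
  simp only [heatKernelDeriv, e]
  ring

/-- The heat semigroup of the plane. -/
noncomputable def heatOp (r : ℝ) (f : Plane → ℝ) (x : Plane) : ℝ :=
  ∫ y, heatKernel r (x - y) * f y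

lemma continuous_heatKernel_sub (r : ℝ) (x : Plane) : Continuous fun y ↦ heatKernel r (x - y) := by
  unfold heatKernel; fun_prop

lemma abs_heatOp_le {r M : ℝ} (hr : 0 < r) {f : Plane → ℝ} (hf : ∀ y, |f y| ≤ M) (x : Plane) :
    |heatOp r f x| ≤ M := by
  have h : ‖∫ y, heatKernel r (x - y) * f y‖ ≤ ∫ y, heatKernel r (x - y) * M := by
    refine norm_integral_le_of_norm_le ((integrable_heatKernel_sub hr x).mul_const M)
      (ae_of_all _ fun y ↦ ?_)
    have := heatKernel_pos hr (x - y)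
    rw [norm_mul, Real.norm_eq_abs, Real.norm_eq_abs, abs_of_pos this]
    exact mul_le_mul_of_nonneg_left (hf y) this.le
  rwa [integral_mul_const, integral_heatKernel_sub hr, one_mul] at h

lemma abs_heatOp_le_L2 {r : ℝ} (hr : 0 < r) {f : Plane → ℝ} (hf : MemLp f 2) (x : Plane) :
    |heatOp r f x| ≤ √((8 * π * r)⁻¹) * √(∫ y, f y ^ 2) := by
  rw [← integral_heatKernel_sq hr x]
  exact abs_integral_mul_le_sqrt (memLp_heatKernel_sub hr x) hf

lemma abs_heatOp_sub_le_L2 {r : ℝ} (hr : 0 < r) {f : Plane → ℝ} (hf : MemLp f 2) (x x' : Plane) :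
    |heatOp r f x - heatOp r f x'| ≤ ‖x - x'‖ / r * √(∫ y, f y ^ 2) := by
  have i : ∀ z, Integrable fun y ↦ heatKernel r (z - y) * f y :=
    fun z ↦ (memLp_heatKernel_sub hr z).integrable_mul hf
  have e : heatOp r f x - heatOp r f x' =
      ∫ y, (heatKernel r (x - y) - heatKernel r (x' - y)) * f y := by
    simp_rw [sub_mul]
    rw [integral_sub (i x) (i x')]
    rfl
  rw [e]
  refine (abs_integral_mul_le_sqrt ((memLp_heatKernel_sub hr x).sub
    (memLp_heatKernel_sub hr x')) hf).trans ?_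
  gcongr
  rw [Real.sqrt_le_left (by positivity)]
  refine (integral_heatKernel_sub_sq_le hr x x').trans ?_
  rw [div_pow]
  gcongr
  nlinarith [Real.pi_gt_three, sq_nonneg r]

lemma abs_heatOp_sub_self_le {r L : ℝ} (hr : 0 < r) {f : Plane → ℝ} (x : Plane)
    (hi : Integrable fun y ↦ heatKernel r (x - y) * f y) (hf : ∀ y, |f y - f x| ≤ L * ‖x - y‖)
    (hL : 0 ≤ L) : |heatOp r f x - f x| ≤ 4 * L * √r := by
  have e : heatOp r f x - f x = ∫ y, heatKernel r (x - y) * (f y - f x) := by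
    simp_rw [mul_sub]
    rw [integral_sub hi ((integrable_heatKernel_sub hr x).mul_const _), integral_mul_const,
      integral_heatKernel_sub hr, one_mul]
    rfl
  rw [e]
  have hr2 : 0 < 2 * r := by positivity
  have h : ‖∫ y, heatKernel r (x - y) * (f y - f x)‖ ≤
      ∫ y, 4 * L * √r * heatKernel (2 * r) (x - y) := by
    refine norm_integral_le_of_norm_le ((integrable_heatKernel_sub hr2 x).const_mul _)
      (ae_of_all _ fun y ↦ ?_)
    have := heatKernel_pos hr (x - y)
    rw [norm_mul, Real.norm_eq_abs, Real.norm_eq_abs, abs_of_pos this]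
    have h1 := mul_le_mul_of_nonneg_left (hf y) this.le
    have h2 := mul_le_mul_of_nonneg_left (norm_mul_heatKernel_le hr (x - y)) hL
    linarith
  rwa [integral_const_mul, integral_heatKernel_sub hr2, mul_one] at h

lemma SchwartzMap.exists_lipschitz (g : 𝓢(Plane, ℝ)) :
    ∃ L, 0 ≤ L ∧ ∀ x y, |g y - g x| ≤ L * ‖x - y‖ := by
  obtain ⟨C, hC⟩ := g.decay 0 1
  refine ⟨C, hC.1.le, fun x y ↦ ?_⟩
  have := Convex.norm_image_sub_le_of_norm_fderiv_le (𝕜 := ℝ) (f := g) (C := C) (s := Set.univ)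
    (x := x) (y := y) (fun z _ ↦ g.differentiableAt) (fun z _ ↦ ?_) convex_univ trivial trivial
  · rwa [Real.norm_eq_abs, norm_sub_rev] at this
  · have := hC.2 z
    rwa [pow_zero, one_mul, norm_iteratedFDeriv_one] at this

lemma abs_heatKernelDeriv_le_of_le {r₁ r r₂ : ℝ} (h : 0 < r₁) (h₁ : r₁ ≤ r) (h₂ : r ≤ r₂)
    (y : Plane) : |heatKernelDeriv r y| ≤ 4 / r₁ * (r₂ / r₁) * heatKernel (2 * r₂) y := by
  have hr : 0 < r := h.trans_le h₁
  have h3 := heatKernel_le_of_le (r₁ := 2 * r₁) (r := 2 * r) (r₂ := 2 * r₂) (by positivity)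
    (by linarith) (by linarith) y
  rw [mul_div_mul_left _ _ (two_ne_zero)] at h3
  have h4 := heatKernel_pos (r := 2 * r) (by positivity) y
  calc _ ≤ 4 / r * heatKernel (2 * r) y := abs_heatKernelDeriv_le hr y
    _ ≤ 4 / r₁ * heatKernel (2 * r) y := by gcongr
    _ ≤ 4 / r₁ * (r₂ / r₁ * heatKernel (2 * r₂) y) := by gcongr
    _ = _ := by ring

lemma abs_heatKernel_le_inv {r : ℝ} (hr : 0 < r) (y : Plane) :
    |heatKernel r y| ≤ (4 * π * r)⁻¹ := by
  rw [abs_of_pos (heatKernel_pos hr y)]; exact heatKernel_le_inv hr y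

lemma SchwartzMap.integrable_heatKernel_mul (g : 𝓢(Plane, ℝ)) {r : ℝ} (hr : 0 < r) (x : Plane) :
    Integrable fun y ↦ heatKernel r (x - y) * g y :=
  g.integrable_bdd_mul (continuous_heatKernel_sub r x).aestronglyMeasurable
    fun _ ↦ abs_heatKernel_le_inv hr _

lemma hasDerivAt_heatOp (g : 𝓢(Plane, ℝ)) {r : ℝ} (hr : 0 < r) (x : Plane) :
    HasDerivAt (fun r ↦ heatOp r g x) (heatOp r (Δ g : 𝓢(Plane, ℝ)) x) r := by
  have hC := g.exists_abs_le
  obtain ⟨M, hM, hg⟩ := hC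
  have h := (hasDerivAt_integral_of_dominated_loc_of_deriv_le (μ := volume)
    (F := fun r y ↦ heatKernel r (x - y) * g y) (F' := fun r y ↦ heatKernelDeriv r (x - y) * g y)
    (bound := fun y ↦ 4 / (r / 2) * (2 * r / (r / 2)) * heatKernel (2 * (2 * r)) (x - y) * M)
    (s := Set.Icc (r / 2) (2 * r)) (x₀ := r) (Icc_mem_nhds (by linarith) (by linarith))
    (Eventually.of_forall fun r ↦
      ((continuous_heatKernel_sub r x).mul g.continuous).aestronglyMeasurable)
    (g.integrable_heatKernel_mul hr x)
    ((((continuous_heatKernelDeriv r).comp (continuous_sub_left x)).mul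
      g.continuous).aestronglyMeasurable)
    (ae_of_all _ fun y r' hr' ↦ ?_) ?_ (ae_of_all _ fun y r' hr' ↦ ?_)).2
  · rwa [integral_heatKernelDeriv_mul hr x g] at h
  · rw [norm_mul]
    exact mul_le_mul (abs_heatKernelDeriv_le_of_le (by positivity) hr'.1 hr'.2 _) (hg y)
      (norm_nonneg _) (by have := heatKernel_pos (r := 2 * (2 * r)) (by positivity) (x - y)
                          positivity)
  · exact ((integrable_heatKernel_sub (by positivity) x).const_mul _).mul_const _
  · exact (hasDerivAt_heatKernel (by linarith [hr'.1]) _).mul_const _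

lemma abs_heatOp_sub_heatOp_le (g : 𝓢(Plane, ℝ)) {M : ℝ} (hM : ∀ y, |(Δ g) y| ≤ M) {r r' : ℝ}
    (hr : 0 < r) (hr' : 0 < r') (x : Plane) : |heatOp r' g x - heatOp r g x| ≤ M * |r' - r| :=
  Convex.norm_image_sub_le_of_norm_hasDerivWithin_le (f := fun r ↦ heatOp r g x)
    (f' := fun r ↦ heatOp r (Δ g : 𝓢(Plane, ℝ)) x) (s := Set.Ioi 0)
    (fun _ hs ↦ (hasDerivAt_heatOp g hs x).hasDerivWithinAt)
    (fun _ hs ↦ abs_heatOp_le hs hM x) (convex_Ioi 0) hr hr'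

lemma tendsto_heatOp_zero (g : 𝓢(Plane, ℝ)) (x : Plane) :
    Tendsto (fun r ↦ heatOp r g x) (𝓝[>] 0) (𝓝 (g x)) := by
  obtain ⟨L, hL, hg⟩ := g.exists_lipschitz
  rw [tendsto_iff_norm_sub_tendsto_zero]
  have h : Tendsto (fun r ↦ 4 * L * √r) (𝓝[>] 0) (𝓝 0) := by
    have : Tendsto (fun r ↦ 4 * L * √r) (𝓝 0) (𝓝 (4 * L * √0)) :=
      (continuous_const.mul Real.continuous_sqrt).tendsto 0
    rw [Real.sqrt_zero, mul_zero] at this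
    exact this.mono_left nhdsWithin_le_nhds
  refine squeeze_zero' (Eventually.of_forall fun _ ↦ norm_nonneg _) ?_ h
  filter_upwards [self_mem_nhdsWithin] with r hr
  exact abs_heatOp_sub_self_le hr x (g.integrable_heatKernel_mul hr x) (hg x) hL

lemma abs_heatOp_sub_self_le_laplacian (g : 𝓢(Plane, ℝ)) {M : ℝ} (hM : ∀ y, |(Δ g) y| ≤ M) {r : ℝ}
    (hr : 0 < r) (x : Plane) : |heatOp r g x - g x| ≤ M * r := by
  have h1 : Tendsto (fun r' ↦ |heatOp r g x - heatOp r' g x|) (𝓝[>] 0)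
    (𝓝 |heatOp r g x - g x|) := ((tendsto_heatOp_zero g x).const_sub _).abs
  have h2 : Tendsto (fun r' ↦ M * |r - r'|) (𝓝[>] 0) (𝓝 (M * r)) := by
    have : Tendsto (fun r' ↦ M * |r - r'|) (𝓝 0) (𝓝 (M * |r - 0|)) :=
      Continuous.tendsto (by fun_prop) 0
    rw [sub_zero, abs_of_pos hr] at this
    exact this.mono_left nhdsWithin_le_nhds
  refine le_of_tendsto_of_tendsto h1 h2 ?_
  filter_upwards [self_mem_nhdsWithin] with r' hr'
  exact abs_heatOp_sub_heatOp_le g hM hr' hr x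

lemma sq_heatOp_le {r : ℝ} (hr : 0 < r) (g : 𝓢(Plane, ℝ)) (x : Plane) :
    heatOp r g x ^ 2 ≤ ∫ y, heatKernel r (x - y) * g y ^ 2 := by
  have i0 := integrable_heatKernel_sub hr x
  have i1 := g.integrable_heatKernel_mul hr x
  have i2 : Integrable fun y ↦ heatKernel r (x - y) * g y ^ 2 :=
    (g.memLp 2).integrable_sq.bdd_mul (continuous_heatKernel_sub r x).aestronglyMeasurable
      (ae_of_all _ fun _ ↦ abs_heatKernel_le_inv hr _)
  have e : ∫ y, heatKernel r (x - y) * (g y - heatOp r g x) ^ 2 =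
      (∫ y, heatKernel r (x - y) * g y ^ 2) - heatOp r g x ^ 2 := by
    have e1 : ∀ y, heatKernel r (x - y) * (g y - heatOp r g x) ^ 2 =
        heatKernel r (x - y) * g y ^ 2 - (2 * heatOp r g x) * (heatKernel r (x - y) * g y) +
          heatKernel r (x - y) * heatOp r g x ^ 2 := fun y ↦ by ring
    simp_rw [e1]
    have i3 : Integrable fun y ↦ heatKernel r (x - y) * g y ^ 2 -
      (2 * heatOp r g x) * (heatKernel r (x - y) * g y) := i2.sub (i1.const_mul _)
    rw [integral_add i3 (i0.mul_const _), integral_sub i2 (i1.const_mul _), integral_const_mul,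
      integral_mul_const, integral_heatKernel_sub hr]
    change _ - 2 * heatOp r g x * heatOp r g x + _ = _
    ring
  have : 0 ≤ ∫ y, heatKernel r (x - y) * (g y - heatOp r g x) ^ 2 :=
    integral_nonneg fun y ↦ mul_nonneg (heatKernel_pos hr _).le (sq_nonneg _)
  linarith

/-- The heat semigroup contracts the `L²` norm. -/
lemma integral_sq_heatOp_le {r : ℝ} (hr : 0 < r) (g : 𝓢(Plane, ℝ)) :
    ∫ x, heatOp r g x ^ 2 ≤ ∫ x, g x ^ 2 := by
  have i2 := (g.memLp 2).integrable_sq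
  have h := integral_convolution (ContinuousLinearMap.mul ℝ ℝ) i2 (integrable_heatKernel hr)
  have hi := i2.integrable_convolution (ContinuousLinearMap.mul ℝ ℝ) (integrable_heatKernel hr)
  rw [integral_heatKernel hr] at h
  simp only [ContinuousLinearMap.mul_apply', mul_one] at h
  rw [← h]
  refine integral_mono_of_nonneg (ae_of_all _ fun x ↦ sq_nonneg _) hi (ae_of_all _ fun x ↦ ?_)
  refine (sq_heatOp_le hr g x).trans (le_of_eq ?_)
  simp [convolution, mul_comm]

section

/-- The `L²` norm of a real function on the plane. -/
noncomputable def l2norm (f : Plane → ℝ) : ℝ := √(∫ y, f y ^ 2)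

lemma l2norm_nonneg (f : Plane → ℝ) : 0 ≤ l2norm f := Real.sqrt_nonneg _

lemma l2norm_sq (f : Plane → ℝ) : l2norm f ^ 2 = ∫ y, f y ^ 2 :=
  Real.sq_sqrt (integral_nonneg fun _ ↦ sq_nonneg _)

/-- A solution of the heat equation on `[0, T]` with Schwartz slices, continuous in time at each
point, whose `L²` norm is `o(1 / √t)` as `t → 0`. -/
structure HeatFlow (T : ℝ) (u : ℝ → 𝓢(Plane, ℝ)) : Prop where
  pos : 0 < T
  cont : ∀ x, Continuous fun t ↦ u t x
  cont_lap : ∀ x, Continuous fun t ↦ (Δ (u t)) x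
  deriv : ∀ t ∈ Set.Ioo 0 T, ∀ x, HasDerivAt (fun s ↦ u s x) ((Δ (u t)) x) t
  bdd : ∃ M, 0 ≤ M ∧ ∀ t ∈ Set.Ioc 0 T, l2norm (u t) ≤ M / √t
  small : ∀ e > 0, ∃ δ > 0, ∀ t ∈ Set.Ioc 0 δ, l2norm (u t) ≤ e / √t

variable {T : ℝ} {u : ℝ → 𝓢(Plane, ℝ)}

lemma HeatFlow.exists_slope (hu : HeatFlow T u) {s t : ℝ} (hs : 0 ≤ s) (hst : s < t) (ht : t ≤ T)
    (x : Plane) : ∃ c ∈ Set.Ioo s t, (Δ (u c)) x = (u t x - u s x) / (t - s) :=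
  exists_hasDerivAt_eq_slope (fun t ↦ u t x) (fun t ↦ (Δ (u t)) x) hst (hu.cont x).continuousOn
    fun c hc ↦ hu.deriv c ⟨hs.trans_lt hc.1, hc.2.trans_le ht⟩ x

lemma HeatFlow.abs_sub_le (hu : HeatFlow T u) {n s t : ℝ} (hs : 0 ≤ s) (hst : s ≤ t) (ht : t ≤ T)
    {x : Plane} (hn : ∀ c ∈ Set.Icc s t, |(Δ (u c)) x| ≤ n) : |u t x - u s x| ≤ n * (t - s) := by
  rcases hst.eq_or_lt with rfl | hst
  · simp
  obtain ⟨c, hc, h⟩ := hu.exists_slope hs hst ht x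
  have h1 := hn c ⟨hc.1.le, hc.2.le⟩
  have h2 : 0 < t - s := sub_pos.2 hst
  rwa [h, abs_div, abs_of_pos h2, div_le_iff₀ h2] at h1

lemma HeatFlow.eq_heatOp_of_bdd (hu : HeatFlow T u) {n α β : ℝ} (hα : 0 ≤ α) (hαβ : α < β)
    (hβ : β ≤ T) (hn : ∀ s ∈ Set.Icc α β, ∀ x, |(Δ (u s)) x| ≤ n) (x : Plane) :
    u β x = heatOp (β - α) (u α) x := by
  have hn0 : 0 ≤ n := (abs_nonneg _).trans (hn α ⟨le_rfl, hαβ.le⟩ 0)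
  obtain ⟨M₀, hM₀, hM⟩ := (u α).exists_abs_le
  set M := M₀ + n * (β - α) with hMdef
  have hM' : ∀ s ∈ Set.Icc α β, ∀ y, |u s y| ≤ M := by
    intro s hs y
    have h1 := hu.abs_sub_le hα hs.1 (hs.2.trans hβ) (x := y)
      fun c hc ↦ hn c ⟨hc.1, hc.2.trans hs.2⟩ y
    have h2 : n * (s - α) ≤ n * (β - α) := by have := hs.2; gcongr
    have h3 := hM y
    have h4 : u s y = (u s y - u α y) + u α y := by ring
    rw [h4]
    exact (abs_add_le _ _).trans (by linarith)
  have hM1 : 0 ≤ M := (abs_nonneg _).trans (hM' α ⟨le_rfl, hαβ.le⟩ 0)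
  have meas : ∀ s, AEStronglyMeasurable fun y ↦ heatKernel (β - s) (x - y) * u s y := fun s ↦
    ((continuous_heatKernel_sub _ x).mul (u s).continuous).aestronglyMeasurable
  have hderiv : ∀ s ∈ Set.Ioo α β, HasDerivAt (fun s ↦ heatOp (β - s) (u s) x) 0 s := by
    intro s hs
    have hs1 := hs.1
    have hs2 := hs.2
    set R := (β - s) / 2 with hR
    have hR0 : 0 < R := by linarith
    have hn' : Set.Icc ((α + s) / 2) (s + R) ∈ 𝓝 s :=
      Icc_mem_nhds (by linarith) (by linarith)
    have h := (hasDerivAt_integral_of_dominated_loc_of_deriv_le (μ := volume)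
      (F := fun s y ↦ heatKernel (β - s) (x - y) * u s y)
      (F' := fun s y ↦ (heatKernelDeriv (β - s) (x - y) * (-1)) * u s y +
        heatKernel (β - s) (x - y) * (Δ (u s)) y)
      (bound := fun y ↦ 4 / R * ((β - α) / R) * heatKernel (2 * (β - α)) (x - y) * M +
        (β - α) / R * heatKernel (β - α) (x - y) * n)
      hn' (Eventually.of_forall meas)
      ((u s).integrable_heatKernel_mul (by linarith) x) ?_
      (ae_of_all _ fun y s' hs' ↦ ?_) ?_ (ae_of_all _ fun y s' hs' ↦ ?_)).2
    · have e : ∫ y, (heatKernelDeriv (β - s) (x - y) * (-1)) * u s y +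
          heatKernel (β - s) (x - y) * (Δ (u s)) y = 0 := by
        have hb : 0 < β - s := by linarith
        have hi := (Δ (u s)).integrable_heatKernel_mul hb x
        have hi' : Integrable fun y ↦ heatKernelDeriv (β - s) (x - y) * u s y :=
          (u s).integrable_bdd_mul
            ((continuous_heatKernelDeriv _).comp (continuous_sub_left x)).aestronglyMeasurable
            (M := 4 / (β - s) * (4 * π * (2 * (β - s)))⁻¹) fun y ↦ by
              refine (abs_heatKernelDeriv_le hb _).trans ?_
              have := heatKernel_le_inv (r := 2 * (β - s)) (by positivity) (x - y)
              gcongr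
        have e2 : ∀ y, (heatKernelDeriv (β - s) (x - y) * (-1)) * u s y +
          heatKernel (β - s) (x - y) * (Δ (u s)) y = heatKernel (β - s) (x - y) * (Δ (u s)) y -
            heatKernelDeriv (β - s) (x - y) * u s y := fun y ↦ by ring
        simp_rw [e2]
        rw [integral_sub hi hi', integral_heatKernelDeriv_mul hb, sub_self]
      rw [e] at h
      exact h
    · exact ((((continuous_heatKernelDeriv _).comp (continuous_sub_left x)).mul_const _ |>.mul
        (u s).continuous).add ((continuous_heatKernel_sub _ x).mul
        (Δ (u s)).continuous)).aestronglyMeasurable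
    · have hs3 : α < s' := by linarith [hs'.1]
      have hs4 := hs'.2
      have hs5 : s' ∈ Set.Icc α β := ⟨hs3.le, by linarith⟩
      have k1 := abs_heatKernelDeriv_le_of_le (r := β - s') (r₂ := β - α) hR0 (by linarith)
        (by linarith) (x - y)
      have k2 := heatKernel_le_of_le (r := β - s') (r₂ := β - α) hR0 (by linarith)
        (by linarith) (x - y)
      have k3 := heatKernel_pos (r := β - s') (by linarith) (x - y)
      have k4 := hM' s' hs5 y
      have k5 := hn s' hs5 y
      rw [Real.norm_eq_abs]
      refine (abs_add_le _ _).trans (add_le_add ?_ ?_)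
      · rw [abs_mul, abs_mul, abs_neg, abs_one, mul_one]
        exact mul_le_mul k1 k4 (abs_nonneg _) ((abs_nonneg _).trans k1)
      · rw [abs_mul, abs_of_pos k3]
        exact mul_le_mul k2 k5 (abs_nonneg _) (k3.le.trans k2)
    · exact (((integrable_heatKernel_sub (by linarith) x).const_mul _).mul_const _).add
        (((integrable_heatKernel_sub (by linarith) x).const_mul _).mul_const _)
    · have hs3 : α < s' := by linarith [hs'.1]
      have hs4 := hs'.2
      have h1 : HasDerivAt (fun s ↦ heatKernel (β - s) (x - y))
          (heatKernelDeriv (β - s') (x - y) * (-1)) s' :=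
        (hasDerivAt_heatKernel (r := β - s') (by linarith) (x - y)).comp s'
          ((hasDerivAt_id s').const_sub β)
      exact h1.mul (hu.deriv s' ⟨by linarith, by linarith⟩ y)
  have hcont : ∀ γ ∈ Set.Ioo α β, ContinuousOn (fun s ↦ heatOp (β - s) (u s) x) (Set.Icc α γ) := by
    intro γ hγ
    have hγ2 := hγ.2
    refine continuousOn_of_dominated (bound := fun y ↦ (β - α) / (β - γ) *
      heatKernel (β - α) (x - y) * M) (fun s _ ↦ meas s) (fun s hs ↦ ae_of_all _ fun y ↦ ?_)
      (((integrable_heatKernel_sub (by linarith) x).const_mul _).mul_const _)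
      (ae_of_all _ fun y ↦ ?_)
    · have hs1 := hs.1
      have hs2 := hs.2
      have k2 := heatKernel_le_of_le (r₁ := β - γ) (r := β - s) (r₂ := β - α) (by linarith)
        (by linarith) (by linarith) (x - y)
      have k3 := heatKernel_pos (r := β - s) (by linarith) (x - y)
      rw [Real.norm_eq_abs, abs_mul, abs_of_pos k3]
      exact mul_le_mul k2 (hM' s ⟨hs1, by linarith⟩ y) (abs_nonneg _) (k3.le.trans k2)
    · intro s hs
      have hs2 := hs.2
      have h1 : HasDerivAt (fun s ↦ heatKernel (β - s) (x - y))
          (heatKernelDeriv (β - s) (x - y) * (-1)) s :=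
        (hasDerivAt_heatKernel (r := β - s) (by linarith) (x - y)).comp s
          ((hasDerivAt_id s).const_sub β)
      exact (h1.continuousAt.mul (hu.cont y).continuousAt).continuousWithinAt
  have hconst : ∀ γ ∈ Set.Ioo α β, heatOp (β - γ) (u γ) x = heatOp (β - α) (u α) x := by
    intro γ hγ
    obtain ⟨c, hc, h⟩ := exists_hasDerivAt_eq_slope (fun s ↦ heatOp (β - s) (u s) x) (fun _ ↦ 0)
      hγ.1 (hcont γ hγ) fun c hc ↦ hderiv c ⟨hc.1, hc.2.trans hγ.2⟩
    have h2 : γ - α ≠ 0 := by have := hγ.1; intro h; linarith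
    field_simp at h
    linarith
  have hlim : ∀ γ ∈ Set.Ioo α β, |heatOp (β - α) (u α) x - u β x| ≤ 2 * n * (β - γ) := by
    intro γ hγ
    have hγ2 : 0 < β - γ := by linarith [hγ.2]
    rw [← hconst γ hγ]
    have h1 := abs_heatOp_sub_self_le_laplacian (u β) (hn β ⟨hαβ.le, le_rfl⟩) hγ2 x
    have h2 : heatOp (β - γ) (u γ) x - heatOp (β - γ) (u β) x =
        heatOp (β - γ) (fun y ↦ u γ y - u β y) x := by
      unfold heatOp
      rw [← integral_sub ((u γ).integrable_heatKernel_mul hγ2 x)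
        ((u β).integrable_heatKernel_mul hγ2 x)]
      simp_rw [mul_sub]
    have h3 : |heatOp (β - γ) (fun y ↦ u γ y - u β y) x| ≤ n * (β - γ) := by
      refine abs_heatOp_le hγ2 (fun y ↦ ?_) x
      rw [abs_sub_comm]
      exact hu.abs_sub_le (hα.trans hγ.1.le) hγ.2.le hβ fun c hc ↦
        hn c ⟨hγ.1.le.trans hc.1, hc.2⟩ y
    rw [← h2] at h3
    have h4 : heatOp (β - γ) (u γ) x - u β x = (heatOp (β - γ) (u γ) x - heatOp (β - γ) (u β) x) +
      (heatOp (β - γ) (u β) x - u β x) := by ring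
    rw [h4]
    exact (abs_add_le _ _).trans (by linarith)
  have hfin : |heatOp (β - α) (u α) x - u β x| ≤ 0 := by
    have : Tendsto (fun γ ↦ 2 * n * (β - γ)) (𝓝[<] β) (𝓝 0) := by
      have : Tendsto (fun γ ↦ 2 * n * (β - γ)) (𝓝 β) (𝓝 (2 * n * (β - β))) :=
        Continuous.tendsto (by fun_prop) β
      rw [sub_self, mul_zero] at this
      exact this.mono_left nhdsWithin_le_nhds
    refine ge_of_tendsto this ?_
    filter_upwards [Ioo_mem_nhdsLT hαβ] with γ hγ using hlim γ hγ
  have := abs_nonpos_iff.1 hfin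
  linarith

end

section

lemma heatKernel_mul_time {r r' : ℝ} (hr : 0 < r) (hr' : 0 < r') (y : Plane) :
    heatKernel r y * heatKernel r' y =
      (4 * π * (r + r'))⁻¹ * heatKernel (r * r' / (r + r')) y := by
  unfold heatKernel
  rw [mul_mul_mul_comm, ← exp_add, ← mul_assoc]
  congr 1
  · field_simp
  · congr 1
    field_simp
    ring

lemma integral_heatKernel_sub_time_sq {r r' : ℝ} (hr : 0 < r) (hr' : 0 < r') (x : Plane) :
    ∫ y, (heatKernel r (x - y) - heatKernel r' (x - y)) ^ 2 =
      (r - r') ^ 2 / (8 * π * (r * r' * (r + r'))) := by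
  have e : ∀ y, (heatKernel r (x - y) - heatKernel r' (x - y)) ^ 2 =
      heatKernel r (x - y) ^ 2 - 2 * (heatKernel r (x - y) * heatKernel r' (x - y)) +
        heatKernel r' (x - y) ^ 2 := fun y ↦ by ring
  simp_rw [e]
  have i1 := (memLp_heatKernel_sub hr x).integrable_sq
  have i2 := (memLp_heatKernel_sub hr' x).integrable_sq
  have i3 : Integrable fun y ↦ 2 * (heatKernel r (x - y) * heatKernel r' (x - y)) :=
    ((memLp_heatKernel_sub hr x).integrable_mul (memLp_heatKernel_sub hr' x)).const_mul 2
  have i4 : Integrable fun y ↦ heatKernel r (x - y) ^ 2 -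
    2 * (heatKernel r (x - y) * heatKernel r' (x - y)) := i1.sub i3
  rw [integral_add i4 i2, integral_sub i1 i3, integral_const_mul, integral_heatKernel_sq hr,
    integral_heatKernel_sq hr']
  simp_rw [heatKernel_mul_time hr hr']
  rw [integral_const_mul, integral_heatKernel_sub (by positivity)]
  field_simp
  ring

lemma abs_heatOp_sub_time_le {r r' : ℝ} (hr : 0 < r) (hr' : 0 < r') {f : Plane → ℝ}
    (hf : MemLp f 2) (x : Plane) :
    |heatOp r f x - heatOp r' f x| ≤ √((r - r') ^ 2 / (8 * π * (r * r' * (r + r')))) * l2norm f := by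
  have i : ∀ r > 0, Integrable fun y ↦ heatKernel r (x - y) * f y :=
    fun r hr ↦ (memLp_heatKernel_sub hr x).integrable_mul hf
  have e : heatOp r f x - heatOp r' f x =
      ∫ y, (heatKernel r (x - y) - heatKernel r' (x - y)) * f y := by
    simp_rw [sub_mul]
    rw [integral_sub (i r hr) (i r' hr')]
    rfl
  rw [e, ← integral_heatKernel_sub_time_sq hr hr' x]
  exact abs_integral_mul_le_sqrt ((memLp_heatKernel_sub hr x).sub (memLp_heatKernel_sub hr' x)) hf

/-- A bounded family in `L²` tending to zero pointwise tends to zero weakly. -/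
lemma tendsto_integral_mul_of_l2norm_bdd {α : Type*} [MeasurableSpace α] {μ : Measure α}
    {ι : Type*} {l : Filter ι} [l.IsCountablyGenerated] {k : α → ℝ} {w : ι → α → ℝ} {N : ℝ}
    (hk : MemLp k 2 μ) (hw : ∀ᶠ j in l, MemLp (w j) 2 μ) (hN : ∀ᶠ j in l, ∫ y, w j y ^ 2 ∂μ ≤ N)
    (h : ∀ y, Tendsto (fun j ↦ w j y) l (𝓝 0)) :
    Tendsto (fun j ↦ ∫ y, k y * w j y ∂μ) l (𝓝 0) := by
  rw [Metric.tendsto_nhds]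
  intro ε hε
  obtain ⟨m, hm, hNm⟩ : ∃ m : ℝ, 0 < m ∧ N / m < ε / 2 := by
    refine ⟨2 * (|N| + 1) / ε, by positivity, ?_⟩
    rw [div_div_eq_mul_div, div_lt_div_iff₀ (by positivity) (by positivity)]
    nlinarith [le_abs_self N, abs_nonneg N]
  have hX : Tendsto (fun j ↦ ∫ y, min (|k y * w j y|) (m * k y ^ 2) ∂μ) l (𝓝 (∫ _, 0 ∂μ)) := by
    refine tendsto_integral_filter_of_dominated_convergence (fun y ↦ m * k y ^ 2) ?_ ?_
      (hk.integrable_sq.const_mul m) (ae_of_all _ fun y ↦ ?_)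
    · filter_upwards [hw] with j hj
      exact (hk.integrable_mul hj).abs.aestronglyMeasurable.inf
        (hk.integrable_sq.const_mul m).aestronglyMeasurable
    · refine Eventually.of_forall fun j ↦ ae_of_all _ fun y ↦ ?_
      rw [Real.norm_eq_abs, abs_of_nonneg (le_min (abs_nonneg _) (by positivity))]
      exact min_le_right _ _
    · have h1 : Tendsto (fun j ↦ min (|k y * w j y|) (m * k y ^ 2)) l
          (𝓝 (min (|k y * 0|) (m * k y ^ 2))) :=
        (((h y).const_mul _).abs).min tendsto_const_nhds
      rwa [mul_zero, abs_zero, min_eq_left (by positivity)] at h1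
  rw [integral_zero] at hX
  filter_upwards [hw, hN, (Metric.tendsto_nhds.1 hX) (ε / 2) (by positivity)] with j hj hjN hjX
  rw [dist_zero_right, Real.norm_eq_abs] at hjX ⊢
  have hjX := (le_abs_self _).trans_lt hjX
  have i1 : Integrable (fun y ↦ k y * w j y) μ := hk.integrable_mul hj
  have i2 : Integrable (fun y ↦ m * k y ^ 2) μ := hk.integrable_sq.const_mul m
  have i3 : Integrable (fun y ↦ w j y ^ 2 / m) μ := hj.integrable_sq.div_const m
  have i4 : Integrable (fun y ↦ min (|k y * w j y|) (m * k y ^ 2)) μ := i1.abs.inf i2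
  calc |∫ y, k y * w j y ∂μ| ≤ ∫ y, |k y * w j y| ∂μ := abs_integral_le_integral_abs
    _ ≤ ∫ y, min (|k y * w j y|) (m * k y ^ 2) + w j y ^ 2 / m ∂μ := by
        refine integral_mono i1.abs (i4.add i3) fun y ↦ ?_
        have h0 : 0 ≤ w j y ^ 2 / m := by positivity
        rcases le_total (|k y * w j y|) (m * k y ^ 2) with h1 | h1
        · simp only [min_eq_left h1]; linarith
        · have h2 : |k y * w j y| ≤ w j y ^ 2 / m := by
            rw [le_div_iff₀ hm]
            rw [abs_mul] at h1 ⊢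
            rw [← sq_abs (k y)] at h1
            rw [← sq_abs (w j y)]
            rcases (abs_nonneg (k y)).eq_or_lt with h3 | h3
            · rw [← h3]; simp; positivity
            · have : m * |k y| ≤ |w j y| := by nlinarith
              nlinarith [abs_nonneg (w j y)]
          have h3 : 0 ≤ min (|k y * w j y|) (m * k y ^ 2) := le_min (abs_nonneg _) (by positivity)
          simp only
          linarith
    _ = (∫ y, min (|k y * w j y|) (m * k y ^ 2) ∂μ) + (∫ y, w j y ^ 2 ∂μ) / m := by
        rw [integral_add i4 i3, integral_div]
    _ < ε := by
        have : (∫ y, w j y ^ 2 ∂μ) / m ≤ N / m := by gcongr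
        linarith

variable {T : ℝ} {u : ℝ → 𝓢(Plane, ℝ)}

lemma HeatFlow.exists_l2norm_le (hu : HeatFlow T u) {s : ℝ} (hs : 0 < s) :
    ∃ N, ∀ t ∈ Set.Icc s T, l2norm (u t) ≤ N := by
  obtain ⟨M, hM, h⟩ := hu.bdd
  refine ⟨M / √s, fun t ht ↦ (h t ⟨hs.trans_le ht.1, ht.2⟩).trans ?_⟩
  have := Real.sqrt_pos.2 hs
  have := Real.sqrt_le_sqrt ht.1
  gcongr

/-- The semigroup identity passes to the left endpoint. -/
lemma HeatFlow.eq_heatOp_of_forall_gt (hu : HeatFlow T u) {α t : ℝ} (hα : 0 < α) (hαt : α < t)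
    (ht : t ≤ T) (x : Plane) (h : ∀ s ∈ Set.Ioo α t, u t x = heatOp (t - s) (u s) x) :
    u t x = heatOp (t - α) (u α) x := by
  obtain ⟨N, hN⟩ := hu.exists_l2norm_le hα
  have hr : 0 < t - α := sub_pos.2 hαt
  have hN0 : 0 ≤ N := (l2norm_nonneg _).trans (hN α ⟨le_rfl, by linarith⟩)
  have hnear : ∀ᶠ s in 𝓝[>] α, s ∈ Set.Ioo α t := Ioo_mem_nhdsGT hαt
  have h1 : Tendsto (fun s ↦ heatOp (t - α) (fun y ↦ u s y - u α y) x) (𝓝[>] α) (𝓝 0) := by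
    refine tendsto_integral_mul_of_l2norm_bdd (N := 2 * N ^ 2 + 2 * N ^ 2)
      (memLp_heatKernel_sub hr x)
      (Eventually.of_forall fun s ↦ ((u s).memLp 2).sub ((u α).memLp 2)) ?_ fun y ↦ ?_
    · filter_upwards [hnear] with s hs
      have i1 := ((u s).memLp 2).integrable_sq.const_mul 2
      have i2 := ((u α).memLp 2).integrable_sq.const_mul 2
      calc ∫ y, (u s y - u α y) ^ 2 ≤ ∫ y, 2 * u s y ^ 2 + 2 * u α y ^ 2 :=
            integral_mono (((u s).memLp 2).sub ((u α).memLp 2)).integrable_sq (i1.add i2)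
              fun y ↦ by simp only; nlinarith [sq_nonneg (u s y + u α y)]
        _ = 2 * l2norm (u s) ^ 2 + 2 * l2norm (u α) ^ 2 := by
            rw [integral_add i1 i2, integral_const_mul, integral_const_mul, l2norm_sq, l2norm_sq]
        _ ≤ _ := by
            have k1 := hN s ⟨hs.1.le, hs.2.le.trans ht⟩
            have k2 := hN α ⟨le_rfl, by linarith⟩
            have := l2norm_nonneg (u s)
            have := l2norm_nonneg (u α)
            gcongr
    · have := ((hu.cont y).tendsto α).sub_const (u α y)
      rw [sub_self] at this
      exact this.mono_left nhdsWithin_le_nhds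
  have h2 : Tendsto (fun s ↦ heatOp (t - s) (u s) x - heatOp (t - α) (u s) x) (𝓝[>] α) (𝓝 0) := by
    have h3 : Tendsto (fun s ↦ √((t - s - (t - α)) ^ 2 /
        (8 * π * ((t - s) * (t - α) * (t - s + (t - α))))) * N) (𝓝[>] α) (𝓝 0) := by
      have : ContinuousAt (fun s ↦ √((t - s - (t - α)) ^ 2 /
        (8 * π * ((t - s) * (t - α) * (t - s + (t - α))))) * N) α := by
        refine ContinuousAt.mul (Real.continuous_sqrt.continuousAt.comp
          (ContinuousAt.div (by fun_prop) (by fun_prop) ?_)) continuousAt_const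
        positivity
      have := this.tendsto
      simp only [sub_self, ne_eq, OfNat.ofNat_ne_zero, not_false_eq_true, zero_pow, zero_div,
        Real.sqrt_zero, zero_mul] at this
      exact this.mono_left nhdsWithin_le_nhds
    refine squeeze_zero_norm' ?_ h3
    filter_upwards [hnear] with s hs
    refine (abs_heatOp_sub_time_le (sub_pos.2 hs.2) hr ((u s).memLp 2) x).trans ?_
    have := hN s ⟨hs.1.le, hs.2.le.trans ht⟩
    gcongr
  have h3 : Tendsto (fun _ : ℝ ↦ u t x - heatOp (t - α) (u α) x) (𝓝[>] α) (𝓝 (0 + 0)) := by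
    refine (h2.add h1).congr' ?_
    filter_upwards [hnear] with s hs
    have e : heatOp (t - α) (fun y ↦ u s y - u α y) x =
        heatOp (t - α) (u s) x - heatOp (t - α) (u α) x := by
      unfold heatOp
      rw [← integral_sub ((u s).integrable_heatKernel_mul hr x)
        ((u α).integrable_heatKernel_mul hr x)]
      simp_rw [mul_sub]
    rw [e, ← h s hs]
    ring
  have := tendsto_nhds_unique h3 tendsto_const_nhds
  linarith

end

section

variable {T : ℝ} {u : ℝ → 𝓢(Plane, ℝ)}

/-- A portion of a nonempty closed set covered by countably many closed sets is contained in one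
of them. -/
lemma exists_portion_subset {X : Type*} [MetricSpace X] [CompleteSpace X] {L : Set X}
    (hL : IsClosed L) (hne : L.Nonempty) {C : ℕ → Set X} (hC : ∀ n, IsClosed (C n))
    (hcover : L ⊆ ⋃ n, C n) :
    ∃ n, ∃ x ∈ L, ∃ δ > 0, ∀ y ∈ L, dist y x < δ → y ∈ C n := by
  have := hL.completeSpace_coe
  have := hne.to_subtype
  obtain ⟨n, x, hx⟩ := nonempty_interior_of_iUnion_of_closed (X := L)
    (f := fun n ↦ Subtype.val ⁻¹' C n) (fun n ↦ (hC n).preimage continuous_subtype_val)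
    (Set.eq_univ_of_forall fun x ↦ by simpa using hcover x.2)
  obtain ⟨δ, hδ, h⟩ := Metric.isOpen_iff.1 isOpen_interior x hx
  refine ⟨n, x, x.2, δ, hδ, fun y hy hyx ↦ ?_⟩
  have := interior_subset (h (Metric.mem_ball.2 (by exact hyx) : (⟨y, hy⟩ : L) ∈ _))
  exact this

/-- The Laplacian of the flow is bounded uniformly in space, for times in `I` near `t`. -/
def LaplacianBddNear (u : ℝ → 𝓢(Plane, ℝ)) (I : Set ℝ) (t : ℝ) : Prop :=
  ∃ n : ℝ, ∀ᶠ s in 𝓝 t, s ∈ I → ∀ x, |(Δ (u s)) x| ≤ n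

lemma isOpen_laplacianBddNear (u : ℝ → 𝓢(Plane, ℝ)) (I : Set ℝ) :
    IsOpen {t | LaplacianBddNear u I t} := by
  rw [isOpen_iff_mem_nhds]
  rintro t ⟨n, hn⟩
  filter_upwards [eventually_eventually_nhds.2 hn] with s hs
  exact ⟨n, hs⟩

lemma exists_laplacian_le_of_bddNear {I K : Set ℝ} (hK : IsCompact K) (hKI : K ⊆ I)
    (h : ∀ t ∈ K, LaplacianBddNear u I t) : ∃ n : ℝ, ∀ t ∈ K, ∀ x, |(Δ (u t)) x| ≤ n := by
  refine hK.induction_on (p := fun S ↦ ∃ n : ℝ, ∀ t ∈ S, ∀ x, |(Δ (u t)) x| ≤ n) ?_ ?_ ?_ ?_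
  · exact ⟨0, by simp⟩
  · rintro S S' hS ⟨n, hn⟩
    exact ⟨n, fun t ht ↦ hn t (hS ht)⟩
  · rintro S S' ⟨n, hn⟩ ⟨m, hm⟩
    refine ⟨max n m, fun t ht x ↦ ?_⟩
    rcases ht with ht | ht
    · exact (hn t ht x).trans (le_max_left _ _)
    · exact (hm t ht x).trans (le_max_right _ _)
  · intro t ht
    obtain ⟨n, hn⟩ := h t ht
    refine ⟨_ ∩ K,
      inter_mem (nhdsWithin_le_nhds hn) self_mem_nhdsWithin, n, fun s hs ↦ hs.1 (hKI hs.2)⟩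

lemma HeatFlow.isClosed_laplacian_le (hu : HeatFlow T u) (n : ℝ) :
    IsClosed {t | ∀ x, |(Δ (u t)) x| ≤ n} := by
  simp only [Set.ofPred_forall]
  exact isClosed_iInter fun x ↦ isClosed_le (hu.cont_lap x).abs continuous_const

/-- If the Laplacian is locally bounded on `(α, t]` then the bound at time `α` propagates. -/
lemma HeatFlow.laplacian_le_of_bddNear (hu : HeatFlow T u) {α t n : ℝ} {I : Set ℝ} (hα : 0 < α)
    (hαt : α < t) (ht : t ≤ T) (hI : Set.Icc α t ⊆ I) (hn : ∀ x, |(Δ (u α)) x| ≤ n)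
    (h : ∀ s ∈ Set.Ioc α t, LaplacianBddNear u I s) (x : Plane) : |(Δ (u t)) x| ≤ n := by
  have hrep : ∀ t' ∈ Set.Ioc α t, u t' x = heatOp (t' - α) (u α) x := by
    intro t' ht'
    refine hu.eq_heatOp_of_forall_gt hα ht'.1 (ht'.2.trans ht) x fun s hs ↦ ?_
    obtain ⟨m, hm⟩ := exists_laplacian_le_of_bddNear (u := u) (I := I) isCompact_Icc
      (K := Set.Icc s t') (fun r hr ↦ hI ⟨hs.1.le.trans hr.1, hr.2.trans ht'.2⟩)
      fun r hr ↦ h r ⟨hs.1.trans_le hr.1, hr.2.trans ht'.2⟩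
    exact hu.eq_heatOp_of_bdd (hα.trans hs.1).le hs.2 (ht'.2.trans ht) hm x
  have hcl : t ∈ closure {c | |(Δ (u c)) x| ≤ n} := by
    rw [Metric.mem_closure_iff]
    intro ε hε
    obtain ⟨t', ht'1, ht'2⟩ : ∃ t', max α (t - ε) < t' ∧ t' < t :=
      exists_between (max_lt hαt (by linarith))
    rw [max_lt_iff] at ht'1
    obtain ⟨c, hc, hs⟩ := hu.exists_slope (hα.trans ht'1.1).le ht'2 ht x
    refine ⟨c, ?_, ?_⟩
    · have h1 := abs_heatOp_sub_heatOp_le (u α) hn (sub_pos.2 ht'1.1) (sub_pos.2 hαt) x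
      rw [← hrep t' ⟨ht'1.1, ht'2.le⟩, ← hrep t ⟨hαt, le_rfl⟩, sub_sub_sub_cancel_right] at h1
      have h2 : 0 < t - t' := sub_pos.2 ht'2
      change |(Δ (u c)) x| ≤ n
      rwa [hs, abs_div, div_le_iff₀ (abs_pos.2 h2.ne')]
    · rw [Real.dist_eq, abs_lt]
      constructor <;> linarith [hc.1, hc.2]
  rwa [(isClosed_le (hu.cont_lap x).abs continuous_const).closure_eq] at hcl

/-- The Laplacian of the flow is bounded uniformly in space and in time away from time zero. -/
lemma HeatFlow.exists_laplacian_le (hu : HeatFlow T u) {s₀ : ℝ} (hs₀ : 0 < s₀) :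
    ∃ n : ℝ, ∀ t ∈ Set.Icc s₀ T, ∀ x, |(Δ (u t)) x| ≤ n := by
  refine exists_laplacian_le_of_bddNear isCompact_Icc (K := Set.Icc s₀ T) subset_rfl ?_
  by_contra hcon
  push Not at hcon
  set I := Set.Icc s₀ T with hIdef
  set L : Set ℝ := I ∩ {t | ¬ LaplacianBddNear u I t} with hL
  have hLc : IsClosed L := isClosed_Icc.inter (isOpen_laplacianBddNear u I).isClosed_compl
  obtain ⟨n, t₁, ht₁, δ, hδ, hport⟩ := exists_portion_subset hLc hcon
    (C := fun n : ℕ ↦ {t | ∀ x, |(Δ (u t)) x| ≤ (n : ℝ)}) (fun n ↦ hu.isClosed_laplacian_le n) (by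
      intro t _
      obtain ⟨M, -, hM⟩ := (Δ (u t)).exists_abs_le
      obtain ⟨n, hn⟩ := exists_nat_ge M
      exact Set.mem_iUnion.2 ⟨n, fun x ↦ (hM x).trans hn⟩)
  set s := max s₀ (t₁ - δ / 2) with hs
  have hs1 : s₀ ≤ s := le_max_left _ _
  have hs2 : t₁ - δ / 2 ≤ s := le_max_right _ _
  obtain ⟨m, -, hm⟩ := (Δ (u s)).exists_abs_le
  refine ht₁.2 ⟨max (n : ℝ) m, ?_⟩
  have hnear : ∀ᶠ t in 𝓝 t₁, t ∈ Set.Ioo (t₁ - δ / 2) (t₁ + δ) :=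
    Ioo_mem_nhds (by linarith) (by linarith)
  filter_upwards [hnear] with t ht htI
  have hst : s ≤ t := max_le htI.1 ht.1.le
  obtain ⟨α, hα, hmax⟩ := (isCompact_Icc (a := s) (b := t)).inter_left
    (hLc.union (isClosed_singleton (x := s))) |>.exists_isGreatest ⟨s, Or.inr rfl, le_rfl, hst⟩
  have hαn : ∀ x, |(Δ (u α)) x| ≤ max (n : ℝ) m := by
    intro x
    rcases hα.1 with h | h
    · refine (hport α h ?_ x).trans (le_max_left _ _)
      rw [Real.dist_eq, abs_lt]
      constructor <;> linarith [hα.2.1, hα.2.2, ht.2]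
    · rw [Set.mem_singleton_iff.1 h]
      exact (hm x).trans (le_max_right _ _)
  rcases hα.2.2.eq_or_lt with rfl | hαt
  · exact hαn
  refine fun x ↦ hu.laplacian_le_of_bddNear (I := I) (by linarith [hα.2.1]) hαt htI.2
    (fun r hr ↦ ⟨by linarith [hα.2.1, hr.1], hr.2.trans htI.2⟩) hαn (fun r hr ↦ ?_) x
  by_contra hr'
  have hrL : r ∈ L := ⟨⟨by linarith [hα.2.1, hr.1], hr.2.trans htI.2⟩, hr'⟩
  exact hr.1.not_ge (hmax ⟨Or.inl hrL, by linarith [hα.2.1, hr.1], hr.2⟩)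

/-- Away from time zero the flow is given by the heat semigroup. -/
theorem HeatFlow.eq_heatOp (hu : HeatFlow T u) {s t : ℝ} (hs : 0 < s) (hst : s < t) (ht : t ≤ T)
    (x : Plane) : u t x = heatOp (t - s) (u s) x := by
  obtain ⟨n, hn⟩ := hu.exists_laplacian_le hs
  exact hu.eq_heatOp_of_bdd hs.le hst ht (fun c hc ↦ hn c ⟨hc.1, hc.2.trans ht⟩) x

end

section

variable {T : ℝ} {u : ℝ → 𝓢(Plane, ℝ)}

lemma HeatFlow.abs_sub_le_of_l2norm_le (hu : HeatFlow T u) {e δ : ℝ} (hδ : δ ≤ T)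
    (he : ∀ t ∈ Set.Ioc 0 δ, l2norm (u t) ≤ e / √t) {t : ℝ} (ht : t ∈ Set.Ioc 0 δ) (x x' : Plane) :
    |u t x - u t x'| ≤ 4 * e * ‖x - x'‖ / (t * √t) := by
  have ht0 := ht.1
  have h2 : 0 < t / 2 := by linarith
  have hsq := Real.sqrt_pos.2 ht0
  have h := abs_heatOp_sub_le_L2 h2 ((u (t / 2)).memLp 2) x x'
  have e1 : t - t / 2 = t / 2 := by ring
  have hx := hu.eq_heatOp h2 (by linarith) (ht.2.trans hδ) x
  have hx' := hu.eq_heatOp h2 (by linarith) (ht.2.trans hδ) x'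
  rw [e1] at hx hx'
  rw [← hx, ← hx'] at h
  have h3 := he (t / 2) ⟨h2, by linarith [ht.2]⟩
  have hE : 0 ≤ e := by
    have := (l2norm_nonneg _).trans h3
    by_contra hcon
    exact this.not_gt (div_neg_of_neg_of_pos (by linarith) (Real.sqrt_pos.2 h2))
  have h4 : e / √(t / 2) ≤ 2 * e / √t := by
    rw [div_le_div_iff₀ (Real.sqrt_pos.2 h2) hsq]
    have : √t ≤ 2 * √(t / 2) := by
      rw [Real.sqrt_le_left (by positivity), mul_pow, Real.sq_sqrt h2.le]
      linarith
    nlinarith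
  calc |u t x - u t x'| ≤ ‖x - x'‖ / (t / 2) * l2norm (u (t / 2)) := h
    _ ≤ ‖x - x'‖ / (t / 2) * (2 * e / √t) := by gcongr; exact h3.trans h4
    _ = _ := by field_simp; ring

lemma SchwartzMap.laplacian_neg_apply (f : 𝓢(Plane, ℝ)) (x : Plane) :
    (Δ (-f) : 𝓢(Plane, ℝ)) x = -(Δ f : 𝓢(Plane, ℝ)) x := by
  simp [SchwartzMap.laplacian_apply_eq, LineDeriv.lineDerivOp_neg]

lemma HeatFlow.neg (hu : HeatFlow T u) : HeatFlow T fun t ↦ -u t where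
  pos := hu.pos
  cont x := (hu.cont x).neg
  cont_lap x := by
    simp only [SchwartzMap.laplacian_neg_apply]
    exact (hu.cont_lap x).neg
  deriv t ht x := by
    simp only [SchwartzMap.laplacian_neg_apply]
    exact (hu.deriv t ht x).neg
  bdd := by
    have h : ∀ t, l2norm (-u t) = l2norm (u t) := fun t ↦ by simp [l2norm]
    simpa [h] using hu.bdd
  small := by
    have h : ∀ t, l2norm (-u t) = l2norm (u t) := fun t ↦ by simp [l2norm]
    simpa [h] using hu.small

lemma HeatFlow.stronglyMeasurable (hu : HeatFlow T u) :
    StronglyMeasurable (fun p : ℝ × Plane ↦ u p.1 p.2) :=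
  stronglyMeasurable_uncurry_of_continuous_of_stronglyMeasurable (ι := ℝ) (α := Plane)
    (u := fun s y ↦ u s y) hu.cont fun s ↦ (u s).continuous.stronglyMeasurable

end

section

variable {T : ℝ} {u : ℝ → 𝓢(Plane, ℝ)}

/-- The time integral of a family of functions, starting from time `0`. -/
noncomputable def timeInt (u : ℝ → 𝓢(Plane, ℝ)) (t : ℝ) (x : Plane) : ℝ :=
  ∫ s in (0 : ℝ)..t, u s x

lemma integrableOn_inv_sqrt (t : ℝ) : IntegrableOn (fun s ↦ (√s)⁻¹) (Set.Ioc 0 t) := by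
  rcases le_or_gt t 0 with ht | ht
  · simp [Set.Ioc_eq_empty_of_le ht]
  have h := (intervalIntegral.intervalIntegrable_rpow' (a := 0) (b := t) (r := -(1 / 2))
    (by norm_num)).1
  refine h.congr_fun (fun s hs ↦ ?_) measurableSet_Ioc
  simp only
  rw [Real.rpow_neg hs.1.le, Real.sqrt_eq_rpow]

lemma integral_inv_sqrt {t : ℝ} (ht : 0 ≤ t) : ∫ s in Set.Ioc 0 t, (√s)⁻¹ = 2 * √t := by
  have h := integral_rpow (a := 0) (b := t) (r := -(1 / 2)) (Or.inl (by norm_num))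
  rw [intervalIntegral.integral_of_le ht] at h
  have h2 : ∫ s in Set.Ioc 0 t, (√s)⁻¹ = ∫ s in Set.Ioc 0 t, s ^ (-(1 / 2) : ℝ) := by
    refine setIntegral_congr_fun measurableSet_Ioc fun s hs ↦ ?_
    rw [Real.rpow_neg hs.1.le, Real.sqrt_eq_rpow]
  rw [h2, h, Real.zero_rpow (by norm_num), Real.sqrt_eq_rpow]
  norm_num
  ring

lemma HeatFlow.continuous_timeInt (hu : HeatFlow T u) (x : Plane) :
    Continuous fun t ↦ timeInt u t x :=
  intervalIntegral.continuous_primitive (fun _ _ ↦ (hu.cont x).intervalIntegrable _ _) 0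

lemma HeatFlow.hasDerivAt_timeInt (hu : HeatFlow T u) (x : Plane) (t : ℝ) :
    HasDerivAt (fun t ↦ timeInt u t x) (u t x) t :=
  (hu.cont x).integral_hasStrictDerivAt 0 t |>.hasDerivAt

lemma HeatFlow.stronglyMeasurable_timeInt (hu : HeatFlow T u) (t : ℝ) :
    StronglyMeasurable (timeInt u t) := by
  unfold timeInt
  simp only [intervalIntegral]
  have h := hu.stronglyMeasurable
  have h' : StronglyMeasurable fun p : Plane × ℝ ↦ u p.2 p.1 := h.comp_measurable measurable_swap
  exact h'.integral_prod_right.sub h'.integral_prod_right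

lemma HeatFlow.sq_timeInt_le (hu : HeatFlow T u) {t : ℝ} (ht : 0 ≤ t) (x : Plane) :
    timeInt u t x ^ 2 ≤ 2 * √t * ∫ s in Set.Ioc 0 t, √s * u s x ^ 2 := by
  have hc : IntegrableOn (fun s ↦ √s * u s x ^ 2) (Set.Ioc 0 t) :=
    (Continuous.integrableOn_Icc (by have := hu.cont x; fun_prop)).mono_set Set.Ioc_subset_Icc_self
  have e1 : ∀ s, (√√s)⁻¹ ^ 2 = (√s)⁻¹ := fun s ↦ by
    rw [inv_pow, Real.sq_sqrt (Real.sqrt_nonneg _)]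
  have e2 : ∀ s, (√√s * u s x) ^ 2 = √s * u s x ^ 2 := fun s ↦ by
    rw [mul_pow, Real.sq_sqrt (Real.sqrt_nonneg _)]
  have m1 : MemLp (fun s : ℝ ↦ (√√s)⁻¹) 2 (volume.restrict (Set.Ioc 0 t)) := by
    rw [memLp_two_iff_integrable_sq (by fun_prop)]
    simp only [e1]
    exact integrableOn_inv_sqrt t
  have m2 : MemLp (fun s : ℝ ↦ √√s * u s x) 2 (volume.restrict (Set.Ioc 0 t)) := by
    have := hu.cont x
    rw [memLp_two_iff_integrable_sq (by fun_prop)]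
    simp only [e2]
    exact hc
  have h := abs_integral_mul_le_sqrt m1 m2
  have e3 : ∫ s in Set.Ioc 0 t, (√√s)⁻¹ * (√√s * u s x) = timeInt u t x := by
    rw [timeInt, intervalIntegral.integral_of_le ht]
    refine setIntegral_congr_fun measurableSet_Ioc fun s hs ↦ ?_
    have := Real.sqrt_pos.2 (Real.sqrt_pos.2 hs.1)
    field_simp
  simp only [e1, e2, e3, integral_inv_sqrt ht] at h
  have hn : 0 ≤ ∫ s in Set.Ioc 0 t, √s * u s x ^ 2 := integral_nonneg fun s ↦ by positivity
  calc timeInt u t x ^ 2 = |timeInt u t x| ^ 2 := (sq_abs _).symm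
    _ ≤ (√(2 * √t) * √(∫ s in Set.Ioc 0 t, √s * u s x ^ 2)) ^ 2 := by gcongr
    _ = _ := by rw [mul_pow, Real.sq_sqrt (by positivity), Real.sq_sqrt hn]

lemma HeatFlow.integral_l2norm_aux (hu : HeatFlow T u) {e t : ℝ} 
    (he : ∀ s ∈ Set.Ioc 0 t, l2norm (u s) ≤ e / √s) :
    Integrable (fun p : ℝ × Plane ↦ √p.1 * u p.1 p.2 ^ 2)
      ((volume.restrict (Set.Ioc 0 t)).prod volume) ∧
    ∀ s ∈ Set.Ioc 0 t, ∫ y, √s * u s y ^ 2 ≤ e ^ 2 * (√s)⁻¹ := by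
  have hb : ∀ s ∈ Set.Ioc 0 t, ∫ y, √s * u s y ^ 2 ≤ e ^ 2 * (√s)⁻¹ := by
    intro s hs
    have h1 := he s hs
    have h2 := Real.sqrt_pos.2 hs.1
    rw [integral_const_mul, ← l2norm_sq]
    calc √s * l2norm (u s) ^ 2 ≤ √s * (e / √s) ^ 2 := by
          have := l2norm_nonneg (u s); gcongr
      _ = _ := by field_simp
  refine ⟨?_, hb⟩
  have hm := hu.stronglyMeasurable
  have hm' : StronglyMeasurable fun p : ℝ × Plane ↦ √p.1 * u p.1 p.2 ^ 2 :=
    (by fun_prop : Continuous fun p : ℝ × Plane ↦ √p.1).stronglyMeasurable.mul (hm.pow 2)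
  rw [integrable_prod_iff hm'.aestronglyMeasurable]
  refine ⟨.of_forall fun s ↦ (((u s).memLp 2).integrable_sq).const_mul (√s), ?_⟩
  have e1 : ∀ s y, ‖√s * u s y ^ 2‖ = √s * u s y ^ 2 := fun s y ↦
    Real.norm_of_nonneg (by positivity)
  simp only [e1]
  refine Integrable.mono' ((integrableOn_inv_sqrt t).const_mul (e ^ 2))
    hm'.integral_prod_right.aestronglyMeasurable ?_
  rw [ae_restrict_iff' measurableSet_Ioc]
  refine .of_forall fun s hs ↦ ?_
  rw [Real.norm_of_nonneg (integral_nonneg fun y ↦ by positivity)]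
  exact hb s hs

lemma HeatFlow.memLp_timeInt (hu : HeatFlow T u) {e t : ℝ} (ht : 0 ≤ t)
    (he : ∀ s ∈ Set.Ioc 0 t, l2norm (u s) ≤ e / √s) :
    MemLp (timeInt u t) 2 ∧ ∫ x, timeInt u t x ^ 2 ≤ e ^ 2 * (4 * t) := by
  obtain ⟨hi, hb⟩ := hu.integral_l2norm_aux he
  have hi' := hi.integral_prod_right.const_mul (2 * √t)
  have hm := (hu.stronglyMeasurable_timeInt t).aestronglyMeasurable (μ := volume)
  have hI : Integrable fun x ↦ timeInt u t x ^ 2 := by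
    refine hi'.mono' (hm.pow 2) (.of_forall fun x ↦ ?_)
    rw [Real.norm_of_nonneg (sq_nonneg _)]
    exact hu.sq_timeInt_le ht x
  refine ⟨(memLp_two_iff_integrable_sq hm).2 hI, ?_⟩
  calc ∫ x, timeInt u t x ^ 2 ≤ ∫ x, 2 * √t * ∫ s in Set.Ioc 0 t, √s * u s x ^ 2 :=
        integral_mono hI hi' (hu.sq_timeInt_le ht)
    _ = 2 * √t * ∫ s in Set.Ioc 0 t, ∫ x, √s * u s x ^ 2 := by
        rw [integral_const_mul, ← integral_integral_swap hi]
    _ ≤ 2 * √t * ∫ s in Set.Ioc 0 t, e ^ 2 * (√s)⁻¹ := by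
        refine mul_le_mul_of_nonneg_left ?_ (by positivity)
        exact setIntegral_mono_on hi.integral_prod_left ((integrableOn_inv_sqrt t).const_mul _)
          measurableSet_Ioc hb
    _ = e ^ 2 * (4 * t) := by
        rw [integral_const_mul, integral_inv_sqrt ht]
        linear_combination 4 * e ^ 2 * Real.sq_sqrt ht

lemma HeatFlow.integral_mul_timeInt (hu : HeatFlow T u) {t : ℝ} (ht : t ∈ Set.Icc 0 T)
    {k : Plane → ℝ} (hk : MemLp k 2) (hkm : StronglyMeasurable k) :
    ∫ y, k y * timeInt u t y = ∫ s in (0 : ℝ)..t, ∫ y, k y * u s y := by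
  obtain ⟨M, hM, hb⟩ := hu.bdd
  have hm := hu.stronglyMeasurable
  have hm' : StronglyMeasurable fun p : ℝ × Plane ↦ k p.2 * u p.1 p.2 :=
    (hkm.comp_measurable measurable_snd).mul hm
  have hi : Integrable (fun p : ℝ × Plane ↦ k p.2 * u p.1 p.2)
      ((volume.restrict (Set.Ioc 0 t)).prod volume) := by
    rw [integrable_prod_iff hm'.aestronglyMeasurable]
    refine ⟨.of_forall fun s ↦ hk.integrable_mul ((u s).memLp 2), ?_⟩
    refine Integrable.mono' ((integrableOn_inv_sqrt t).const_mul (l2norm k * M))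
      hm'.norm.integral_prod_right.aestronglyMeasurable ?_
    rw [ae_restrict_iff' measurableSet_Ioc]
    refine .of_forall fun s hs ↦ ?_
    rw [Real.norm_of_nonneg (integral_nonneg fun y ↦ norm_nonneg _)]
    have h1 := abs_integral_mul_le_sqrt hk.norm ((u s).memLp 2).norm
    simp only [Real.norm_eq_abs, sq_abs] at h1
    simp only [norm_mul, Real.norm_eq_abs]
    refine (le_abs_self _).trans (h1.trans ?_)
    change l2norm k * l2norm (u s) ≤ _
    rw [mul_assoc, ← div_eq_mul_inv]
    exact mul_le_mul_of_nonneg_left (hb s ⟨hs.1, hs.2.trans ht.2⟩) (l2norm_nonneg _)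
  rw [intervalIntegral.integral_of_le ht.1, integral_integral_swap hi]
  congr 1
  ext y
  rw [integral_const_mul, timeInt, intervalIntegral.integral_of_le ht.1]

lemma HeatFlow.heatOp_timeInt (hu : HeatFlow T u) {t r : ℝ} (ht : 0 ≤ t) (hr : 0 < r)
    (htr : t + r ≤ T) (x : Plane) :
    heatOp r (timeInt u t) x = timeInt u (t + r) x - timeInt u r x := by
  rw [heatOp, hu.integral_mul_timeInt ⟨ht, by linarith⟩ (memLp_heatKernel_sub hr x)
    (continuous_heatKernel_sub r x).stronglyMeasurable]
  have h1 : ∫ s in (0 : ℝ)..t, ∫ y, heatKernel r (x - y) * u s y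
      = ∫ s in (0 : ℝ)..t, u (s + r) x := by
    rw [intervalIntegral.integral_of_le ht, intervalIntegral.integral_of_le ht]
    refine setIntegral_congr_fun measurableSet_Ioc fun s hs ↦ ?_
    have := hu.eq_heatOp hs.1 (show s < s + r by linarith) (by linarith [hs.2]) x
    rw [this, heatOp]
    simp
  rw [h1, intervalIntegral.integral_comp_add_right (fun s ↦ u s x), zero_add, timeInt, timeInt,
    intervalIntegral.integral_interval_sub_left ((hu.cont x).intervalIntegrable _ _)
      ((hu.cont x).intervalIntegrable _ _)]

end

section

variable {T : ℝ} {u : ℝ → 𝓢(Plane, ℝ)}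

lemma heatKernel_mul_norm_sq_le {r : ℝ} (hr : 0 < r) (y : Plane) :
    heatKernel r y * ‖y‖ ^ 2 ≤ 16 * r * heatKernel (2 * r) y := by
  have h := poly_mul_heatKernel_le hr (y := y) (p := ‖y‖ ^ 2 / (4 * r ^ 2)) (by
    have : 2 / r * (1 + ‖y‖ ^ 2 / (8 * r)) = 2 / r + ‖y‖ ^ 2 / (4 * r ^ 2) := by
      field_simp; ring
    rw [this]
    have := div_pos two_pos hr
    linarith)
  calc heatKernel r y * ‖y‖ ^ 2 = 4 * r ^ 2 * (‖y‖ ^ 2 / (4 * r ^ 2) * heatKernel r y) := by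
        field_simp
    _ ≤ 4 * r ^ 2 * (4 / r * heatKernel (2 * r) y) := by gcongr
    _ = _ := by field_simp; ring

lemma integrable_heatKernel_mul_norm_sq {r : ℝ} (hr : 0 < r) :
    Integrable fun y : Plane ↦ heatKernel r y * ‖y‖ ^ 2 := by
  have hc := continuous_heatKernel r
  refine ((integrable_heatKernel (by linarith : 0 < 2 * r)).const_mul (16 * r)).mono'
    (by fun_prop) (.of_forall fun y ↦ ?_)
  rw [Real.norm_of_nonneg (mul_nonneg (heatKernel_pos hr y).le (sq_nonneg _))]
  exact heatKernel_mul_norm_sq_le hr y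

lemma integral_heatKernel_mul_norm_sq_le {r : ℝ} (hr : 0 < r) :
    ∫ y : Plane, heatKernel r y * ‖y‖ ^ 2 ≤ 16 * r := by
  have h2 : 0 < 2 * r := by linarith
  calc ∫ y : Plane, heatKernel r y * ‖y‖ ^ 2 ≤ ∫ y : Plane, 16 * r * heatKernel (2 * r) y :=
        integral_mono (integrable_heatKernel_mul_norm_sq hr)
          ((integrable_heatKernel h2).const_mul _) (heatKernel_mul_norm_sq_le hr)
    _ = 16 * r := by rw [integral_const_mul, integral_heatKernel h2, mul_one]

lemma integrable_heatKernel_mul_norm_sub_sq {r : ℝ} (hr : 0 < r) (w : Plane) :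
    Integrable fun y : Plane ↦ heatKernel r y * ‖w - y‖ ^ 2 := by
  have hc := continuous_heatKernel r
  refine (((integrable_heatKernel hr).mul_const (2 * ‖w‖ ^ 2)).add
    ((integrable_heatKernel_mul_norm_sq hr).const_mul 2)).mono' (by fun_prop)
    (.of_forall fun y ↦ ?_)
  have hp := heatKernel_pos hr y
  rw [Real.norm_of_nonneg (mul_nonneg hp.le (sq_nonneg _))]
  have h1 : ‖w - y‖ ^ 2 ≤ 2 * ‖w‖ ^ 2 + 2 * ‖y‖ ^ 2 := by
    have := norm_sub_le w y
    nlinarith [norm_nonneg (w - y), sq_nonneg (‖w‖ - ‖y‖)]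
  simp only [Pi.add_apply]
  nlinarith

lemma integrable_heatKernel_sub_mul_norm_sub_sq {r : ℝ} (hr : 0 < r) (x x₀ : Plane) :
    Integrable fun y : Plane ↦ heatKernel r (x - y) * ‖y - x₀‖ ^ 2 := by
  have h := (integrable_heatKernel_mul_norm_sub_sq hr (x - x₀)).comp_sub_left x
  refine h.congr (.of_forall fun y ↦ ?_)
  simp only
  congr 3
  abel

lemma heatOp_norm_sub_sq_le {r : ℝ} (hr : 0 < r) (x x₀ : Plane) :
    heatOp r (fun y ↦ ‖y - x₀‖ ^ 2) x ≤ ‖x - x₀‖ ^ 2 + 16 * r := by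
  set w := x - x₀
  have h1 : heatOp r (fun y ↦ ‖y - x₀‖ ^ 2) x = ∫ y, heatKernel r y * ‖w - y‖ ^ 2 := by
    rw [heatOp, ← integral_sub_left_eq_self (fun y ↦ heatKernel r y * ‖w - y‖ ^ 2) volume x]
    congr 1
    ext y
    congr 3
    simp only [w]
    abel
  have h2 : ∫ y, heatKernel r y * ‖w - y‖ ^ 2 = ∫ y, heatKernel r y * ‖w + y‖ ^ 2 := by
    rw [← integral_neg_eq_self]
    simp [heatKernel_neg]
  have i1 := integrable_heatKernel_mul_norm_sub_sq hr w
  have i2 : Integrable fun y ↦ heatKernel r y * ‖w + y‖ ^ 2 := by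
    refine i1.comp_neg.congr (.of_forall fun y ↦ ?_)
    simp [heatKernel_neg]
  have h3 : (∫ y, heatKernel r y * ‖w - y‖ ^ 2) + ∫ y, heatKernel r y * ‖w + y‖ ^ 2
      = 2 * ‖w‖ ^ 2 + 2 * ∫ y, heatKernel r y * ‖y‖ ^ 2 := by
    have e : ∀ y : Plane, heatKernel r y * ‖w - y‖ ^ 2 + heatKernel r y * ‖w + y‖ ^ 2
        = heatKernel r y * (2 * ‖w‖ ^ 2) + 2 * (heatKernel r y * ‖y‖ ^ 2) := fun y ↦ by
      have := parallelogram_law_with_norm ℝ w y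
      linear_combination heatKernel r y * this
    rw [← integral_add i1 i2]
    simp only [e]
    rw [integral_add ((integrable_heatKernel hr).mul_const _)
      ((integrable_heatKernel_mul_norm_sq hr).const_mul _), integral_mul_const,
      integral_heatKernel hr, integral_const_mul, one_mul]
  have := integral_heatKernel_mul_norm_sq_le hr
  rw [h1]
  linarith

/-- The heat average of a function with a local maximum exceeds the maximum at most by an
exponentially small amount. -/
lemma integral_heatKernel_mul_le_of_nonpos {r ρ B : ℝ} (hr : 0 < r) (hρ : 0 < ρ) (hB : 0 ≤ B)
    {x : Plane} {D U : Plane → ℝ} (hU : MemLp U 2)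
    (hi : Integrable fun y ↦ heatKernel r (x - y) * D y)
    (hD : ∀ y, ‖x - y‖ < ρ → D y ≤ 0) (hDB : ∀ y, D y ≤ |U y| + B) :
    ∫ y, heatKernel r (x - y) * D y ≤
      2 * exp (-(ρ ^ 2 / (8 * r))) * (√((16 * π * r)⁻¹) * √(∫ y, U y ^ 2) + B) := by
  have h2 : 0 < 2 * r := by linarith
  set κ := 2 * exp (-(ρ ^ 2 / (8 * r))) with hκ
  have hκ0 : 0 ≤ κ := by positivity
  have hpt : ∀ y, heatKernel r (x - y) * D y ≤
      κ * (heatKernel (2 * r) (x - y) * |U y| + heatKernel (2 * r) (x - y) * B) := by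
    intro y
    have p1 := heatKernel_pos hr (x - y)
    have p2 := heatKernel_pos h2 (x - y)
    have p3 : 0 ≤ |U y| + B := by positivity
    rcases lt_or_ge ‖x - y‖ ρ with h | h
    · exact (mul_nonpos_of_nonneg_of_nonpos p1.le (hD y h)).trans (by positivity)
    · have h3 := heatKernel_tail hr hρ.le h
      calc heatKernel r (x - y) * D y ≤ heatKernel r (x - y) * (|U y| + B) := by
            gcongr; exact hDB y
        _ ≤ (κ * heatKernel (2 * r) (x - y)) * (|U y| + B) := by gcongr
        _ = _ := by ring
  have i1 : Integrable fun y ↦ heatKernel (2 * r) (x - y) * |U y| :=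
    (memLp_heatKernel_sub h2 x).integrable_mul hU.norm
  have i2 := (integrable_heatKernel_sub h2 x).mul_const B
  refine (integral_mono hi ((i1.add i2).const_mul κ) hpt).trans ?_
  simp only [Pi.add_apply]
  rw [integral_const_mul, integral_add i1 i2, integral_mul_const, integral_heatKernel_sub h2,
    one_mul]
  have h4 := (le_abs_self _).trans (abs_heatOp_le_L2 h2 hU.norm x)
  simp only [heatOp, Real.norm_eq_abs, sq_abs] at h4
  have e : 8 * π * (2 * r) = 16 * π * r := by ring
  rw [e] at h4
  gcongr

lemma exp_neg_div_le {c r : ℝ} (hc : 0 < c) (hr : 0 < r) : exp (-(c / r)) ≤ 2 * r ^ 2 / c ^ 2 := by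
  have h := Real.quadratic_le_exp_of_nonneg (div_pos hc hr).le
  have h1 : (c / r) ^ 2 / 2 ≤ exp (c / r) := by
    have := div_pos hc hr
    linarith
  rw [Real.exp_neg]
  calc (exp (c / r))⁻¹ ≤ ((c / r) ^ 2 / 2)⁻¹ := by gcongr
    _ = _ := by field_simp

lemma HasDerivAt.le_of_le_add_mul_sqrt {F : ℝ → ℝ} {F' L C : ℝ} (h : HasDerivAt F F' 0)
    (hF : ∀ᶠ r in 𝓝[>] 0, F r - F 0 ≤ L * r + C * (r * √r)) : F' ≤ L := by
  have h1 := h.tendsto_slope_zero_right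
  have h2 : Tendsto (fun r : ℝ ↦ L + C * √r) (𝓝[>] 0) (𝓝 L) := by
    have : Tendsto (fun r : ℝ ↦ L + C * √r) (𝓝 0) (𝓝 (L + C * √0)) :=
      (by fun_prop : Continuous fun r : ℝ ↦ L + C * √r).tendsto 0
    simpa using this.mono_left nhdsWithin_le_nhds
  refine le_of_tendsto_of_tendsto h1 h2 ?_
  filter_upwards [hF, self_mem_nhdsWithin] with r hr (hr0 : 0 < r)
  rw [zero_add, smul_eq_mul, inv_mul_le_iff₀ hr0]
  linarith

lemma HeatFlow.sub_le_of_localMax (hu : HeatFlow T u) {t A M ρ : ℝ} {x x₀ : Plane}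
    (ht : t ∈ Set.Ioo 0 T) (hA : 0 ≤ A) (hM : ∀ y, |(Δ (u 0)) y| ≤ M) (hρ : 0 < ρ)
    (hmax : ∀ y, ‖x - y‖ < ρ → timeInt u t y - t * u 0 y - A * ‖y - x₀‖ ^ 2 ≤
      timeInt u t x - t * u 0 x - A * ‖x - x₀‖ ^ 2) :
    u t x - u 0 x ≤ t * M + 16 * A := by
  obtain ⟨M₁, -, hM₁⟩ := hu.bdd
  have hU := (hu.memLp_timeInt ht.1.le fun s hs ↦ hM₁ s ⟨hs.1, hs.2.trans ht.2.le⟩).1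
  obtain ⟨M₀, hM₀, hg⟩ := (u 0).exists_abs_le
  set N := √(∫ y, timeInt u t y ^ 2)
  set B := |timeInt u t x| + 2 * t * M₀ + A * ‖x - x₀‖ ^ 2 with hB
  have ht0 := ht.1
  have hder : HasDerivAt (fun r ↦ timeInt u (t + r) x - timeInt u r x) (u t x - u 0 x) 0 := by
    have h1 := (hu.hasDerivAt_timeInt x (t + 0)).comp_const_add t 0
    have h2 := h1.sub (hu.hasDerivAt_timeInt x 0)
    rw [add_zero] at h2
    exact h2
  refine hder.le_of_le_add_mul_sqrt (C := 4 / (ρ ^ 2 / 8) ^ 2 * (N + B)) ?_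
  have hmem : Set.Ioo 0 (min 1 (T - t)) ∈ 𝓝[>] (0 : ℝ) :=
    Ioo_mem_nhdsGT (lt_min one_pos (sub_pos.2 ht.2))
  filter_upwards [hmem] with r hr
  have hr0 := hr.1
  have hr1 := hr.2.trans_le (min_le_left _ _)
  have hr2 := hr.2.trans_le (min_le_right _ _)
  set D : Plane → ℝ := fun y ↦ (timeInt u t y - t * u 0 y - A * ‖y - x₀‖ ^ 2) -
    (timeInt u t x - t * u 0 x - A * ‖x - x₀‖ ^ 2) with hD
  have iU : Integrable fun y ↦ heatKernel r (x - y) * timeInt u t y :=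
    (memLp_heatKernel_sub hr0 x).integrable_mul hU
  have ig := SchwartzMap.integrable_heatKernel_mul (u 0) hr0 x
  have iq := integrable_heatKernel_sub_mul_norm_sub_sq hr0 x x₀
  have i1 := integrable_heatKernel_sub hr0 x
  have eD : ∀ y, heatKernel r (x - y) * D y = ((heatKernel r (x - y) * timeInt u t y -
      t * (heatKernel r (x - y) * u 0 y)) - A * (heatKernel r (x - y) * ‖y - x₀‖ ^ 2)) -
      heatKernel r (x - y) * (timeInt u t x - t * u 0 x - A * ‖x - x₀‖ ^ 2) := fun y ↦ by
    simp only [hD]; ring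
  have j1 : Integrable fun y ↦ heatKernel r (x - y) * timeInt u t y -
      t * (heatKernel r (x - y) * u 0 y) := iU.sub (ig.const_mul t)
  have j2 : Integrable fun y ↦ (heatKernel r (x - y) * timeInt u t y -
      t * (heatKernel r (x - y) * u 0 y)) - A * (heatKernel r (x - y) * ‖y - x₀‖ ^ 2) :=
    j1.sub (iq.const_mul A)
  have iD : Integrable fun y ↦ heatKernel r (x - y) * D y := by
    simp only [eD]
    exact j2.sub (i1.mul_const _)
  have hI : ∫ y, heatKernel r (x - y) * D y = heatOp r (timeInt u t) x - t * heatOp r (u 0) x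
      - A * heatOp r (fun y ↦ ‖y - x₀‖ ^ 2) x
      - (timeInt u t x - t * u 0 x - A * ‖x - x₀‖ ^ 2) := by
    simp only [eD]
    rw [integral_sub j2 (i1.mul_const _), integral_sub j1 (iq.const_mul A),
      integral_sub iU (ig.const_mul t), integral_const_mul, integral_const_mul, integral_mul_const,
      integral_heatKernel_sub hr0, one_mul]
    rfl
  have hB0 : 0 ≤ B := by positivity
  have key := integral_heatKernel_mul_le_of_nonpos hr0 hρ hB0 hU iD
    (fun y hy ↦ by have := hmax y hy; simp only [hD]; linarith) (fun y ↦ by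
      have a1 := le_abs_self (timeInt u t y)
      have a2 := neg_abs_le (timeInt u t x)
      have a3 := mul_le_mul_of_nonneg_left (abs_le.1 (hg x)).2 ht0.le
      have a4 := mul_le_mul_of_nonneg_left (abs_le.1 (hg y)).1 ht0.le
      have a5 : 0 ≤ A * ‖y - x₀‖ ^ 2 := by positivity
      simp only [hD, hB]
      linarith)
  rw [hI, hu.heatOp_timeInt ht0.le hr0 (by linarith)] at key
  have k1 := mul_le_mul_of_nonneg_left (abs_le.1 (abs_heatOp_sub_self_le_laplacian (u 0) hM hr0 x)).2
    ht0.le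
  have k2 := mul_le_mul_of_nonneg_left (heatOp_norm_sub_sq_le hr0 x x₀) hA
  have k3 : 2 * exp (-(ρ ^ 2 / (8 * r))) * (√((16 * π * r)⁻¹) * N + B) ≤
      4 / (ρ ^ 2 / 8) ^ 2 * (N + B) * (r * √r) := by
    have hs := Real.sqrt_pos.2 hr0
    have e1 : exp (-(ρ ^ 2 / (8 * r))) ≤ 2 * r ^ 2 / (ρ ^ 2 / 8) ^ 2 := by
      have := exp_neg_div_le (by positivity : 0 < ρ ^ 2 / 8) hr0
      rwa [div_div] at this
    have e2 : √((16 * π * r)⁻¹) ≤ (√r)⁻¹ := by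
      rw [← Real.sqrt_inv]
      apply Real.sqrt_le_sqrt
      gcongr
      nlinarith [Real.pi_gt_three]
    have e3 : 1 ≤ (√r)⁻¹ := (one_le_inv₀ hs).2 (Real.sqrt_le_one.2 hr1.le)
    have hN : 0 ≤ N := Real.sqrt_nonneg _
    calc 2 * exp (-(ρ ^ 2 / (8 * r))) * (√((16 * π * r)⁻¹) * N + B)
        ≤ 2 * (2 * r ^ 2 / (ρ ^ 2 / 8) ^ 2) * ((√r)⁻¹ * N + (√r)⁻¹ * B) := by
          gcongr
          exact le_mul_of_one_le_left hB0 e3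
      _ = 4 / (ρ ^ 2 / 8) ^ 2 * (N + B) * (r ^ 2 * (√r)⁻¹) := by ring
      _ = _ := by
          congr 1
          have : r ^ 2 = r * (√r * √r) := by rw [Real.mul_self_sqrt hr0.le]; ring
          rw [this]; field_simp
  have e0 : timeInt u 0 x = 0 := by simp [timeInt]
  rw [add_zero, e0]
  linarith

end

section

variable {T : ℝ} {u : ℝ → 𝓢(Plane, ℝ)}

/-- The time integral of `u - u 0`. -/
noncomputable def timeIncr (u : ℝ → 𝓢(Plane, ℝ)) (t : ℝ) (x : Plane) : ℝ :=
  timeInt u t x - t * u 0 x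

lemma timeIncr_zero (u : ℝ → 𝓢(Plane, ℝ)) (x : Plane) : timeIncr u 0 x = 0 := by
  simp [timeIncr, timeInt]

lemma timeIncr_neg (u : ℝ → 𝓢(Plane, ℝ)) (t : ℝ) (x : Plane) :
    timeIncr (fun t ↦ -u t) t x = -timeIncr u t x := by
  simp [timeIncr, timeInt]
  ring

lemma HeatFlow.hasDerivAt_timeIncr (hu : HeatFlow T u) (x : Plane) (t : ℝ) :
    HasDerivAt (fun t ↦ timeIncr u t x) (u t x - u 0 x) t := by
  have := (hu.hasDerivAt_timeInt x t).sub ((hasDerivAt_id t).mul_const (u 0 x))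
  rw [one_mul] at this
  exact this

lemma HeatFlow.timeIncr_le (hu : HeatFlow T u) {δ ρ ω M : ℝ} {x₀ : Plane} (hδ : δ < T)
    (hρ : 0 < ρ) (hM : ∀ y, |(Δ (u 0)) y| ≤ M)
    (hc : ContinuousOn (fun p : ℝ × Plane ↦ timeIncr u p.1 p.2)
      (Set.Icc 0 δ ×ˢ Metric.closedBall x₀ ρ))
    (hω : ∀ t ∈ Set.Icc 0 δ, ∀ x ∈ Metric.closedBall x₀ ρ, |timeIncr u t x| ≤ ω) {t : ℝ}
    (ht : t ∈ Set.Icc 0 δ) : timeIncr u t x₀ ≤ (16 * ω / ρ ^ 2 + δ * M) * t := by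
  have hM0 : 0 ≤ M := (abs_nonneg _).trans (hM 0)
  have hx₀ : x₀ ∈ Metric.closedBall x₀ ρ := Metric.mem_closedBall_self hρ.le
  have hω0 : 0 ≤ ω := (abs_nonneg _).trans (hω t ht x₀ hx₀)
  set A := ω / ρ ^ 2 with hA
  have hA0 : 0 ≤ A := by positivity
  have hAω : A * ρ ^ 2 = ω := by rw [hA]; field_simp
  suffices h : ∀ μ > 16 * A + δ * M, timeIncr u t x₀ ≤ μ * t by
    have e : 16 * ω / ρ ^ 2 = 16 * A := by rw [hA]; ring
    rw [e]
    rcases ht.1.eq_or_lt with rfl | h0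
    · simp [timeIncr_zero]
    rw [← div_le_iff₀ h0]
    refine le_of_forall_gt_imp_ge_of_dense fun μ hμ ↦ ?_
    rw [div_le_iff₀ h0]
    exact h μ hμ
  intro μ hμ
  set f : ℝ × Plane → ℝ := fun p ↦ timeIncr u p.1 p.2 - A * ‖p.2 - x₀‖ ^ 2 - μ * p.1 with hf
  have hfc : ContinuousOn f (Set.Icc 0 δ ×ˢ Metric.closedBall x₀ ρ) :=
    (hc.sub (by fun_prop)).sub (by fun_prop)
  obtain ⟨⟨t₁, x₁⟩, ⟨ht₁, hx₁⟩, hmax⟩ :=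
    (isCompact_Icc.prod (isCompact_closedBall x₀ ρ)).exists_isMaxOn ⟨(t, x₀), ht, hx₀⟩ hfc
  simp only at ht₁ hx₁
  rw [isMaxOn_iff] at hmax
  suffices h : f (t₁, x₁) ≤ 0 by
    have h1 := hmax (t, x₀) ⟨ht, hx₀⟩
    have h2 := h1.trans h
    simp only [hf, sub_self, norm_zero] at h2
    linarith
  by_contra! hpos
  have hμ0 : 0 ≤ μ := by
    have := mul_nonneg (ht.1.trans ht.2) hM0
    linarith
  have ht₁0 : 0 < t₁ := by
    refine ht₁.1.lt_of_ne ?_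
    rintro rfl
    simp only [hf, timeIncr_zero] at hpos
    have : 0 ≤ A * ‖x₁ - x₀‖ ^ 2 := by positivity
    linarith
  have hx₁ρ : ‖x₁ - x₀‖ < ρ := by
    rw [mem_closedBall_iff_norm] at hx₁
    refine hx₁.lt_of_ne fun h ↦ ?_
    have h1 := (le_abs_self _).trans (hω t₁ ht₁ x₁ (mem_closedBall_iff_norm.2 hx₁))
    simp only [hf, h, hAω] at hpos
    have := mul_nonneg hμ0 ht₁0.le
    linarith
  have htouch : u t₁ x₁ - u 0 x₁ ≤ t₁ * M + 16 * A := by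
    refine hu.sub_le_of_localMax (x₀ := x₀) ⟨ht₁0, ht₁.2.trans_lt hδ⟩ hA0 hM (sub_pos.2 hx₁ρ)
      fun y hy ↦ ?_
    have hy' : y ∈ Metric.closedBall x₀ ρ := by
      rw [mem_closedBall_iff_norm]
      have := norm_sub_le_norm_sub_add_norm_sub y x₁ x₀
      rw [norm_sub_rev y x₁] at this
      linarith
    have := hmax (t₁, y) ⟨ht₁, hy'⟩
    simp only [hf, timeIncr] at this
    linarith
  have hder : HasDerivAt (fun r ↦ timeIncr u (t₁ - r) x₁ - μ * (t₁ - r))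
      (-(u t₁ x₁ - u 0 x₁ - μ)) 0 := by
    have h0 : HasDerivAt (fun s ↦ timeIncr u s x₁ - μ * s) (u t₁ x₁ - u 0 x₁ - μ) (t₁ - 0) := by
      have := (hu.hasDerivAt_timeIncr x₁ t₁).sub ((hasDerivAt_id t₁).const_mul μ)
      rw [mul_one] at this
      rw [sub_zero]
      exact this
    exact h0.comp_const_sub t₁ 0
  have := hder.le_of_le_add_mul_sqrt (L := 0) (C := 0) (by
    filter_upwards [Ioo_mem_nhdsGT ht₁0] with r hr
    have := hmax (t₁ - r, x₁) ⟨⟨by linarith [hr.2], by linarith [hr.1, ht₁.2]⟩, hx₁⟩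
    simp only [hf] at this
    simp only [sub_zero]
    linarith)
  have : t₁ * M ≤ δ * M := by gcongr; exact ht₁.2
  linarith

lemma HeatFlow.abs_timeIncr_le (hu : HeatFlow T u) {δ ρ ω M : ℝ} {x₀ : Plane} (hδ : δ < T)
    (hρ : 0 < ρ) (hM : ∀ y, |(Δ (u 0)) y| ≤ M)
    (hc : ContinuousOn (fun p : ℝ × Plane ↦ timeIncr u p.1 p.2)
      (Set.Icc 0 δ ×ˢ Metric.closedBall x₀ ρ))
    (hω : ∀ t ∈ Set.Icc 0 δ, ∀ x ∈ Metric.closedBall x₀ ρ, |timeIncr u t x| ≤ ω) {t : ℝ}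
    (ht : t ∈ Set.Icc 0 δ) : |timeIncr u t x₀| ≤ (16 * ω / ρ ^ 2 + δ * M) * t := by
  rw [abs_le']
  refine ⟨hu.timeIncr_le hδ hρ hM hc hω ht, ?_⟩
  rw [← timeIncr_neg]
  refine hu.neg.timeIncr_le hδ hρ ?_ ?_ ?_ ht
  · simpa only [SchwartzMap.laplacian_neg_apply, abs_neg] using hM
  · simp only [timeIncr_neg]
    exact hc.neg
  · simpa only [timeIncr_neg, abs_neg] using hω

end

section

lemma hasDerivAt_max_zero_sq (x : ℝ) : HasDerivAt (fun x : ℝ ↦ max 0 x ^ 2) (2 * max 0 x) x := by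
  rcases lt_trichotomy x 0 with h | rfl | h
  · rw [max_eq_left h.le, mul_zero]
    refine (hasDerivAt_const x (0 : ℝ)).congr_of_eventuallyEq ?_
    filter_upwards [gt_mem_nhds h] with y hy
    rw [max_eq_left (le_of_lt hy)]
    norm_num
  · rw [hasDerivAt_iff_isLittleO]
    simp only [max_self, mul_zero, sub_zero, smul_eq_mul]
    have h : (fun y : ℝ ↦ y ^ 2) =o[𝓝 0] fun y : ℝ ↦ y := by
      simpa using Asymptotics.isLittleO_pow_id (𝕜 := ℝ) (n := 2) one_lt_two
    refine (Asymptotics.IsBigO.of_norm_le fun y ↦ ?_).trans_isLittleO h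
    rw [Real.norm_eq_abs, zero_pow two_ne_zero, sub_zero, abs_of_nonneg (sq_nonneg _)]
    rcases le_total 0 y with hy | hy
    · rw [max_eq_right hy]
    · rw [max_eq_left hy]; simpa using sq_nonneg y
  · rw [max_eq_right h.le]
    refine ((hasDerivAt_pow 2 x).congr_of_eventuallyEq ?_).congr_deriv (by ring)
    filter_upwards [lt_mem_nhds h] with y hy
    rw [max_eq_right (le_of_lt hy)]

/-- A compactly supported bump. -/
noncomputable def bump (y : Plane) : ℝ := max 0 (1 - ‖y‖ ^ 2) ^ 2

/-- The radial profile with `-∇ bump y = bumpRadial y • y`. -/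
noncomputable def bumpRadial (y : Plane) : ℝ := 4 * max 0 (1 - ‖y‖ ^ 2)

lemma continuous_bump : Continuous bump := by unfold bump; fun_prop

lemma continuous_bumpRadial : Continuous bumpRadial := by unfold bumpRadial; fun_prop

lemma bump_nonneg (y : Plane) : 0 ≤ bump y := sq_nonneg _

lemma bumpRadial_nonneg (y : Plane) : 0 ≤ bumpRadial y :=
  mul_nonneg (by norm_num) (le_max_left _ _)

lemma max_one_sub_sq_eq_zero {y : Plane} (hy : 1 ≤ ‖y‖) : max 0 (1 - ‖y‖ ^ 2) = 0 :=
  max_eq_left (by nlinarith)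

lemma bump_eq_zero {y : Plane} (hy : 1 ≤ ‖y‖) : bump y = 0 := by
  simp [bump, max_one_sub_sq_eq_zero hy]

lemma bumpRadial_eq_zero {y : Plane} (hy : 1 ≤ ‖y‖) : bumpRadial y = 0 := by
  simp [bumpRadial, max_one_sub_sq_eq_zero hy]

lemma hasCompactSupport_bump : HasCompactSupport bump :=
  .of_support_subset_isCompact (isCompact_closedBall (0 : Plane) 1) fun y hy ↦ by
    rw [mem_closedBall_zero_iff]
    by_contra! h
    exact hy (bump_eq_zero h.le)

lemma hasCompactSupport_bumpRadial : HasCompactSupport bumpRadial :=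
  .of_support_subset_isCompact (isCompact_closedBall (0 : Plane) 1) fun y hy ↦ by
    rw [mem_closedBall_zero_iff]
    by_contra! h
    exact hy (bumpRadial_eq_zero h.le)

lemma integrable_bump : Integrable bump :=
  continuous_bump.integrable_of_hasCompactSupport hasCompactSupport_bump

lemma integrable_bumpRadial : Integrable bumpRadial :=
  continuous_bumpRadial.integrable_of_hasCompactSupport hasCompactSupport_bumpRadial

lemma memLp_bumpRadial : MemLp bumpRadial 2 :=
  continuous_bumpRadial.memLp_of_hasCompactSupport hasCompactSupport_bumpRadial

lemma integral_bumpRadial_pos : 0 < ∫ y, bumpRadial y :=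
  continuous_bumpRadial.integral_pos_of_hasCompactSupport_nonneg_nonzero
    hasCompactSupport_bumpRadial bumpRadial_nonneg (x := 0) (by simp [bumpRadial])

lemma abs_bumpRadial_mul_coord_le (y : Plane) (i : Fin 2) :
    |bumpRadial y * y i| ≤ bumpRadial y := by
  rw [abs_mul, abs_of_nonneg (bumpRadial_nonneg y)]
  rcases le_or_gt 1 ‖y‖ with h | h
  · simp [bumpRadial_eq_zero h]
  · exact mul_le_of_le_one_right (bumpRadial_nonneg y) ((PiLp.norm_apply_le y i).trans h.le)

lemma hasLineDerivAt_bump (y : Plane) (i : Fin 2) :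
    HasLineDerivAt ℝ bump (-(bumpRadial y * y i)) y (EuclideanSpace.single i 1) := by
  unfold HasLineDerivAt bump
  simp_rw [norm_add_smul_single_sq]
  have h1 : HasDerivAt (fun t : ℝ ↦ 1 - (‖y‖ ^ 2 + 2 * t * y i + t ^ 2)) (-(2 * y i)) 0 := by
    have := ((((hasDerivAt_id (0 : ℝ)).const_mul 2).mul_const (y i)).const_add (‖y‖ ^ 2)).add
      (hasDerivAt_pow 2 (0 : ℝ)) |>.const_sub 1
    refine this.congr_deriv (by simp)
  have h2 := (hasDerivAt_max_zero_sq (1 - (‖y‖ ^ 2 + 2 * 0 * y i + 0 ^ 2))).comp (0 : ℝ) h1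
  refine h2.congr_deriv ?_
  simp only [bumpRadial]
  simp
  ring

variable (g : 𝓢(Plane, ℝ)) (x : Plane)

lemma SchwartzMap.continuous_comp_add_smul (ε : ℝ) : Continuous fun y : Plane ↦ g (x + ε • y) :=
  g.continuous.comp (by fun_prop)

lemma SchwartzMap.integrable_mul_comp {k : Plane → ℝ} (hk : Integrable k) (ε : ℝ) :
    Integrable fun y ↦ k y * g (x + ε • y) := by
  obtain ⟨M, -, hM⟩ := g.exists_abs_le
  exact hk.mul_bdd (g.continuous_comp_add_smul x ε).aestronglyMeasurable
    (.of_forall fun y ↦ hM (x + ε • y))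

lemma SchwartzMap.hasDerivAt_comp_add_smul (y : Plane) (ε : ℝ) :
    HasDerivAt (fun ε : ℝ ↦ g (x + ε • y))
      (∑ i : Fin 2, y i * (∂_{EuclideanSpace.single i (1 : ℝ)} g) (x + ε • y)) ε := by
  have h1 : HasDerivAt (fun ε : ℝ ↦ x + ε • y) y ε := by
    simpa using ((hasDerivAt_id ε).smul_const y).const_add x
  have h2 := (g.differentiableAt (x := x + ε • y)).hasFDerivAt.comp_hasDerivAt ε h1
  refine h2.congr_deriv ?_
  have hy : y = ∑ i : Fin 2, y i • EuclideanSpace.single i (1 : ℝ) := by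
    ext j
    fin_cases j <;> simp [Fin.sum_univ_two]
  simp only [SchwartzMap.lineDerivOp_apply_eq_fderiv]
  conv_lhs => rw [hy]
  rw [map_sum]
  refine Finset.sum_congr rfl fun i _ ↦ ?_
  rw [map_smul, smul_eq_mul, ← hy]

lemma SchwartzMap.integral_bumpRadial_mul_lineDeriv (ε : ℝ) (i : Fin 2) :
    ∫ y : Plane, bumpRadial y * y i * (∂_{EuclideanSpace.single i (1 : ℝ)} g) (x + ε • y) =
      ε * ∫ y, bump y * (∂_{EuclideanSpace.single i (1 : ℝ)}
        (∂_{EuclideanSpace.single i (1 : ℝ)} g)) (x + ε • y) := by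
  set e : Plane := EuclideanSpace.single i 1
  set h : 𝓢(Plane, ℝ) := ∂_{e} g
  have hc : Continuous fun y : Plane ↦ bumpRadial y * y i := by
    have := continuous_bumpRadial; fun_prop
  have hi : Integrable fun y : Plane ↦ bumpRadial y * y i :=
    integrable_bumpRadial.mono' hc.aestronglyMeasurable
      (.of_forall fun y ↦ abs_bumpRadial_mul_coord_le y i)
  have i1 := h.integrable_mul_comp x hi ε
  have i2 := (∂_{e} h).integrable_mul_comp x integrable_bump ε
  have i3 := h.integrable_mul_comp x integrable_bump ε
  have key := integral_bilinear_hasLineDerivAt_right_eq_neg_left_of_integrable (μ := volume)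
    (B := ContinuousLinearMap.mul ℝ ℝ) (v := e) (f := bump) (f' := fun y ↦ -(bumpRadial y * y i))
    (g := fun y ↦ h (x + ε • y)) (g' := fun y ↦ ε * (∂_{e} h) (x + ε • y))
    (by simpa using i1.neg) (by
      refine (i2.const_mul ε).congr (.of_forall fun y ↦ ?_)
      simp; ring) (by simpa using i3)
    (fun y _ ↦ hasLineDerivAt_bump y i) (fun y _ ↦ by
      have h1 := h.hasLineDerivAt (x + ε • y) e
      unfold HasLineDerivAt at h1 ⊢
      have h2 : HasDerivAt (fun t : ℝ ↦ ε * t) ε 0 := by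
        simpa using (hasDerivAt_id (0 : ℝ)).const_mul ε
      rw [← mul_zero ε] at h1
      have h3 := h1.comp (0 : ℝ) h2
      rw [mul_comm] at h3
      refine h3.congr_of_eventuallyEq (.of_forall fun t ↦ ?_)
      simp only [Function.comp_apply, smul_add, mul_smul, add_assoc])
  simp only [ContinuousLinearMap.mul_apply', neg_mul, integral_neg, neg_neg] at key
  rw [← key, ← integral_const_mul]
  congr 1
  ext y
  ring

lemma SchwartzMap.hasDerivAt_integral_bumpRadial_mul (ε : ℝ) :
    HasDerivAt (fun ε : ℝ ↦ ∫ y, bumpRadial y * g (x + ε • y))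
      (ε * ∫ y, bump y * (Δ g) (x + ε • y)) ε := by
  have hb : ∀ i : Fin 2, ∃ M, 0 ≤ M ∧
      ∀ x, |(∂_{EuclideanSpace.single i (1 : ℝ)} g) x| ≤ M := fun i ↦ exists_abs_le _
  choose M hM0 hM using hb
  have hk : ∀ i : Fin 2, Integrable fun y : Plane ↦ bumpRadial y * y i := fun i ↦
    integrable_bumpRadial.mono'
      (by have := continuous_bumpRadial; fun_prop)
      (.of_forall fun y ↦ abs_bumpRadial_mul_coord_le y i)
  have h := (hasDerivAt_integral_of_dominated_loc_of_deriv_le (μ := volume) (x₀ := ε)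
    (s := Set.univ) (F := fun ε y ↦ bumpRadial y * g (x + ε • y))
    (F' := fun ε y ↦ ∑ i : Fin 2, bumpRadial y * y i *
      (∂_{EuclideanSpace.single i (1 : ℝ)} g) (x + ε • y))
    (bound := fun y ↦ bumpRadial y * ∑ i, M i) univ_mem
    (.of_forall fun ε ↦ (g.integrable_mul_comp x integrable_bumpRadial ε).1)
    (g.integrable_mul_comp x integrable_bumpRadial ε)
    (integrable_finsetSum _ fun i _ ↦ integrable_mul_comp _ x (hk i) ε).1
    (.of_forall fun y ε _ ↦ ?_) (integrable_bumpRadial.mul_const _)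
    (.of_forall fun y ε _ ↦ ?_)).2
  · refine h.congr_deriv ?_
    rw [integral_finsetSum _ fun i _ ↦ integrable_mul_comp _ x (hk i) ε]
    simp_rw [integral_bumpRadial_mul_lineDeriv, laplacian_apply_eq, Finset.mul_sum]
    rw [integral_finsetSum _ fun i _ ↦ integrable_mul_comp _ x integrable_bump ε, Finset.mul_sum]
  · rw [Finset.mul_sum]
    refine (norm_sum_le _ _).trans (Finset.sum_le_sum fun i _ ↦ ?_)
    rw [norm_mul, Real.norm_eq_abs, Real.norm_eq_abs]
    exact mul_le_mul (abs_bumpRadial_mul_coord_le y i) (hM i _) (abs_nonneg _) (bumpRadial_nonneg y)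
  · have := (g.hasDerivAt_comp_add_smul x y ε).const_mul (bumpRadial y)
    refine this.congr_deriv ?_
    rw [Finset.mul_sum]
    exact Finset.sum_congr rfl fun i _ ↦ by ring

/-- The measure `1_{0 < ε ≤ d} dε dy`. -/
noncomputable def meanMeasure (d : ℝ) : Measure (ℝ × Plane) :=
  (volume.restrict (Set.Ioc 0 d)).prod volume

lemma integrable_mul_bump (d : ℝ) :
    Integrable (fun p : ℝ × Plane ↦ p.1 * bump p.2) (meanMeasure d) :=
  Integrable.mul_prod (f := fun ε : ℝ ↦ ε)
    (continuous_id.integrableOn_Icc.mono_set Set.Ioc_subset_Icc_self) integrable_bump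

lemma integral_mul_bump {d : ℝ} (hd : 0 ≤ d) :
    ∫ p, p.1 * bump p.2 ∂meanMeasure d = d ^ 2 / 2 * ∫ y, bump y := by
  rw [meanMeasure, integral_prod_mul (fun ε : ℝ ↦ ε) bump,
    ← intervalIntegral.integral_of_le hd, integral_id]
  ring

lemma ae_meanMeasure (d : ℝ) : ∀ᵐ p ∂meanMeasure d, p.1 ∈ Set.Ioc 0 d := by
  have h : ∀ᵐ ε ∂(volume.restrict (Set.Ioc 0 d)), ε ∈ Set.Ioc 0 d :=
    ae_restrict_mem measurableSet_Ioc
  exact Measure.quasiMeasurePreserving_fst.ae h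

lemma SchwartzMap.continuous_comp_meanMap : Continuous fun p : ℝ × Plane ↦ g (x + p.1 • p.2) :=
  g.continuous.comp (by fun_prop)

lemma SchwartzMap.integrable_bump_mul_comp (d : ℝ) :
    Integrable (fun p : ℝ × Plane ↦ p.1 * bump p.2 * g (x + p.1 • p.2)) (meanMeasure d) := by
  obtain ⟨M, -, hM⟩ := g.exists_abs_le
  exact (integrable_mul_bump d).mul_bdd (g.continuous_comp_meanMap x).aestronglyMeasurable
    (.of_forall fun p ↦ hM (x + p.1 • p.2))

lemma SchwartzMap.mean_formula {d : ℝ} (hd : 0 ≤ d) :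
    ∫ y, bumpRadial y * g (x + d • y) = (∫ y, bumpRadial y) * g x +
      ∫ p, p.1 * bump p.2 * (Δ g) (x + p.1 • p.2) ∂meanMeasure d := by
  have hi := (Δ g).integrable_bump_mul_comp x d
  rw [meanMeasure, integral_prod _ hi]
  have hc : Continuous fun ε : ℝ ↦ ε * ∫ y, bump y * (Δ g) (x + ε • y) := by
    obtain ⟨M, -, hM⟩ := (Δ g).exists_abs_le
    refine continuous_id.mul (continuous_of_dominated (bound := fun y ↦ bump y * M)
      (fun ε ↦ ((Δ g).integrable_mul_comp x integrable_bump ε).1)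
      (fun ε ↦ .of_forall fun y ↦ ?_) (integrable_bump.mul_const _) (.of_forall fun y ↦ ?_))
    · rw [norm_mul, Real.norm_of_nonneg (bump_nonneg y)]
      exact mul_le_mul_of_nonneg_left (hM _) (bump_nonneg y)
    · exact continuous_const.mul ((Δ g).continuous.comp (by fun_prop))
  have h := intervalIntegral.integral_eq_sub_of_hasDerivAt (a := 0) (b := d)
    (fun ε _ ↦ g.hasDerivAt_integral_bumpRadial_mul x ε) (hc.intervalIntegrable _ _)
  simp only [zero_smul, add_zero, integral_mul_const] at h
  rw [intervalIntegral.integral_of_le hd] at h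
  simp only [mul_assoc, integral_const_mul]
  linarith

end

section

lemma hasDerivAt_integral_mul_comp {α : Type*} [MeasurableSpace α] {m : Measure α} {W : α → ℝ}
    (hW : Integrable W m) {q : α → Plane} (hq : Measurable q) {F F' : ℝ → Plane → ℝ} {t C C' : ℝ}
    {s : Set ℝ} (hs : s ∈ 𝓝 t) (hF : ∀ t, StronglyMeasurable (F t))
    (hF' : StronglyMeasurable (F' t)) (hb : ∀ᵐ a ∂m, W a ≠ 0 → |F t (q a)| ≤ C)
    (hb' : ∀ t ∈ s, ∀ z, |F' t z| ≤ C') (hd : ∀ t ∈ s, ∀ z, HasDerivAt (F · z) (F' t z) t) :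
    HasDerivAt (fun t ↦ ∫ a, W a * F t (q a) ∂m) (∫ a, W a * F' t (q a) ∂m) t := by
  have hm : ∀ t, AEStronglyMeasurable (fun a ↦ W a * F t (q a)) m := fun t ↦
    hW.1.mul ((hF t).comp_measurable hq).aestronglyMeasurable
  refine (hasDerivAt_integral_of_dominated_loc_of_deriv_le (F := fun t a ↦ W a * F t (q a))
    (F' := fun t a ↦ W a * F' t (q a)) (bound := fun a ↦ ‖W a‖ * C') hs (.of_forall hm) ?_
    (hW.1.mul (hF'.comp_measurable hq).aestronglyMeasurable) (.of_forall fun a t ht ↦ ?_)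
    (hW.norm.mul_const _) (.of_forall fun a t ht ↦ (hd t ht _).const_mul _)).2
  · refine (hW.norm.mul_const C).mono' (hm t) (hb.mono fun a ha ↦ ?_)
    rw [norm_mul]
    by_cases h : W a = 0
    · simp [h]
    · exact mul_le_mul_of_nonneg_left (ha h) (norm_nonneg _)
  · rw [norm_mul]
    exact mul_le_mul_of_nonneg_left (hb' t ht _) (norm_nonneg _)

variable {T : ℝ} {u : ℝ → 𝓢(Plane, ℝ)}

lemma HeatFlow.abs_le_div (hu : HeatFlow T u) {e t : ℝ} (ht : t ∈ Set.Ioc 0 T)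
    (he : ∀ s ∈ Set.Ioc 0 t, l2norm (u s) ≤ e / √s) (x : Plane) : |u t x| ≤ e / t := by
  have ht0 := ht.1
  have h2 : 0 < t / 2 := by linarith
  have h := abs_heatOp_le_L2 h2 ((u (t / 2)).memLp 2) x
  have hx := hu.eq_heatOp h2 (by linarith) ht.2 x
  rw [show t - t / 2 = t / 2 by ring] at hx
  rw [← hx] at h
  have h3 := he (t / 2) ⟨h2, by linarith⟩
  have hs := Real.sqrt_pos.2 h2
  have hE : 0 ≤ e := by
    have := (l2norm_nonneg _).trans h3
    by_contra hcon
    exact this.not_gt (div_neg_of_neg_of_pos (by linarith) hs)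
  have h4 : √((8 * π * (t / 2))⁻¹) ≤ (2 * √(t / 2))⁻¹ := by
    rw [Real.sqrt_inv]
    gcongr
    rw [Real.le_sqrt (by positivity) (by positivity), mul_pow, Real.sq_sqrt h2.le]
    nlinarith [Real.pi_gt_three]
  have h5 := l2norm_nonneg (u (t / 2))
  calc |u t x| ≤ √((8 * π * (t / 2))⁻¹) * l2norm (u (t / 2)) := h
    _ ≤ (2 * √(t / 2))⁻¹ * (e / √(t / 2)) := by gcongr
    _ = e / (2 * (√(t / 2) * √(t / 2))) := by field_simp
    _ = e / t := by rw [Real.mul_self_sqrt h2.le]; congr 1; ring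

/-- Near time `0`, the time increment is bounded by a multiple of `t` uniformly on `S`. -/
def LinBddOn (u : ℝ → 𝓢(Plane, ℝ)) (S : Set Plane) : Prop :=
  ∃ C, ∃ δ > 0, ∀ y ∈ S, ∀ t ∈ Set.Icc 0 δ, |timeIncr u t y| ≤ C * t

lemma LinBddOn.timeInt_le {S : Set Plane} (h : LinBddOn u S) :
    ∃ C, 0 ≤ C ∧ ∃ δ > 0, ∀ y ∈ S, ∀ t ∈ Set.Icc 0 δ, |timeInt u t y| ≤ C * t := by
  obtain ⟨C, δ, hδ, h⟩ := h
  obtain ⟨M₀, hM₀, hg⟩ := (u 0).exists_abs_le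
  refine ⟨|C| + M₀, by positivity, δ, hδ, fun y hy t ht ↦ ?_⟩
  have h1 := h y hy t ht
  have e : timeInt u t y = timeIncr u t y + t * u 0 y := by simp [timeIncr]
  have h2 := mul_le_mul_of_nonneg_left (hg y) ht.1
  have h3 := mul_le_mul_of_nonneg_right (le_abs_self C) ht.1
  calc |timeInt u t y| ≤ |timeIncr u t y| + t * |u 0 y| := by
        rw [e]
        refine (abs_add_le _ _).trans ?_
        rw [abs_mul t, abs_of_nonneg ht.1]
    _ ≤ _ := by linarith

lemma HeatFlow.exists_abs_le (hu : HeatFlow T u) {s : ℝ} (hs : 0 < s) :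
    ∃ C, ∀ t ∈ Set.Icc s T, ∀ y, |u t y| ≤ C := by
  obtain ⟨M, hM, hb⟩ := hu.bdd
  refine ⟨M / s, fun t ht y ↦ ?_⟩
  have ht0 := hs.trans_le ht.1
  refine (hu.abs_le_div ⟨ht0, ht.2⟩ (fun r hr ↦ hb r ⟨hr.1, hr.2.trans ht.2⟩) y).trans ?_
  have := ht.1
  gcongr

lemma HeatFlow.exists_timeInt_le (hu : HeatFlow T u) {S : Set Plane} (h : LinBddOn u S) {t : ℝ}
    (ht : t ∈ Set.Icc 0 T) : ∃ C, ∀ y ∈ S, |timeInt u t y| ≤ C := by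
  obtain ⟨C, hC, δ, hδ, h⟩ := h.timeInt_le
  rcases le_or_gt t δ with htδ | htδ
  · exact ⟨C * t, fun y hy ↦ h y hy t ⟨ht.1, htδ⟩⟩
  obtain ⟨N, hN⟩ := hu.exists_abs_le hδ
  refine ⟨C * δ + N * |t - δ|, fun y hy ↦ ?_⟩
  have hc := hu.cont y
  have e : timeInt u t y = timeInt u δ y + ∫ s in δ..t, u s y :=
    (intervalIntegral.integral_add_adjacent_intervals (hc.intervalIntegrable _ _)
      (hc.intervalIntegrable _ _)).symm
  have h2 : ‖∫ s in δ..t, u s y‖ ≤ N * |t - δ| :=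
    intervalIntegral.norm_integral_le_of_norm_le_const fun s hs ↦ by
      rw [Set.uIoc_of_le htδ.le] at hs
      exact hN s ⟨hs.1.le, hs.2.trans ht.2⟩ y
  rw [e]
  exact (abs_add_le _ _).trans (add_le_add (h y hy δ ⟨hδ.le, le_rfl⟩) h2)

lemma add_smul_mem_closedBall {x y : Plane} {ε d : ℝ} (hε : ε ∈ Set.Icc 0 d) (hy : ‖y‖ ≤ 1) :
    x + ε • y ∈ Metric.closedBall x d := by
  rw [mem_closedBall_iff_norm, add_sub_cancel_left, norm_smul, Real.norm_of_nonneg hε.1]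
  exact (mul_le_of_le_one_right hε.1 hy).trans hε.2

lemma norm_le_one_of_bumpRadial_ne_zero {y : Plane} (h : bumpRadial y ≠ 0) : ‖y‖ ≤ 1 := by
  by_contra! hy
  exact h (bumpRadial_eq_zero hy.le)

lemma norm_le_one_of_bump_ne_zero {y : Plane} (h : bump y ≠ 0) : ‖y‖ ≤ 1 := by
  by_contra! hy
  exact h (bump_eq_zero hy.le)

lemma ae_mem_closedBall (x : Plane) (d : ℝ) : ∀ᵐ p ∂meanMeasure d,
    p.1 * bump p.2 ≠ 0 → x + p.1 • p.2 ∈ Metric.closedBall x d :=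
  (ae_meanMeasure d).mono fun _ hp h ↦ add_smul_mem_closedBall ⟨hp.1.le, hp.2⟩
    (norm_le_one_of_bump_ne_zero (right_ne_zero_of_mul h))

lemma HeatFlow.mean_formula_timeInt (hu : HeatFlow T u) {x : Plane} {d t : ℝ} (hd : 0 ≤ d)
    (hΩ : LinBddOn u (Metric.closedBall x d)) (ht : t ∈ Set.Ioo 0 T) :
    (∫ y, bumpRadial y * timeInt u t (x + d • y)) - (∫ y, bumpRadial y) * timeInt u t x -
      ∫ p, p.1 * bump p.2 * u t (x + p.1 • p.2) ∂meanMeasure d =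
    -∫ p, p.1 * bump p.2 * u 0 (x + p.1 • p.2) ∂meanMeasure d := by
  set m := meanMeasure d
  set W : ℝ × Plane → ℝ := fun p ↦ p.1 * bump p.2 with hWdef
  have hW : Integrable W m := integrable_mul_bump d
  set q : ℝ × Plane → Plane := fun p ↦ x + p.1 • p.2
  have hq : Measurable q := (by fun_prop : Continuous q).measurable
  set q' : Plane → Plane := fun y ↦ x + d • y
  have hq' : Measurable q' := (by fun_prop : Continuous q').measurable
  have hq'mem : ∀ᵐ y : Plane, bumpRadial y ≠ 0 → q' y ∈ Metric.closedBall x d :=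
    .of_forall fun y hy ↦ add_smul_mem_closedBall ⟨hd, le_rfl⟩ (norm_le_one_of_bumpRadial_ne_zero hy)
  have hqmem := ae_mem_closedBall x d
  have hnhds : ∀ t ∈ Set.Ioo 0 T, Set.Ioo (t / 2) T ∈ 𝓝 t := fun t ht ↦
    Ioo_mem_nhds (by linarith [ht.1]) ht.2
  set P : ℝ → ℝ := fun t ↦ (∫ y, bumpRadial y * timeInt u t (q' y)) -
    (∫ y, bumpRadial y) * timeInt u t x with hP
  set j : ℝ → ℝ := fun t ↦ ∫ p, W p * u t (q p) ∂m with hj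
  set J : ℝ → ℝ := fun t ↦ ∫ p, W p * timeInt u t (q p) ∂m with hJ
  have hjd : ∀ t ∈ Set.Ioo 0 T, HasDerivAt j (∫ p, W p * (Δ (u t)) (q p) ∂m) t := by
    intro t ht
    have ht2 : 0 < t / 2 := by linarith [ht.1]
    obtain ⟨n, hn⟩ := hu.exists_laplacian_le ht2
    obtain ⟨C, hC⟩ := (u t).exists_abs_le
    exact hasDerivAt_integral_mul_comp (F := fun t z ↦ u t z) (F' := fun t z ↦ (Δ (u t)) z) hW hq
      (hnhds t ht) (fun t ↦ (u t).continuous.stronglyMeasurable)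
      (Δ (u t)).continuous.stronglyMeasurable (.of_forall fun a _ ↦ hC.2 _)
      (fun s hs z ↦ hn s ⟨hs.1.le, hs.2.le⟩ z)
      (fun s hs z ↦ hu.deriv s ⟨ht2.trans hs.1, hs.2⟩ z)
  have hJd : ∀ t ∈ Set.Ioo 0 T, HasDerivAt J (j t) t := by
    intro t ht
    obtain ⟨n, hn⟩ := hu.exists_abs_le (by linarith [ht.1] : 0 < t / 2)
    obtain ⟨C, hC⟩ := hu.exists_timeInt_le hΩ ⟨ht.1.le, ht.2.le⟩
    exact hasDerivAt_integral_mul_comp (F := timeInt u) (F' := fun t z ↦ u t z) hW hq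
      (hnhds t ht) hu.stronglyMeasurable_timeInt (u t).continuous.stronglyMeasurable
      (hqmem.mono fun p hp h ↦ hC _ (hp h)) (fun s hs z ↦ hn s ⟨hs.1.le, hs.2.le⟩ z)
      (fun s _ z ↦ hu.hasDerivAt_timeInt z s)
  have hPd : ∀ t ∈ Set.Ioo 0 T, HasDerivAt P
      ((∫ y, bumpRadial y * u t (q' y)) - (∫ y, bumpRadial y) * u t x) t := by
    intro t ht
    obtain ⟨n, hn⟩ := hu.exists_abs_le (by linarith [ht.1] : 0 < t / 2)
    obtain ⟨C, hC⟩ := hu.exists_timeInt_le hΩ ⟨ht.1.le, ht.2.le⟩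
    have := hasDerivAt_integral_mul_comp (F := timeInt u) (F' := fun t z ↦ u t z)
      integrable_bumpRadial hq'
      (hnhds t ht) hu.stronglyMeasurable_timeInt (u t).continuous.stronglyMeasurable
      (hq'mem.mono fun y hy h ↦ hC _ (hy h)) (fun s hs z ↦ hn s ⟨hs.1.le, hs.2.le⟩ z)
      (fun s _ z ↦ hu.hasDerivAt_timeInt z s)
    exact this.sub ((hu.hasDerivAt_timeInt x t).const_mul _)
  have hconst : ∀ s ∈ Set.Ioo 0 T, P s - j s = P t - j t := by
    intro s hs
    have hd' : ∀ r ∈ Set.Ioo 0 T, HasDerivAt (fun r ↦ P r - j r) 0 r := fun r hr ↦ by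
      refine ((hPd r hr).sub (hjd r hr)).congr_deriv ?_
      have := (u r).mean_formula x hd
      simp only [q', q, hWdef, m]
      linarith
    exact isOpen_Ioo.is_const_of_deriv_eq_zero isPreconnected_Ioo
      (fun r hr ↦ (hd' r hr).differentiableAt.differentiableWithinAt)
      (fun r hr ↦ (hd' r hr).deriv) hs ht
  obtain ⟨C, hC0, δ, hδ, hC⟩ := hΩ.timeInt_le
  have hx : x ∈ Metric.closedBall x d := Metric.mem_closedBall_self hd
  have hev : Set.Ioo 0 (min δ T) ∈ 𝓝[>] (0 : ℝ) := Ioo_mem_nhdsGT (lt_min hδ hu.pos)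
  have bound : ∀ s ∈ Set.Ioo 0 (min δ T), ∀ᵐ p ∂m, ‖W p * timeInt u s (q p)‖ ≤ ‖W p‖ * (C * s) := by
    intro s hs
    refine hqmem.mono fun p hp ↦ ?_
    rw [norm_mul]
    by_cases h : W p = 0
    · simp [h]
    · exact mul_le_mul_of_nonneg_left
        (hC _ (hp h) s ⟨hs.1.le, hs.2.le.trans (min_le_left _ _)⟩) (norm_nonneg _)
  have bound' : ∀ s ∈ Set.Ioo 0 (min δ T), |∫ y, bumpRadial y * timeInt u s (q' y)| ≤
      (∫ y, bumpRadial y) * (C * s) := by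
    intro s hs
    rw [← integral_mul_const, ← Real.norm_eq_abs]
    refine norm_integral_le_of_norm_le (integrable_bumpRadial.mul_const _)
      (hq'mem.mono fun y hy ↦ ?_)
    rw [norm_mul, Real.norm_of_nonneg (bumpRadial_nonneg y)]
    by_cases h : bumpRadial y = 0
    · simp [h]
    · exact mul_le_mul_of_nonneg_left
        (hC _ (hy h) s ⟨hs.1.le, hs.2.le.trans (min_le_left _ _)⟩) (bumpRadial_nonneg y)
  have lin0 : ∀ K : ℝ, Tendsto (fun s : ℝ ↦ K * (C * s)) (𝓝[>] 0) (𝓝 0) := fun K ↦ by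
    have : Tendsto (fun s : ℝ ↦ K * (C * s)) (𝓝 0) (𝓝 (K * (C * 0))) :=
      (by fun_prop : Continuous fun s : ℝ ↦ K * (C * s)).tendsto 0
    simpa using this.mono_left nhdsWithin_le_nhds
  have hP0 : Tendsto P (𝓝[>] 0) (𝓝 0) := by
    have h1 : Tendsto (fun s ↦ ∫ y, bumpRadial y * timeInt u s (q' y)) (𝓝[>] 0) (𝓝 0) :=
      squeeze_zero_norm' (by filter_upwards [hev] with s hs using bound' s hs) (lin0 _)
    have h2 : Tendsto (fun s ↦ timeInt u s x) (𝓝[>] 0) (𝓝 0) := by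
      have := (hu.continuous_timeInt x).tendsto 0
      simp only [timeInt, intervalIntegral.integral_same] at this
      exact this.mono_left nhdsWithin_le_nhds
    simpa using h1.sub (h2.const_mul (∫ y, bumpRadial y))
  have hJ0 : Tendsto J (𝓝[>] 0) (𝓝 0) := by
    refine squeeze_zero_norm' ?_ (lin0 (∫ p, ‖W p‖ ∂m))
    filter_upwards [hev] with s hs
    rw [← integral_mul_const]
    exact norm_integral_le_of_norm_le (hW.norm.mul_const _) (bound s hs)
  have hlim1 : Tendsto (fun s ↦ J s / s) (𝓝[>] 0) (𝓝 (-(P t - j t))) := by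
    refine HasDerivAt.lhopital_zero_nhdsGT (f' := j) (g' := fun _ ↦ 1) ?_
      (.of_forall fun s ↦ hasDerivAt_id s) (by simp) hJ0
      (tendsto_nhdsWithin_of_tendsto_nhds tendsto_id) ?_
    · filter_upwards [Ioo_mem_nhdsGT hu.pos] with s hs using hJd s hs
    · have : Tendsto (fun s ↦ P s - (P t - j t)) (𝓝[>] 0) (𝓝 (0 - (P t - j t))) :=
        hP0.sub_const _
      rw [zero_sub] at this
      refine this.congr' ?_
      filter_upwards [Ioo_mem_nhdsGT hu.pos] with s hs
      rw [← hconst s hs]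
      simp
  have hlim2 : Tendsto (fun s ↦ J s / s) (𝓝[>] 0) (𝓝 (∫ p, W p * u 0 (q p) ∂m)) := by
    have e : ∀ s, J s / s = ∫ p, W p * timeInt u s (q p) / s ∂m := fun s ↦ by
      rw [integral_div]
    simp only [e]
    refine tendsto_integral_filter_of_dominated_convergence (fun p ↦ ‖W p‖ * C) ?_ ?_
      (hW.norm.mul_const _) (.of_forall fun p ↦ ?_)
    · refine .of_forall fun s ↦ ?_
      have h1 := (hW.1.mul
        ((hu.stronglyMeasurable_timeInt s).comp_measurable hq).aestronglyMeasurable).mul_const s⁻¹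
      exact h1.congr (.of_forall fun p ↦ by simp [div_eq_mul_inv])
    · filter_upwards [hev] with s hs
      filter_upwards [bound s hs] with p hp
      rw [norm_div, Real.norm_of_nonneg hs.1.le, div_le_iff₀ hs.1]
      linarith
    · have h1 := (hu.hasDerivAt_timeInt (q p) 0).tendsto_slope_zero_right
      have h2 := h1.const_mul (W p)
      refine h2.congr fun s ↦ ?_
      simp [timeInt]
      ring
  have := tendsto_nhds_unique hlim1 hlim2
  change P t - j t = _
  linarith

/-- The constant in the interior estimate for the time increment. -/
noncomputable def meanConst : ℝ :=
  (2 * √(∫ y, bumpRadial y ^ 2) + (∫ y, bump y) / 2 + ∫ y, bumpRadial y) / ∫ y, bumpRadial y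

lemma integral_bump_nonneg : 0 ≤ ∫ y, bump y := integral_nonneg bump_nonneg

lemma meanConst_nonneg : 0 ≤ meanConst := by
  have := integral_bumpRadial_pos
  have := integral_bump_nonneg
  unfold meanConst
  positivity

lemma abs_integral_mul_bump_mul_le {d C : ℝ} (hd : 0 ≤ d) {f : Plane → ℝ} (hC : ∀ y, |f y| ≤ C)
    (x : Plane) : |∫ p, p.1 * bump p.2 * f (x + p.1 • p.2) ∂meanMeasure d| ≤
      d ^ 2 / 2 * (∫ y, bump y) * C := by
  rw [← integral_mul_bump hd, ← integral_mul_const, ← Real.norm_eq_abs]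
  refine norm_integral_le_of_norm_le ((integrable_mul_bump d).mul_const C)
    ((ae_meanMeasure d).mono fun p hp ↦ ?_)
  have h0 : 0 ≤ p.1 * bump p.2 := mul_nonneg hp.1.le (bump_nonneg _)
  rw [norm_mul, Real.norm_of_nonneg h0]
  exact mul_le_mul_of_nonneg_left (hC _) h0

lemma HeatFlow.abs_timeIncr_le_of_linBddOn (hu : HeatFlow T u) {x : Plane} {e t M₀ : ℝ}
    (ht : t ∈ Set.Ioo 0 T) (he : ∀ s ∈ Set.Ioc 0 t, l2norm (u s) ≤ e / √s)
    (hg : ∀ y, |u 0 y| ≤ M₀) (hΩ : LinBddOn u (Metric.closedBall x √t)) :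
    |timeIncr u t x| ≤ meanConst * (e + M₀ * t) := by
  have ht0 := ht.1
  have hd := Real.sqrt_pos.2 ht0
  have hc0 := integral_bumpRadial_pos
  have hθ := integral_bump_nonneg
  have hE : 0 ≤ e := by
    have := (l2norm_nonneg _).trans (he t ⟨ht0, le_rfl⟩)
    by_contra hcon
    exact this.not_gt (div_neg_of_neg_of_pos (by linarith) hd)
  have hM₀ : 0 ≤ M₀ := (abs_nonneg _).trans (hg 0)
  obtain ⟨hU, hU2⟩ := hu.memLp_timeInt ht0.le he
  have key := hu.mean_formula_timeInt hd.le hΩ ht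
  have b1 : |∫ y, bumpRadial y * timeInt u t (x + √t • y)| ≤ √(∫ y, bumpRadial y ^ 2) * (2 * e) := by
    have hm : MemLp (fun y ↦ timeInt u t (x + √t • y)) 2 := by
      rw [memLp_two_iff_integrable_sq]
      · have := (hU.integrable_sq.comp_add_left x).comp_smul hd.ne'
        exact this
      · exact ((hu.stronglyMeasurable_timeInt t).comp_measurable
          (by fun_prop : Continuous fun y : Plane ↦ x + √t • y).measurable).aestronglyMeasurable
    refine (abs_integral_mul_le_sqrt memLp_bumpRadial hm).trans ?_
    gcongr
    rw [Real.sqrt_le_left (by positivity),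
      Measure.integral_comp_smul volume (fun y ↦ timeInt u t (x + y) ^ 2) √t,
      integral_add_left_eq_self (fun y ↦ timeInt u t y ^ 2) x]
    simp only [finrank_euclideanSpace, Fintype.card_fin, Real.sq_sqrt ht0.le, smul_eq_mul]
    rw [abs_of_pos (inv_pos.2 ht0), inv_mul_le_iff₀ ht0]
    linarith
  have b2 := abs_integral_mul_bump_mul_le hd.le (hu.abs_le_div ⟨ht0, ht.2.le⟩ he) x
  have b3 := abs_integral_mul_bump_mul_le hd.le hg x
  rw [Real.sq_sqrt ht0.le] at b2 b3
  have e2 : t / 2 * (∫ y, bump y) * (e / t) = (∫ y, bump y) / 2 * e := by field_simp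
  rw [e2] at b2
  rw [abs_le] at b1 b2 b3
  have b4 := abs_le.1 (hg x)
  have b5 := mul_le_mul_of_nonneg_left b4.1 (mul_pos hc0 ht0).le
  have b6 := mul_le_mul_of_nonneg_left b4.2 (mul_pos hc0 ht0).le
  set c₀ := ∫ y, bumpRadial y
  have hmul : c₀ * |timeIncr u t x| ≤ c₀ * (meanConst * (e + M₀ * t)) := by
    have e3 : c₀ * (meanConst * (e + M₀ * t)) =
        (2 * √(∫ y, bumpRadial y ^ 2) + (∫ y, bump y) / 2 + c₀) * (e + M₀ * t) := by
      have e4 : meanConst = (2 * √(∫ y, bumpRadial y ^ 2) + (∫ y, bump y) / 2 + c₀) / c₀ := rfl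
      rw [e4]; field_simp
    rw [e3]
    have n1 : 0 ≤ √(∫ y, bumpRadial y ^ 2) * (M₀ * t) := by positivity
    have n2 : 0 ≤ c₀ * e := by positivity
    rw [← abs_of_pos hc0, ← abs_mul, abs_of_pos hc0, abs_le, timeIncr]
    constructor <;> linarith
  exact le_of_mul_le_mul_left hmul hc0

end

section

variable {T : ℝ} {u : ℝ → 𝓢(Plane, ℝ)}

lemma LinBddOn.mono {S S' : Set Plane} (h : LinBddOn u S') (hS : S ⊆ S') : LinBddOn u S := by
  obtain ⟨C, δ, hδ, h⟩ := h
  exact ⟨C, δ, hδ, fun y hy ↦ h y (hS hy)⟩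

lemma LinBddOn.union {S S' : Set Plane} (h : LinBddOn u S) (h' : LinBddOn u S') :
    LinBddOn u (S ∪ S') := by
  obtain ⟨C, δ, hδ, h⟩ := h
  obtain ⟨C', δ', hδ', h'⟩ := h'
  refine ⟨max C C', min δ δ', lt_min hδ hδ', ?_⟩
  rintro y (hy | hy) t ⟨ht0, ht⟩
  · exact (h y hy t ⟨ht0, ht.trans (min_le_left _ _)⟩).trans
      (mul_le_mul_of_nonneg_right (le_max_left _ _) ht0)
  · exact (h' y hy t ⟨ht0, ht.trans (min_le_right _ _)⟩).trans
      (mul_le_mul_of_nonneg_right (le_max_right _ _) ht0)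

/-- The increments of the time integral are linearly bounded near `x`. -/
def LinBddNear (u : ℝ → 𝓢(Plane, ℝ)) (x : Plane) : Prop := ∃ S ∈ 𝓝 x, LinBddOn u S

lemma isOpen_linBddNear (u : ℝ → 𝓢(Plane, ℝ)) : IsOpen {x | LinBddNear u x} := by
  rw [isOpen_iff_mem_nhds]
  rintro x ⟨S, hS, h⟩
  filter_upwards [eventually_mem_nhds_iff.2 hS] with y hy
  exact ⟨S, hy, h⟩

lemma linBddOn_of_isCompact {K : Set Plane} (hK : IsCompact K) (h : ∀ x ∈ K, LinBddNear u x) :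
    LinBddOn u K := by
  refine hK.induction_on ⟨0, 1, one_pos, by simp⟩ (fun _ _ hS h ↦ h.mono hS)
    (fun _ _ h h' ↦ h.union h') fun x hx ↦ ?_
  obtain ⟨S, hS, h⟩ := h x hx
  exact ⟨S, nhdsWithin_le_nhds hS, h⟩

lemma hasDerivAt_neg_inv_sqrt {c s : ℝ} (hs : 0 < s) :
    HasDerivAt (fun s ↦ -(8 * c / √s)) (4 * c / (s * √s)) s := by
  have hs' := Real.sqrt_pos.2 hs
  have h := (((hasDerivAt_id s).sqrt hs.ne').inv hs'.ne').const_mul (-(8 * c))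
  simp only [id] at h
  refine (h.congr_of_eventuallyEq (.of_forall fun _ ↦ ?_)).congr_deriv ?_
  · simp [div_eq_mul_inv]
  · have e : √s ^ 2 = s := Real.sq_sqrt hs.le
    field_simp
    rw [e]
    ring

lemma HeatFlow.abs_timeIncr_le_of_near (hu : HeatFlow T u) {x y : Plane} {e δ m M₀ t : ℝ}
    (hδ : δ < T) (he : ∀ s ∈ Set.Ioc 0 δ, l2norm (u s) ≤ e / √s) (he0 : 0 ≤ e)
    (hm : ∀ s ∈ Set.Icc 0 T, |u s y| ≤ m) (hg : ∀ y, |u 0 y| ≤ M₀)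
    (h : ∀ r < dist x y, LinBddOn u (Metric.closedBall x r)) (ht : t ∈ Set.Icc 0 δ) :
    |timeIncr u t x| ≤ meanConst * (e + M₀ * t) + (m + M₀) * t + 16 * e := by
  have hM₀ : 0 ≤ M₀ := (abs_nonneg _).trans (hg 0)
  have hm0 : 0 ≤ m := (abs_nonneg _).trans (hm 0 ⟨le_rfl, hu.pos.le⟩)
  have hc := meanConst_nonneg
  have ht0 := ht.1
  rcases ht0.eq_or_lt with rfl | htpos
  · rw [timeIncr_zero, abs_zero]; positivity
  have hw : ∀ s ∈ Set.Ioc 0 δ,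
      ‖u s x - u 0 x‖ ≤ (m + M₀) + 4 * (e * dist x y) / (s * √s) := by
    intro s hs
    have h1 := hu.abs_sub_le_of_l2norm_le hδ.le he hs x y
    have h2 := hm s ⟨hs.1.le, hs.2.trans hδ.le⟩
    have h3 := hg x
    rw [← dist_eq_norm, mul_assoc 4] at h1
    rw [Real.norm_eq_abs]
    rw [abs_le] at *
    constructor <;> linarith
  have hcont : Continuous fun t ↦ timeIncr u t x :=
    continuous_iff_continuousAt.2 fun t ↦ (hu.hasDerivAt_timeIncr x t).continuousAt
  rcases dist_nonneg.eq_or_lt (a := 0) (b := dist x y) with hd | hd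
  · have := image_norm_le_of_norm_deriv_right_le_deriv_boundary (a := 0) (b := t)
      (f := fun t ↦ timeIncr u t x) (f' := fun t ↦ u t x - u 0 x) (B := fun s ↦ (m + M₀) * s)
      (B' := fun _ ↦ m + M₀) hcont.continuousOn
      (fun s _ ↦ (hu.hasDerivAt_timeIncr x s).hasDerivWithinAt) (by simp [timeIncr_zero])
      (fun s ↦ by simpa using (hasDerivAt_id s).const_mul (m + M₀))
      (fun s hs ↦ by
        rcases hs.1.eq_or_lt with rfl | hs0
        · simp; positivity
        · simpa [← hd] using hw s ⟨hs0, hs.2.le.trans ht.2⟩) ⟨ht0, le_rfl⟩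
    rw [Real.norm_eq_abs] at this
    have : 0 ≤ meanConst * (e + M₀ * t) := by positivity
    linarith
  have key : ∀ τ ∈ Set.Ioc 0 δ, √τ < dist x y →
      |timeIncr u τ x| ≤ meanConst * (e + M₀ * τ) := fun τ hτ hlt ↦
    hu.abs_timeIncr_le_of_linBddOn ⟨hτ.1, hτ.2.trans_lt hδ⟩
      (fun s hs ↦ he s ⟨hs.1, hs.2.trans hτ.2⟩) hg (h _ hlt)
  rcases lt_or_ge √t (dist x y) with hlt | hge
  · have := key t ⟨htpos, ht.2⟩ hlt
    have : 0 ≤ (m + M₀) * t := by positivity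
    linarith
  set d := dist x y
  set τ := (d / 2) ^ 2 with hτ
  have hsτ : √τ = d / 2 := Real.sqrt_sq (by positivity)
  have hτ0 : 0 < τ := by positivity
  have hτt : τ ≤ t := by
    have := Real.sq_sqrt ht0
    nlinarith
  have hk := key τ ⟨hτ0, hτt.trans ht.2⟩ (by rw [hsτ]; linarith)
  have h1 : 8 * (e * d) / √τ = 16 * e := by rw [hsτ]; field_simp; ring
  have hpos : ∀ s ∈ Set.Icc τ t, HasDerivAt (fun s ↦ meanConst * (e + M₀ * τ) + 16 * e +
      (m + M₀) * s + -(8 * (e * d) / √s)) ((m + M₀) + 4 * (e * d) / (s * √s)) s := fun s hs ↦ by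
    have := (((hasDerivAt_id s).const_mul (m + M₀)).const_add
      (meanConst * (e + M₀ * τ) + 16 * e)).add
      (hasDerivAt_neg_inv_sqrt (c := e * d) (hτ0.trans_le hs.1))
    rw [mul_one] at this
    exact this
  have := image_norm_le_of_norm_deriv_right_le_deriv_boundary' (a := τ) (b := t)
    (f := fun t ↦ timeIncr u t x) (f' := fun t ↦ u t x - u 0 x)
    (B := fun s ↦ meanConst * (e + M₀ * τ) + 16 * e + (m + M₀) * s + -(8 * (e * d) / √s))
    (B' := fun s ↦ m + M₀ + 4 * (e * d) / (s * √s))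
    hcont.continuousOn (fun s _ ↦ (hu.hasDerivAt_timeIncr x s).hasDerivWithinAt)
    (by
      simp only [h1, Real.norm_eq_abs]
      have : 0 ≤ (m + M₀) * τ := by positivity
      linarith)
    (fun s hs ↦ (hpos s hs).continuousAt.continuousWithinAt)
    (fun s hs ↦ (hpos s ⟨hs.1, hs.2.le⟩).hasDerivWithinAt)
    (fun s hs ↦ hw s ⟨hτ0.trans_le hs.1, hs.2.le.trans ht.2⟩) ⟨hτt, le_rfl⟩
  simp only [Real.norm_eq_abs] at this
  have h2 : 0 ≤ 8 * (e * d) / √t := by positivity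
  have h3 : meanConst * (e + M₀ * τ) ≤ meanConst * (e + M₀ * t) := by gcongr
  linarith

/-- If `timeIncr u t` tends to zero uniformly on `S`, it is jointly continuous up to time zero. -/
lemma HeatFlow.continuousOn_timeIncr (hu : HeatFlow T u) {S : Set Plane}
    (h : ∀ e > 0, ∃ δ > 0, ∀ t ∈ Set.Icc 0 δ, ∀ x ∈ S, |timeIncr u t x| ≤ e) :
    ContinuousOn (fun p : ℝ × Plane ↦ timeIncr u p.1 p.2) (Set.Icc 0 T ×ˢ S) := by
  have hT := hu.pos
  refine continuousOn_of_uniform_approx_of_continuousOn fun V hV ↦ ?_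
  obtain ⟨ε, hε, hV⟩ := Metric.mem_uniformity_dist.1 hV
  obtain ⟨δ, hδ, h⟩ := h (ε / 4) (by positivity)
  set τ := min δ T
  have hτ : 0 < τ := lt_min hδ hT
  obtain ⟨C, hC⟩ := hu.exists_abs_le hτ
  obtain ⟨M₀, _, hM₀⟩ := (u 0).exists_abs_le
  set r : ℝ → ℝ := fun s ↦ max τ (min s T)
  have hr : Continuous r := by fun_prop
  have hrm : ∀ s, r s ∈ Set.Icc τ T := fun s ↦ ⟨le_max_left _ _,
    max_le (min_le_right _ _) (min_le_right _ _)⟩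
  have hc : Continuous fun p : Plane × ℝ ↦ ∫ s in τ..p.2, (u (r s) p.1 - u 0 p.1) := by
    refine continuous_iff_continuousAt.2 fun p ↦ ?_
    refine intervalIntegral.continuousAt_parametric_primitive_of_dominated
      (F := fun x s ↦ u (r s) x - u 0 x) (fun _ ↦ C + M₀)
      (min τ p.2 - 1) (max τ p.2 + 1) (fun x ↦ ?_) (.of_forall fun x ↦ .of_forall fun s ↦ ?_)
      intervalIntegrable_const (.of_forall fun s ↦ ?_) ?_ ?_ (by simp)
    · exact (((hu.cont x).comp hr).sub continuous_const).aestronglyMeasurable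
    · exact (norm_sub_le _ _).trans (add_le_add (hC _ (hrm s) _) (hM₀ _))
    · exact ((u (r s)).continuous.sub (u 0).continuous).continuousAt
    · exact ⟨by linarith [min_le_left τ p.2], by linarith [le_max_left τ p.2]⟩
    · exact ⟨by linarith [min_le_right τ p.2], by linarith [le_max_right τ p.2]⟩
  refine ⟨fun p ↦ ∫ s in τ..max τ p.1, (u (r s) p.2 - u 0 p.2),
    (hc.comp (g := fun q : Plane × ℝ ↦ ∫ s in τ..q.2, (u (r s) q.1 - u 0 q.1))
      (f := fun p : ℝ × Plane ↦ (p.2, max τ p.1)) (by fun_prop)).continuousOn,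
    fun p hp ↦ hV ?_⟩
  have e : ∫ s in τ..max τ p.1, (u (r s) p.2 - u 0 p.2) =
      timeIncr u (max τ p.1) p.2 - timeIncr u τ p.2 := by
    have hle : τ ≤ max τ p.1 := le_max_left _ _
    rw [← intervalIntegral.integral_eq_sub_of_hasDerivAt
      (fun s _ ↦ hu.hasDerivAt_timeIncr p.2 s)
      (((hu.cont p.2).sub continuous_const).intervalIntegrable _ _)]
    refine intervalIntegral.integral_congr fun s hs ↦ ?_
    rw [Set.uIcc_of_le hle] at hs
    have : s ≤ T := hs.2.trans (max_le (min_le_right _ _) hp.1.2)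
    simp only [r, min_eq_left this, max_eq_right hs.1]
  simp only [e, Real.dist_eq]
  have h1 := h τ ⟨hτ.le, min_le_left _ _⟩ p.2 hp.2
  rcases le_total τ p.1 with hle | hle
  · rw [max_eq_right hle, sub_sub_cancel]
    linarith
  · have h2 := h p.1 ⟨hp.1.1, hle.trans (min_le_left _ _)⟩ p.2 hp.2
    rw [max_eq_left hle, sub_self, sub_zero]
    linarith

lemma HeatFlow.linBddNear (hu : HeatFlow T u) (x : Plane) : LinBddNear u x := by
  by_contra hx
  set K : Set Plane := {x | LinBddNear u x}ᶜ with hK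
  have hKc : IsClosed K := (isOpen_linBddNear u).isClosed_compl
  obtain ⟨m, x₀, hx₀, δ₀, hδ₀, hm⟩ := exists_portion_subset hKc ⟨x, hx⟩
    (C := fun n : ℕ ↦ {y | ∀ t ∈ Set.Icc 0 T, |u t y| ≤ n})
    (fun n ↦ by
      simp only [Set.ofPred_forall]
      exact isClosed_iInter fun t ↦ isClosed_iInter fun _ ↦
        isClosed_le (u t).continuous.abs continuous_const)
    (fun y _ ↦ by
      obtain ⟨C, hC⟩ := isCompact_Icc.exists_bound_of_continuousOn
        (hu.cont y).continuousOn (s := Set.Icc 0 T)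
      obtain ⟨n, hn⟩ := exists_nat_ge C
      exact Set.mem_iUnion.2 ⟨n, fun t ht ↦ (hC t ht).trans hn⟩)
  obtain ⟨M₀, hM₀0, hM₀⟩ := (u 0).exists_abs_le
  obtain ⟨M, hM0, hM⟩ := (Δ (u 0) : 𝓢(Plane, ℝ)).exists_abs_le
  have hc := meanConst_nonneg
  have hT := hu.pos
  set ρ := δ₀ / 3 with hρ
  have hρ0 : 0 < ρ := by positivity
  have hunif : ∀ e > 0, ∃ δ > 0, ∀ t ∈ Set.Icc 0 δ, ∀ x ∈ Metric.closedBall x₀ ρ,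
      |timeIncr u t x| ≤ e := by
    intro e he
    obtain ⟨δ, hδ, hs⟩ := hu.small (e / (2 * (meanConst + 16))) (by positivity)
    set A := meanConst * M₀ + (m + M₀) with hA
    have hA0 : 0 ≤ A := by positivity
    refine ⟨min (min δ (T / 2)) (e / (2 * (A + 1))), by positivity, fun t ht x hx ↦ ?_⟩
    have ht1 : t ≤ min δ (T / 2) := ht.2.trans (min_le_left _ _)
    have ht2 : t ≤ e / (2 * (A + 1)) := ht.2.trans (min_le_right _ _)
    obtain ⟨y, hy, hxy⟩ := hKc.exists_infDist_eq_dist ⟨x₀, hx₀⟩ x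
    have hle : dist x y ≤ ρ := by
      rw [← hxy]
      exact (Metric.infDist_le_dist_of_mem hx₀).trans hx
    have hyx₀ : dist y x₀ < δ₀ := by
      have := dist_triangle y x x₀
      rw [dist_comm y x] at this
      have := Metric.mem_closedBall.1 hx
      linarith
    have := hu.abs_timeIncr_le_of_near (x := x) (y := y) (δ := min δ (T / 2)) (t := t)
      ((min_le_right _ _).trans_lt (by linarith))
      (fun s hs' ↦ hs s ⟨hs'.1, hs'.2.trans (min_le_left _ _)⟩) (by positivity)
      (hm y hy hyx₀) hM₀ (fun r hr ↦ linBddOn_of_isCompact (isCompact_closedBall x r) fun w hw ↦ by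
        by_contra hn
        have := Metric.infDist_le_dist_of_mem (x := x) (show w ∈ K from hn)
        rw [hxy, dist_comm x w] at this
        exact absurd (Metric.mem_closedBall.1 hw) (by linarith)) ⟨ht.1, ht1⟩
    refine this.trans ?_
    have h1 : (meanConst + 16) * (e / (2 * (meanConst + 16))) = e / 2 := by field_simp
    have h2 : (A + 1) * t ≤ e / 2 := by
      calc (A + 1) * t ≤ (A + 1) * (e / (2 * (A + 1))) := by gcongr
        _ = e / 2 := by field_simp
    have := ht.1
    nlinarith
  have hcont := hu.continuousOn_timeIncr hunif
  obtain ⟨δ, hδ, hω⟩ := hunif 1 one_pos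
  set δ' := min δ (T / 2)
  have hδ'T : δ' < T := (min_le_right _ _).trans_lt (by linarith)
  refine hx₀ ⟨Metric.ball x₀ (ρ / 2), Metric.ball_mem_nhds _ (by positivity),
    16 * 1 / (ρ / 2) ^ 2 + δ' * M, δ', lt_min hδ (by positivity), fun y hy t ht ↦ ?_⟩
  have hsub : Metric.closedBall y (ρ / 2) ⊆ Metric.closedBall x₀ ρ :=
    Metric.closedBall_subset_closedBall' (by
      have := Metric.mem_ball.1 hy
      linarith)
  exact hu.abs_timeIncr_le hδ'T (by positivity) hM
    (hcont.mono (Set.prod_mono (Set.Icc_subset_Icc_right hδ'T.le) hsub))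
    (fun s hs w hw ↦ hω s ⟨hs.1, hs.2.trans (min_le_left _ _)⟩ w (hsub hw)) ht

lemma HeatFlow.abs_timeIncr_le_mean (hu : HeatFlow T u) {e t M₀ : ℝ}
    (ht : t ∈ Set.Ioo 0 T) (he : ∀ s ∈ Set.Ioc 0 t, l2norm (u s) ≤ e / √s)
    (hg : ∀ y, |u 0 y| ≤ M₀) (x : Plane) : |timeIncr u t x| ≤ meanConst * (e + M₀ * t) :=
  hu.abs_timeIncr_le_of_linBddOn ht he hg
    (linBddOn_of_isCompact (isCompact_closedBall _ _) fun y _ ↦ hu.linBddNear y)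

lemma HeatFlow.abs_timeIncr_le_sq (hu : HeatFlow T u) {M t : ℝ}
    (hM : ∀ y, |(Δ (u 0)) y| ≤ M) (ht : t ∈ Set.Ico 0 T) (x : Plane) :
    |timeIncr u t x| ≤ M * t ^ 2 := by
  obtain ⟨M₀, hM₀0, hM₀⟩ := (u 0).exists_abs_le
  obtain ⟨e, he0, he⟩ := hu.bdd
  have hc := meanConst_nonneg
  have hT := hu.pos
  have hbound : ∀ s ∈ Set.Icc 0 t, ∀ y, |timeIncr u s y| ≤ meanConst * (e + M₀ * T) := by
    intro s hs y
    rcases hs.1.eq_or_lt with rfl | hs0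
    · rw [timeIncr_zero, abs_zero]; positivity
    have hsT : s < T := hs.2.trans_lt ht.2
    refine (hu.abs_timeIncr_le_mean ⟨hs0, hsT⟩ (fun r hr ↦ he r ⟨hr.1, hr.2.trans hsT.le⟩)
      hM₀ y).trans ?_
    gcongr
  have hunif : ∀ ε > 0, ∃ δ > 0, ∀ t ∈ Set.Icc 0 δ, ∀ x ∈ Set.univ, |timeIncr u t x| ≤ ε := by
    intro ε hε
    obtain ⟨δ, hδ, hs⟩ := hu.small (ε / (2 * (meanConst + 1))) (by positivity)
    refine ⟨min (min δ (T / 2)) (ε / (2 * (meanConst * M₀ + 1))), by positivity,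
      fun t ht x _ ↦ ?_⟩
    rcases ht.1.eq_or_lt with rfl | ht0
    · rw [timeIncr_zero, abs_zero]; positivity
    have ht1 : t ≤ min δ (T / 2) := ht.2.trans (min_le_left _ _)
    have ht2 : t ≤ ε / (2 * (meanConst * M₀ + 1)) := ht.2.trans (min_le_right _ _)
    have := hu.abs_timeIncr_le_mean ⟨ht0, by linarith [ht1.trans (min_le_right _ _)]⟩
      (fun r hr ↦ hs r ⟨hr.1, hr.2.trans (ht1.trans (min_le_left _ _))⟩) hM₀ x
    have h1 : (meanConst + 1) * (ε / (2 * (meanConst + 1))) = ε / 2 := by field_simp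
    have h2 : (meanConst * M₀ + 1) * t ≤ ε / 2 := by
      calc (meanConst * M₀ + 1) * t ≤
          (meanConst * M₀ + 1) * (ε / (2 * (meanConst * M₀ + 1))) := by gcongr
        _ = ε / 2 := by field_simp
    have h3 : 0 ≤ ε / (2 * (meanConst + 1)) := by positivity
    nlinarith
  have hcont := hu.continuousOn_timeIncr hunif
  have hlim : Tendsto (fun ρ : ℝ ↦ (16 * (meanConst * (e + M₀ * T)) / ρ ^ 2 + t * M) * t) atTop
      (𝓝 ((0 + t * M) * t)) :=
    (((tendsto_const_nhds.div_atTop (tendsto_pow_atTop two_ne_zero)).add_const _).mul_const _)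
  rw [show M * t ^ 2 = (0 + t * M) * t by ring]
  refine ge_of_tendsto hlim ((eventually_gt_atTop 0).mono fun ρ hρ ↦ ?_)
  exact hu.abs_timeIncr_le ht.2 hρ hM
    (hcont.mono (Set.prod_mono (Set.Icc_subset_Icc_right ht.2.le) (Set.subset_univ _)))
    (fun s hs w _ ↦ hbound s hs w) ⟨ht.1, le_rfl⟩

/-- A heat flow is the heat semigroup applied to its initial value. -/
theorem HeatFlow.eq_heatOp_zero (hu : HeatFlow T u) {t : ℝ} (ht : t ∈ Set.Ioo 0 T) (x : Plane) :
    u t x = heatOp t (u 0) x := by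
  obtain ⟨M, hM0, hM⟩ := (Δ (u 0) : 𝓢(Plane, ℝ)).exists_abs_le
  have ht0 := ht.1
  have hbd : ∀ h ∈ Set.Ioo 0 (T - t),
      |h⁻¹ • (timeInt u (t + h) x - timeInt u t x) - heatOp t (u 0) x| ≤ M * h := by
    intro h hh
    have hh0 := hh.1
    have h1 := hu.heatOp_timeInt hh0.le ht0 (by linarith [hh.2]) x
    rw [add_comm h t] at h1
    have hi : Integrable fun y ↦ heatKernel t (x - y) * timeInt u h y := by
      obtain ⟨e, he0, he⟩ := hu.bdd
      exact (memLp_heatKernel_sub ht0 x).integrable_mul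
        (hu.memLp_timeInt hh0.le (e := e) fun s hs ↦
          he s ⟨hs.1, by linarith [hs.2, hh.2]⟩).1
    have h2 : heatOp t (timeIncr u h) x = heatOp t (timeInt u h) x - h * heatOp t (u 0) x := by
      unfold heatOp timeIncr
      rw [← integral_const_mul, ← integral_sub hi
        (((u 0).integrable_heatKernel_mul ht0 x).const_mul h)]
      congr 1 with y
      ring
    have h3 := abs_heatOp_le ht0 (fun y ↦ hu.abs_timeIncr_le_sq hM ⟨hh0.le, by linarith [hh.2]⟩ y) x
      (f := timeIncr u h)
    rw [h2, h1] at h3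
    have h4 : h⁻¹ • (timeInt u (t + h) x - timeInt u t x) - heatOp t (u 0) x =
        h⁻¹ * (timeInt u (t + h) x - timeInt u t x - h * heatOp t (u 0) x) := by
      rw [smul_eq_mul]; field_simp
    rw [h4, abs_mul, abs_of_pos (inv_pos.2 hh0), inv_mul_le_iff₀ hh0]
    linarith
  have hlim := (hu.hasDerivAt_timeInt x t).tendsto_slope_zero_right
  refine tendsto_nhds_unique hlim ?_
  have hz : Tendsto (fun h : ℝ ↦ M * h) (𝓝[>] 0) (𝓝 0) := by
    have : Tendsto (fun h : ℝ ↦ M * h) (𝓝 0) (𝓝 (M * 0)) := by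
      exact (continuous_const.mul continuous_id).tendsto 0
    rw [mul_zero] at this
    exact this.mono_left nhdsWithin_le_nhds
  refine tendsto_iff_norm_sub_tendsto_zero.2 (squeeze_zero' (.of_forall fun _ ↦ norm_nonneg _)
    ?_ hz)
  filter_upwards [Ioo_mem_nhdsGT (show (0 : ℝ) < T - t by linarith [ht.2])] with h hh
  exact hbd h hh

theorem HeatFlow.integral_sq_le (hu : HeatFlow T u) {t : ℝ} (ht : t ∈ Set.Ioo 0 T) :
    ∫ x, u t x ^ 2 ≤ ∫ x, u 0 x ^ 2 := by
  simp_rw [hu.eq_heatOp_zero ht]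
  exact integral_sq_heatOp_le ht.1 (u 0)

end

section

lemma one_le_φ (x : Plane) : 1 ≤ φ x := by
  unfold φ
  rw [Real.one_le_sqrt]
  nlinarith [sq_nonneg ‖x‖]

lemma φ_pos (x : Plane) : 0 < φ x := one_pos.trans_le (one_le_φ x)

lemma sq_φ (x : Plane) : φ x ^ 2 = ‖x‖ ^ 2 + 1 := Real.sq_sqrt (by positivity)

lemma continuous_φ : Continuous φ := by unfold φ; fun_prop

lemma continuous_ψ (t : ℝ) : Continuous (ψ t) := by
  unfold ψ
  have := continuous_φ
  have h : ∀ x, φ x ≠ 0 := fun x ↦ (φ_pos x).ne'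
  fun_prop (disch := assumption)

lemma ψ_zero (x : Plane) : ψ 0 x = 0 := by simp [ψ]

lemma ψ_nonneg {t : ℝ} (ht : 0 ≤ t) (x : Plane) : 0 ≤ ψ t x := by
  have h := φ_pos x
  refine mul_nonneg h.le (sub_nonneg.2 (Real.exp_le_one_iff.2 ?_))
  rw [neg_div]
  have : 0 ≤ t / φ x := by positivity
  linarith

lemma ψ_le (t : ℝ) (x : Plane) : ψ t x ≤ t := by
  have h := φ_pos x
  have h1 := Real.add_one_le_exp (-t / φ x)
  calc ψ t x ≤ φ x * (t / φ x) := by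
        refine mul_le_mul_of_nonneg_left ?_ h.le
        rw [neg_div] at h1 ⊢
        linarith
    _ = t := by field_simp

lemma mul_exp_neg_le_ψ {t : ℝ} (ht : 0 ≤ t) (x : Plane) : t * Real.exp (-t) ≤ ψ t x := by
  have h := φ_pos x
  have h1 := Real.add_one_le_exp (t / φ x)
  have h2 : t / φ x ≤ t := div_le_self ht (one_le_φ x)
  have h3 : Real.exp (-t) ≤ Real.exp (-t / φ x) := by
    rw [neg_div]; gcongr
  have h4 : Real.exp (-t / φ x) * Real.exp (t / φ x) = 1 := by
    rw [← Real.exp_add, neg_div, neg_add_cancel, Real.exp_zero]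
  have h5 := Real.exp_pos (-t / φ x)
  calc t * Real.exp (-t) ≤ φ x * (t / φ x * Real.exp (-t / φ x)) := by
        rw [← mul_assoc, mul_div_cancel₀ _ h.ne']; gcongr
    _ ≤ ψ t x := by
        refine mul_le_mul_of_nonneg_left ?_ h.le
        nlinarith

lemma hasDerivAt_ψ (t : ℝ) (x : Plane) :
    HasDerivAt (fun s ↦ ψ s x) (Real.exp (-t / φ x)) t := by
  have h := φ_pos x
  have := ((((hasDerivAt_id t).neg.div_const (φ x)).exp).const_sub 1).const_mul (φ x)
  refine this.congr_deriv ?_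
  simp only [Pi.neg_apply, id]
  field_simp

/-- The partial derivatives of `ψ`. -/
noncomputable def ψDeriv (i : Fin 2) (t : ℝ) (x : Plane) : ℝ :=
  x i / φ x * (1 - Real.exp (-t / φ x) * (1 + t / φ x))

lemma continuous_ψDeriv (i : Fin 2) (t : ℝ) : Continuous (ψDeriv i t) := by
  unfold ψDeriv
  have := continuous_φ
  have h : ∀ x, φ x ≠ 0 := fun x ↦ (φ_pos x).ne'
  fun_prop (disch := assumption)

lemma hasLineDerivAt_ψ (i : Fin 2) (t : ℝ) (x : Plane) :
    HasLineDerivAt ℝ (ψ t) (ψDeriv i t x) x (EuclideanSpace.single i 1) := by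
  have h := φ_pos x
  have hφ : HasDerivAt (fun s : ℝ ↦ φ (x + s • EuclideanSpace.single i (1 : ℝ))) (x i / φ x) 0 := by
    unfold φ
    simp only [norm_add_smul_single_sq]
    have h1 : HasDerivAt (fun s : ℝ ↦ ‖x‖ ^ 2 + 2 * s * x i + s ^ 2 + 1) (2 * x i) 0 := by
      have := (((((hasDerivAt_id (0 : ℝ)).const_mul 2).mul_const (x i)).const_add (‖x‖ ^ 2)).add
        ((hasDerivAt_id (0 : ℝ)).pow 2)).add_const 1
      exact this.congr_deriv (by simp)
    have := h1.sqrt (by simp; positivity)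
    refine this.congr_deriv ?_
    simp
    field_simp
  unfold HasLineDerivAt ψ
  have h0 : φ (x + (0 : ℝ) • EuclideanSpace.single i (1 : ℝ)) = φ x := by simp
  have h2 := hφ.mul ((((hasDerivAt_const (0 : ℝ) (-t)).div hφ (by rw [h0]; exact h.ne')).exp).const_sub 1)
  refine h2.congr_deriv ?_
  simp only [Pi.div_apply, h0, ψDeriv]
  field_simp
  ring

lemma abs_ψDeriv_le (i : Fin 2) {t : ℝ} (ht : 0 ≤ t) (x : Plane) : |ψDeriv i t x| ≤ 1 := by
  have h := φ_pos x
  have h1 : |x i| ≤ φ x := by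
    refine abs_le_of_sq_le_sq ?_ h.le
    rw [sq_φ]
    linarith [sq_coord_le x i]
  have h2 : 0 ≤ t / φ x := by positivity
  have h3 := Real.add_one_le_exp (t / φ x)
  have h4 : Real.exp (-t / φ x) * Real.exp (t / φ x) = 1 := by
    rw [← Real.exp_add, neg_div, neg_add_cancel, Real.exp_zero]
  have h5 := Real.exp_pos (-t / φ x)
  have h6 : 0 ≤ Real.exp (-t / φ x) * (1 + t / φ x) := by positivity
  have h7 : Real.exp (-t / φ x) * (1 + t / φ x) ≤ 1 := by nlinarith
  unfold ψDeriv
  rw [abs_mul, abs_div, abs_of_pos h]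
  refine mul_le_one₀ (div_le_one_of_le₀ h1 h.le) (abs_nonneg _) ?_
  rw [abs_le]
  constructor <;> linarith

lemma SchwartzMap.exists_norm_le (g : 𝓢(Plane, Plane)) : ∃ M, 0 ≤ M ∧ ∀ x, ‖g x‖ ≤ M := by
  obtain ⟨C, hC⟩ := g.decay 0 0
  exact ⟨C, hC.1.le, fun x ↦ by simpa using hC.2 x⟩

lemma SchwartzMap.integrable_mul_inner (f g : 𝓢(Plane, Plane)) {k : Plane → ℝ}
    (hk : Continuous k) {M : ℝ} (hM : ∀ y, |k y| ≤ M) :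
    Integrable fun y ↦ k y * ⟪f y, g y⟫ := by
  obtain ⟨C, hC0, hC⟩ := f.exists_norm_le
  refine (g.integrable.norm.const_mul (M * C)).mono'
    (hk.mul (f.continuous.inner g.continuous)).aestronglyMeasurable (ae_of_all _ fun y ↦ ?_)
  rw [norm_mul, mul_assoc]
  exact mul_le_mul (hM y) ((norm_inner_le_norm _ _).trans (by gcongr; exact hC y))
    (norm_nonneg _) ((abs_nonneg _).trans (hM y))

lemma SchwartzMap.integrable_norm_sq (f : 𝓢(Plane, Plane)) : Integrable fun y ↦ ‖f y‖ ^ 2 := by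
  simpa using f.integrable_mul_inner f continuous_const (k := fun _ ↦ 1) (M := 1) (by simp)

lemma abs_ψ_sq_le {t : ℝ} (ht : 0 ≤ t) (x : Plane) : |ψ t x ^ 2| ≤ t ^ 2 := by
  have h := ψ_nonneg ht x
  have := ψ_le t x
  rw [abs_of_nonneg (by positivity)]
  gcongr

lemma SchwartzMap.integrable_ψ_sq_mul (f : 𝓢(Plane, Plane)) {t : ℝ} (ht : 0 ≤ t) :
    Integrable fun y ↦ ψ t y ^ 2 * ‖f y‖ ^ 2 := by
  simpa using f.integrable_mul_inner f ((continuous_ψ t).pow 2) (abs_ψ_sq_le ht)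

/-- The partial derivative of a vector-valued Schwartz function. -/
noncomputable def SchwartzMap.partialDeriv (i : Fin 2) (f : 𝓢(Plane, Plane)) : 𝓢(Plane, Plane) :=
  ∂_{EuclideanSpace.single i (1 : ℝ)} f

lemma SchwartzMap.partialDeriv_apply (i : Fin 2) (f : 𝓢(Plane, Plane)) (x : Plane) :
    f.partialDeriv i x = fderiv ℝ f x (EuclideanSpace.single i 1) :=
  SchwartzMap.lineDerivOp_apply_eq_fderiv _ f x

lemma two_mul_mul_abs_le {p q c N G : ℝ} (hp : 0 ≤ p) (hq : |q| ≤ 1) (hc : |c| ≤ N * G) :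
    -(p ^ 2 * G ^ 2 + 4 * N ^ 2) ≤ 4 * (p * q * c) := by
  have h1 : |p * q * c| ≤ p * (N * G) := by
    rw [abs_mul, abs_mul, abs_of_nonneg hp]
    have h2 : p * |q| ≤ p := mul_le_of_le_one_right hp hq
    exact mul_le_mul h2 hc (abs_nonneg _) hp
  have h3 := neg_le_of_abs_le h1
  nlinarith [sq_nonneg (p * G - 2 * N)]

/-- The pointwise inequality behind the differential inequality for the weighted energy. -/
lemma energy_density_le {a ν p e q₀ q₁ c₀ c₁ N G₀ G₁ : ℝ} (ha : 0 < a) (hν : 0 < ν) (hp : 0 ≤ p)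
    (he : e ≤ 1) (hq₀ : |q₀| ≤ 1) (hq₁ : |q₁| ≤ 1) (hc₀ : |c₀| ≤ N * G₀) (hc₁ : |c₁| ≤ N * G₁) :
    2 * p * e * N ^ 2 - 2 * a * p ^ 2 * N ^ 2 -
      2 * ν * (p ^ 2 * G₀ ^ 2 + 2 * p * q₀ * c₀ + (p ^ 2 * G₁ ^ 2 + 2 * p * q₁ * c₁)) ≤
    -(min a ν * (p ^ 2 * N ^ 2 + p ^ 2 * (G₀ ^ 2 + G₁ ^ 2))) + (1 / a + 8 * ν) * N ^ 2 := by
  have h0 := mul_le_mul_of_nonneg_left (two_mul_mul_abs_le hp hq₀ hc₀) hν.le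
  have h1 := mul_le_mul_of_nonneg_left (two_mul_mul_abs_le hp hq₁ hc₁) hν.le
  have h2 := mul_le_mul_of_nonneg_right (min_le_left a ν)
    (by positivity : 0 ≤ p ^ 2 * N ^ 2)
  have h3 := mul_le_mul_of_nonneg_right (min_le_right a ν)
    (by positivity : 0 ≤ p ^ 2 * (G₀ ^ 2 + G₁ ^ 2))
  have h4 : 2 * p ≤ a * p ^ 2 + 1 / a := by
    have : a * p ^ 2 + 1 / a - 2 * p = (a * p - 1) ^ 2 / a := by
      field_simp
      ring
    have : 0 ≤ (a * p - 1) ^ 2 / a := by positivity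
    linarith
  have h5 : 2 * p * e ≤ a * p ^ 2 + 1 / a :=
    (mul_le_of_le_one_right (by positivity) he).trans h4
  have h6 := mul_le_mul_of_nonneg_right h5 (sq_nonneg N)
  linarith

section

variable (f : 𝓢(Plane, Plane)) {t : ℝ} (i : Fin 2)

/-- Integration by parts against the weight `ψ²`. -/
lemma SchwartzMap.integral_ψ_sq_parts (ht : 0 ≤ t) :
    Integrable (fun x ↦ ψ t x ^ 2 * ⟪f x, (f.partialDeriv i).partialDeriv i x⟫ +
      (ψ t x ^ 2 * ‖f.partialDeriv i x‖ ^ 2 +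
      2 * ψ t x * ψDeriv i t x * ⟪f x, f.partialDeriv i x⟫)) ∧
    ∫ x, (ψ t x ^ 2 * ⟪f x, (f.partialDeriv i).partialDeriv i x⟫ +
      (ψ t x ^ 2 * ‖f.partialDeriv i x‖ ^ 2 +
      2 * ψ t x * ψDeriv i t x * ⟪f x, f.partialDeriv i x⟫)) = 0 := by
  set v : Plane := EuclideanSpace.single i (1 : ℝ)
  set g := f.partialDeriv i with hg
  set h := g.partialDeriv i
  have c2 : Continuous fun x ↦ ψ t x ^ 2 := (continuous_ψ t).pow 2
  have c1 : Continuous fun x ↦ 2 * ψ t x * ψDeriv i t x :=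
    (continuous_const.mul (continuous_ψ t)).mul (continuous_ψDeriv i t)
  have b1 : ∀ x, |2 * ψ t x * ψDeriv i t x| ≤ 2 * t * 1 := fun x ↦ by
    have h0 := ψ_nonneg ht x
    rw [abs_mul, abs_of_nonneg (by positivity : 0 ≤ 2 * ψ t x)]
    exact mul_le_mul (by linarith [ψ_le t x]) (abs_ψDeriv_le i ht x) (abs_nonneg _) (by positivity)
  have i1 := f.integrable_mul_inner h c2 (abs_ψ_sq_le ht)
  have i2 := g.integrable_mul_inner g c2 (abs_ψ_sq_le ht)
  have i3 := f.integrable_mul_inner g c1 b1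
  have i4 := f.integrable_mul_inner g c2 (abs_ψ_sq_le ht)
  simp only [real_inner_self_eq_norm_sq] at i2
  have hd : ∀ (q : 𝓢(Plane, Plane)) x, HasLineDerivAt ℝ q (q.partialDeriv i x) x v := fun q x ↦ by
    rw [SchwartzMap.partialDeriv_apply]
    exact (q.differentiableAt.hasFDerivAt).hasLineDerivAt v
  have hF : ∀ x, HasLineDerivAt ℝ (fun x ↦ ψ t x ^ 2 • f x)
      (ψ t x ^ 2 • g x + (2 * ψ t x * ψDeriv i t x) • f x) x v := fun x ↦ by
    have h1 : HasDerivAt (fun s : ℝ ↦ ψ t (x + s • v)) (ψDeriv i t x) 0 := hasLineDerivAt_ψ i t x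
    have h2 : HasDerivAt (fun s : ℝ ↦ f (x + s • v)) (g x) 0 := hd f x
    refine ((h1.pow 2).smul h2).congr_deriv ?_
    simp
  have e : ∀ x, ⟪ψ t x ^ 2 • g x + (2 * ψ t x * ψDeriv i t x) • f x, g x⟫ =
      ψ t x ^ 2 * ‖g x‖ ^ 2 + 2 * ψ t x * ψDeriv i t x * ⟪f x, g x⟫ := fun x ↦ by
    rw [inner_add_left, real_inner_smul_left, real_inner_smul_left, real_inner_self_eq_norm_sq]
  have i23 : Integrable fun x ↦ ψ t x ^ 2 * ‖g x‖ ^ 2 +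
    2 * ψ t x * ψDeriv i t x * ⟪f x, g x⟫ := i2.add i3
  have e' : ∀ (q : 𝓢(Plane, Plane)) x, ψ t x ^ 2 * ⟪f x, q x⟫ = ⟪ψ t x ^ 2 • f x, q x⟫ :=
    fun q x ↦ (real_inner_smul_left _ _ _).symm
  obtain ⟨B, hB⟩ : ∃ B : Plane →L[ℝ] Plane →L[ℝ] ℝ, ∀ a b, B a b = ⟪a, b⟫ :=
    ⟨innerSL ℝ, fun _ _ ↦ rfl⟩
  have hp := integral_bilinear_hasLineDerivAt_right_eq_neg_left_of_integrable (μ := volume)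
    (B := B) (v := v) (f := fun x ↦ ψ t x ^ 2 • f x) (g := g) (g' := h)
    (f' := fun x ↦ ψ t x ^ 2 • g x + (2 * ψ t x * ψDeriv i t x) • f x)
    (by simpa only [hB, e] using i23) (by simpa only [hB, ← e'] using i1)
    (by simpa only [hB, ← e'] using i4) (fun x _ ↦ hF x) (fun x _ ↦ hd g x)
  simp only [hB, e, ← e'] at hp
  exact ⟨i1.add i23, by rw [integral_add i1 i23, hp, neg_add_cancel]⟩

/-- The differential inequality for the weighted energy on a time slice. -/
lemma SchwartzMap.integral_energy_deriv_le {a ν : ℝ} (ha : 0 < a) (hν : 0 < ν) (ht : 0 ≤ t) :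
    ∫ x, (2 * ψ t x * Real.exp (-t / φ x) * ‖f x‖ ^ 2 + ψ t x ^ 2 * (2 * ⟪f x,
      ν • ((f.partialDeriv 0).partialDeriv 0 x +
        (f.partialDeriv 1).partialDeriv 1 x) -
      a • f x⟫)) ≤
    -(min a ν * ((∫ x, ψ t x ^ 2 * ‖f x‖ ^ 2) + ∫ x, ψ t x ^ 2 *
      ∑ i : Fin 2, ‖f.partialDeriv i x‖ ^ 2)) +
    (1 / a + 8 * ν) * ∫ x, ‖f x‖ ^ 2 := by
  obtain ⟨j0, z0⟩ := f.integral_ψ_sq_parts 0 ht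
  obtain ⟨j1, z1⟩ := f.integral_ψ_sq_parts 1 ht
  set g0 := f.partialDeriv 0
  set g1 := f.partialDeriv 1
  set h0 := g0.partialDeriv 0
  set h1 := g1.partialDeriv 1
  set Z0 : Plane → ℝ := fun x ↦ ψ t x ^ 2 * ⟪f x, h0 x⟫ + (ψ t x ^ 2 * ‖g0 x‖ ^ 2 +
    2 * ψ t x * ψDeriv 0 t x * ⟪f x, g0 x⟫)
  set Z1 : Plane → ℝ := fun x ↦ ψ t x ^ 2 * ⟪f x, h1 x⟫ + (ψ t x ^ 2 * ‖g1 x‖ ^ 2 +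
    2 * ψ t x * ψDeriv 1 t x * ⟪f x, g1 x⟫)
  have k0 := f.integrable_ψ_sq_mul ht
  have k1 : Integrable fun x ↦ ψ t x ^ 2 *
      ∑ i : Fin 2, ‖f.partialDeriv i x‖ ^ 2 := by
    simp only [Fin.sum_univ_two, mul_add]
    exact (g0.integrable_ψ_sq_mul ht).add (g1.integrable_ψ_sq_mul ht)
  have kN := f.integrable_norm_sq
  have hc : Continuous fun x ↦ 2 * ψ t x * Real.exp (-t / φ x) := by
    have := continuous_φ
    have := continuous_ψ t
    have h : ∀ x, φ x ≠ 0 := fun x ↦ (φ_pos x).ne'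
    fun_prop (disch := assumption)
  have he : ∀ x, Real.exp (-t / φ x) ≤ 1 := fun x ↦ by
    have := φ_pos x
    rw [Real.exp_le_one_iff, neg_div]
    have : 0 ≤ t / φ x := by positivity
    linarith
  have d1 := f.integrable_mul_inner f hc (M := 2 * t) fun x ↦ by
    have h0 := ψ_nonneg ht x
    rw [abs_of_nonneg (by positivity)]
    have := mul_le_mul (ψ_le t x) (he x) (Real.exp_pos _).le ht
    linarith
  simp only [real_inner_self_eq_norm_sq] at d1
  have d2 := f.integrable_mul_inner (ν • (h0 + h1) - a • f) ((continuous_ψ t).pow 2)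
    (abs_ψ_sq_le ht)
  have d : Integrable fun x ↦ 2 * ψ t x * Real.exp (-t / φ x) * ‖f x‖ ^ 2 + ψ t x ^ 2 *
      (2 * ⟪f x, ν • (h0 x + h1 x) - a • f x⟫) := by
    refine (d1.add (d2.const_mul 2)).congr (ae_of_all _ fun x ↦ ?_)
    simp
    ring
  have hZ : ∫ x, 2 * ν * (Z0 x + Z1 x) = 0 := by
    rw [integral_const_mul, integral_add j0 j1, z0, z1]
    simp
  have jZ : Integrable fun x ↦ 2 * ν * (Z0 x + Z1 x) := (j0.add j1).const_mul _
  have hR : Integrable fun x ↦ -(min a ν * (ψ t x ^ 2 * ‖f x‖ ^ 2 + ψ t x ^ 2 *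
      ∑ i : Fin 2, ‖f.partialDeriv i x‖ ^ 2)) +
      (1 / a + 8 * ν) * ‖f x‖ ^ 2 := ((k0.add k1).const_mul _).neg.add (kN.const_mul _)
  have k01 : Integrable fun x ↦ min a ν * (ψ t x ^ 2 * ‖f x‖ ^ 2 + ψ t x ^ 2 *
      ∑ i : Fin 2, ‖f.partialDeriv i x‖ ^ 2) := (k0.add k1).const_mul _
  have hR' := integral_add k01.neg (kN.const_mul (1 / a + 8 * ν))
  simp only [Pi.neg_apply] at hR'
  rw [integral_neg, integral_const_mul, integral_add k0 k1, integral_const_mul] at hR'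
  rw [← hR', ← sub_zero (∫ x, _ + ψ t x ^ 2 * (2 * _)), ← hZ, ← integral_sub d jZ]
  refine integral_mono (d.sub jZ) hR fun x ↦ ?_
  have p0 := ψ_nonneg ht x
  have key := energy_density_le ha hν p0 (he x) (abs_ψDeriv_le 0 ht x) (abs_ψDeriv_le 1 ht x)
    (abs_real_inner_le_norm (f x) (g0 x)) (abs_real_inner_le_norm (f x) (g1 x))
  simp only [Z0, Z1, Fin.sum_univ_two, inner_sub_right, inner_smul_right, inner_add_right,
    real_inner_self_eq_norm_sq]
  linarith

end

end

section

/-- A component of a vector-valued Schwartz function. -/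
noncomputable def SchwartzMap.component (i : Fin 2) (f : 𝓢(Plane, Plane)) : 𝓢(Plane, ℝ) :=
  f.postcompCLM (EuclideanSpace.proj i : Plane →L[ℝ] ℝ)

lemma SchwartzMap.component_apply (i : Fin 2) (f : 𝓢(Plane, Plane)) (x : Plane) :
    f.component i x = f x i := rfl

/-- The componentwise Laplacian of a vector-valued Schwartz function. -/
noncomputable def SchwartzMap.vectorLaplacian (f : 𝓢(Plane, Plane)) : 𝓢(Plane, Plane) :=
  (f.partialDeriv 0).partialDeriv 0 + (f.partialDeriv 1).partialDeriv 1

lemma SchwartzMap.lineDeriv_component (i : Fin 2) (f : 𝓢(Plane, Plane)) (j : Fin 2) :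
    ∂_{EuclideanSpace.single j (1 : ℝ)} (f.component i) = (f.partialDeriv j).component i := by
  ext x
  rw [SchwartzMap.lineDerivOp_apply_eq_fderiv, component_apply, partialDeriv_apply]
  have h := ((EuclideanSpace.proj i : Plane →L[ℝ] ℝ).hasFDerivAt.comp x
    f.differentiableAt.hasFDerivAt).fderiv
  exact DFunLike.congr_fun h (EuclideanSpace.single j 1)

lemma SchwartzMap.laplacian_component (i : Fin 2) (f : 𝓢(Plane, Plane)) (x : Plane) :
    (Δ (f.component i) : 𝓢(Plane, ℝ)) x = f.vectorLaplacian x i := by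
  simp only [laplacian_apply_eq, Fin.sum_univ_two, lineDeriv_component, component_apply]
  rfl

lemma SchwartzMap.laplacian_smul_apply (c : ℝ) (f : 𝓢(Plane, ℝ)) (x : Plane) :
    (Δ (c • f) : 𝓢(Plane, ℝ)) x = c * (Δ f : 𝓢(Plane, ℝ)) x := by
  simp [laplacian_apply_eq, LineDeriv.lineDerivOp_smul, mul_add]

lemma SchwartzMap.integral_norm_sq_eq (f : 𝓢(Plane, Plane)) :
    ∫ x, ‖f x‖ ^ 2 = (∫ x, f.component 0 x ^ 2) + ∫ x, f.component 1 x ^ 2 := by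
  have h : ∀ i, Integrable fun x ↦ f.component i x ^ 2 := fun i ↦ by
    refine f.integrable_norm_sq.mono' (by fun_prop) (ae_of_all _ fun x ↦ ?_)
    rw [Real.norm_eq_abs, abs_of_nonneg (by positivity)]
    exact sq_coord_le _ _
  rw [← integral_add (h 0) (h 1)]
  refine integral_congr_ae (ae_of_all _ fun x ↦ ?_)
  simp [EuclideanSpace.norm_sq_eq, Fin.sum_univ_two, component_apply]

lemma SchwartzMap.l2norm_component_sq_le (f : 𝓢(Plane, Plane)) (i : Fin 2) :
    l2norm (f.component i) ^ 2 ≤ ∫ x, ‖f x‖ ^ 2 := by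
  rw [l2norm_sq]
  exact integral_mono_of_nonneg (ae_of_all _ fun x ↦ sq_nonneg _) f.integrable_norm_sq
    (ae_of_all _ fun x ↦ sq_coord_le (f x) i)

/-- The weighted energy. -/
noncomputable def weightedEnergy (F : ℝ → 𝓢(Plane, Plane)) (r : ℝ) : ℝ :=
  ∫ x, ψ r x ^ 2 * ‖F r x‖ ^ 2

/-- A solution of the damped heat equation with Schwartz slices, whose weighted energy is
continuous in time and is `o(t)` at time zero. -/
structure DampedHeatFlow (a ν T : ℝ) (F : ℝ → 𝓢(Plane, Plane)) : Prop where
  pos : 0 < T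
  cont : ∀ x, Continuous fun t ↦ F t x
  cont_lap : ∀ x, Continuous fun t ↦ (F t).vectorLaplacian x
  deriv : ∀ t ∈ Set.Ioo 0 T, ∀ x,
    HasDerivAt (fun s ↦ F s x) (ν • (F t).vectorLaplacian x - a • F t x) t
  cont_energy : ContinuousOn (weightedEnergy F) (Set.Icc 0 T)
  small_energy : ∀ e > 0, ∃ δ > 0, ∀ t ∈ Set.Ioc 0 δ, weightedEnergy F t ≤ e * t

variable {a ν T : ℝ} {F : ℝ → 𝓢(Plane, Plane)}

lemma mul_integral_norm_sq_le_weightedEnergy {r : ℝ} (hr : 0 ≤ r) :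
    (r * Real.exp (-r)) ^ 2 * ∫ x, ‖F r x‖ ^ 2 ≤ weightedEnergy F r := by
  rw [← integral_const_mul]
  refine integral_mono ((F r).integrable_norm_sq.const_mul _) ((F r).integrable_ψ_sq_mul hr)
    fun x ↦ ?_
  have h := mul_exp_neg_le_ψ hr x
  dsimp only
  gcongr

lemma DampedHeatFlow.exists_weightedEnergy_le (h : DampedHeatFlow a ν T F) :
    ∃ K, 0 ≤ K ∧ ∀ r ∈ Set.Ioc 0 T, weightedEnergy F r ≤ K * r := by
  obtain ⟨δ, hδ, h1⟩ := h.small_energy 1 one_pos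
  obtain ⟨B, hB⟩ := isCompact_Icc.exists_bound_of_continuousOn h.cont_energy
  have hB0 : 0 ≤ B := (norm_nonneg _).trans (hB 0 ⟨le_rfl, h.pos.le⟩)
  refine ⟨1 + B / δ, by positivity, fun r hr ↦ ?_⟩
  rcases le_total r δ with h2 | h2
  · have := mul_nonneg (div_nonneg hB0 hδ.le) hr.1.le
    linarith [h1 r ⟨hr.1, h2⟩]
  · have h3 := (le_abs_self _).trans (hB r ⟨hr.1.le, hr.2⟩)
    have h4 : B ≤ B / δ * r := by
      rw [div_mul_eq_mul_div, le_div_iff₀ hδ]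
      gcongr
    linarith [hr.1]

/-- A component of the solution, with the damping removed and time rescaled to make the
viscosity one. -/
noncomputable def undampedComponent (a ν : ℝ) (F : ℝ → 𝓢(Plane, Plane)) (i : Fin 2) (s : ℝ) :
    𝓢(Plane, ℝ) :=
  Real.exp (a * (s / ν)) • (F (s / ν)).component i

lemma undampedComponent_apply (i : Fin 2) (s : ℝ) (x : Plane) :
    undampedComponent a ν F i s x = Real.exp (a * (s / ν)) * F (s / ν) x i := rfl

lemma l2norm_undampedComponent_le (ha : 0 < a) (hν : 0 < ν) (i : Fin 2) {s k M : ℝ}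
    (hs : s ∈ Set.Ioc 0 (ν * T)) (hM : 0 ≤ M) (hk : weightedEnergy F (s / ν) ≤ k * (s / ν))
    (hkM : ν * Real.exp (2 * (a + 1) * T) * k ≤ M ^ 2) :
    l2norm (undampedComponent a ν F i s) ≤ M / √s := by
  obtain ⟨r, rfl⟩ : ∃ r, s = ν * r := ⟨s / ν, by field_simp⟩
  have hr : 0 < r := pos_of_mul_pos_right hs.1 hν.le
  have hrT : r ≤ T := le_of_mul_le_mul_left hs.2 hν
  have e : ν * r / ν = r := by field_simp
  rw [e] at hk
  have h1 := (mul_integral_norm_sq_le_weightedEnergy hr.le).trans hk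
  have h2 := (F r).l2norm_component_sq_le i
  have h3 : l2norm (undampedComponent a ν F i (ν * r)) ^ 2 =
      Real.exp (a * r) ^ 2 * l2norm ((F r).component i) ^ 2 := by
    simp only [l2norm_sq, undampedComponent_apply, e, mul_pow, integral_const_mul,
      SchwartzMap.component_apply]
  have h4 : r * l2norm ((F r).component i) ^ 2 ≤ Real.exp r ^ 2 * k := by
    have h5 : (r * Real.exp (-r)) ^ 2 * l2norm ((F r).component i) ^ 2 ≤ k * r := by
      refine le_trans ?_ h1
      gcongr
    rw [Real.exp_neg] at h5
    have h6 := Real.exp_pos r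
    field_simp at h5
    linarith
  have hk0 : 0 ≤ k := by
    have : 0 ≤ Real.exp r ^ 2 * k := le_trans (by positivity) h4
    exact nonneg_of_mul_nonneg_right this (by positivity)
  have h7 : Real.exp (a * r) ^ 2 * Real.exp r ^ 2 ≤ Real.exp (2 * (a + 1) * T) := by
    rw [← mul_pow, ← Real.exp_add, ← Real.exp_nat_mul]
    refine Real.exp_le_exp.2 ?_
    push_cast
    nlinarith
  rw [le_div_iff₀ (Real.sqrt_pos.2 hs.1)]
  refine le_of_sq_le_sq ?_ hM
  rw [mul_pow, h3, Real.sq_sqrt hs.1.le]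
  calc _ = ν * Real.exp (a * r) ^ 2 * (r * l2norm ((F r).component i) ^ 2) := by ring
    _ ≤ ν * Real.exp (a * r) ^ 2 * (Real.exp r ^ 2 * k) := by gcongr
    _ = ν * (Real.exp (a * r) ^ 2 * Real.exp r ^ 2) * k := by ring
    _ ≤ _ := le_trans (by gcongr) hkM

lemma DampedHeatFlow.heatFlow_undampedComponent (h : DampedHeatFlow a ν T F) (ha : 0 < a)
    (hν : 0 < ν) (i : Fin 2) : HeatFlow (ν * T) (undampedComponent a ν F i) where
  pos := mul_pos hν h.pos
  cont x := by
    simp only [undampedComponent_apply]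
    have h1 := (EuclideanSpace.proj i : Plane →L[ℝ] ℝ).continuous.comp
      ((h.cont x).comp (continuous_id.div_const ν))
    exact (by fun_prop : Continuous fun s : ℝ ↦ Real.exp (a * (s / ν))).mul h1
  cont_lap x := by
    simp only [undampedComponent, SchwartzMap.laplacian_smul_apply,
      SchwartzMap.laplacian_component]
    have h1 := (EuclideanSpace.proj i : Plane →L[ℝ] ℝ).continuous.comp
      ((h.cont_lap x).comp (continuous_id.div_const ν))
    exact (by fun_prop : Continuous fun s : ℝ ↦ Real.exp (a * (s / ν))).mul h1
  deriv t ht x := by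
    simp only [undampedComponent, SchwartzMap.laplacian_smul_apply,
      SchwartzMap.laplacian_component]
    have ht' : t / ν ∈ Set.Ioo 0 T := ⟨div_pos ht.1 hν, (div_lt_iff₀' hν).2 ht.2⟩
    have h0 : HasDerivAt (fun s : ℝ ↦ s / ν) (1 / ν) t := (hasDerivAt_id t).div_const ν
    have h1 := (EuclideanSpace.proj i : Plane →L[ℝ] ℝ).hasFDerivAt.comp_hasDerivAt (t / ν)
      (h.deriv _ ht' x)
    have h2 := h1.comp t h0
    have h3 := (h0.const_mul a).exp
    refine (h3.mul h2).congr_deriv ?_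
    simp
    field_simp
    ring
  bdd := by
    obtain ⟨K, hK0, hK⟩ := h.exists_weightedEnergy_le
    refine ⟨√(ν * Real.exp (2 * (a + 1) * T) * K), Real.sqrt_nonneg _, fun t ht ↦
      l2norm_undampedComponent_le ha hν i ht (Real.sqrt_nonneg _)
        (hK _ ⟨div_pos ht.1 hν, (div_le_iff₀' hν).2 ht.2⟩) ?_⟩
    rw [Real.sq_sqrt (by positivity)]
  small e he := by
    obtain ⟨δ, hδ, h1⟩ := h.small_energy (e ^ 2 / (ν * Real.exp (2 * (a + 1) * T)))
      (by positivity)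
    refine ⟨ν * min δ T, mul_pos hν (lt_min hδ h.pos), fun t ht ↦ ?_⟩
    have h2 : t / ν ≤ min δ T := (div_le_iff₀' hν).2 ht.2
    refine l2norm_undampedComponent_le (T := T) ha hν i
      ⟨ht.1, ht.2.trans (by gcongr; exact min_le_right _ _)⟩ he.le
      (h1 _ ⟨div_pos ht.1 hν, h2.trans (min_le_left _ _)⟩) ?_
    rw [mul_div_cancel₀ _ (by positivity)]

theorem DampedHeatFlow.integral_norm_sq_le (h : DampedHeatFlow a ν T F) (ha : 0 < a)
    (hν : 0 < ν) {r : ℝ} (hr : r ∈ Set.Ioo 0 T) : ∫ x, ‖F r x‖ ^ 2 ≤ ∫ x, ‖F 0 x‖ ^ 2 := by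
  have key : ∀ i, ∫ x, (F r).component i x ^ 2 ≤ ∫ x, (F 0).component i x ^ 2 := fun i ↦ by
    have h1 := (h.heatFlow_undampedComponent ha hν i).integral_sq_le (t := ν * r)
      ⟨mul_pos hν hr.1, mul_lt_mul_of_pos_left hr.2 hν⟩
    have e : ν * r / ν = r := by field_simp
    simp only [undampedComponent_apply, e, zero_div, mul_zero, Real.exp_zero, one_mul, mul_pow,
      integral_const_mul, ← SchwartzMap.component_apply] at h1
    refine le_trans (le_mul_of_one_le_left (by positivity) (one_le_pow₀ ?_)) h1
    exact Real.one_le_exp (mul_pos ha hr.1).le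
  rw [SchwartzMap.integral_norm_sq_eq, SchwartzMap.integral_norm_sq_eq]
  exact add_le_add (key 0) (key 1)

lemma DampedHeatFlow.integrableOn_integral_norm_sq (h : DampedHeatFlow a ν T F) (ha : 0 < a)
    (hν : 0 < ν) {s t : ℝ} (hs : 0 ≤ s) (ht : t ≤ T) :
    IntegrableOn (fun r ↦ ∫ x, ‖F r x‖ ^ 2) (Set.Icc s t) := by
  have h1 : StronglyMeasurable (Function.uncurry fun (r : ℝ) (x : Plane) ↦ F r x) :=
    stronglyMeasurable_uncurry_of_continuous_of_stronglyMeasurable (ι := ℝ) (α := Plane)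
      (u := fun s y ↦ F s y) h.cont fun s ↦ (F s).continuous.stronglyMeasurable
  have h2 : StronglyMeasurable fun r ↦ ∫ x, ‖F r x‖ ^ 2 :=
    StronglyMeasurable.integral_prod_right (f := fun (r : ℝ) (x : Plane) ↦ ‖F r x‖ ^ 2)
      (h1.norm.pow 2)
  rw [integrableOn_Icc_iff_integrableOn_Ioo]
  refine Measure.integrableOn_of_bounded (M := ∫ x, ‖F 0 x‖ ^ 2) (by simp)
    h2.aestronglyMeasurable ?_
  rw [ae_restrict_iff' measurableSet_Ioo]
  refine ae_of_all _ fun r hr ↦ ?_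
  rw [Real.norm_eq_abs, abs_of_nonneg (by positivity)]
  exact h.integral_norm_sq_le ha hν ⟨hs.trans_lt hr.1, hr.2.trans_le ht⟩

end

section

variable {a ν T : ℝ} {F : ℝ → 𝓢(Plane, Plane)} {z : ℝ → Plane → Plane}

lemma SchwartzMap.pdv_eq (i : Fin 2) (f : 𝓢(Plane, Plane)) : pdv i f = f.partialDeriv i :=
  funext fun x ↦ (f.partialDeriv_apply i x).symm

lemma SchwartzMap.vectorLaplacian_eq (f : 𝓢(Plane, Plane)) (x : Plane) :
    f.vectorLaplacian x = pdv 0 (pdv 0 f) x + pdv 1 (pdv 1 f) x := by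
  simp only [pdv_eq, vectorLaplacian, add_apply]

lemma hasDerivAt_ψ_sq_mul_norm_sq {v : ℝ → Plane} {v' : Plane} {t : ℝ} (h : HasDerivAt v v' t)
    (x : Plane) : HasDerivAt (fun s ↦ ψ s x ^ 2 * ‖v s‖ ^ 2)
      (2 * ψ t x * Real.exp (-t / φ x) * ‖v t‖ ^ 2 + ψ t x ^ 2 * (2 * ⟪v t, v'⟫)) t :=
  (((hasDerivAt_ψ t x).pow 2).mul h.norm_sq).congr_deriv (by simp)

lemma exists_clip (hT : 0 < T) : ∃ κ : ℝ → ℝ, Continuous κ ∧ (∀ r, κ r ∈ Set.Icc 0 T) ∧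
    ∀ r ∈ Set.Icc 0 T, κ r = r :=
  ⟨fun r ↦ max 0 (min r T), by fun_prop, fun r ↦ ⟨le_max_left _ _, max_le hT.le (min_le_right _ _)⟩,
    fun r hr ↦ by simp [min_eq_left hr.2, max_eq_right hr.1]⟩

lemma exists_dampedHeatFlow (hν : 0 < ν) (hT : 0 < T)
    (hz : ∀ t ∈ Set.Icc (0 : ℝ) T, ∃ f : 𝓢(Plane, Plane), ∀ x, z t x = f x)
    (hz' : ∀ x, ContDiff ℝ 1 fun s ↦ z s x)
    (heq : ∀ t ∈ Set.Icc (0 : ℝ) T, ∀ x, HasDerivAt (fun s ↦ z s x)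
      (ν • (pdv 0 (pdv 0 (z t)) x + pdv 1 (pdv 1 (z t)) x) - a • z t x) t)
    (hE : ∀ t ∈ Set.Icc (0 : ℝ) T, HasDerivAt (fun s ↦ ∫ x, ψ s x ^ 2 * ‖z s x‖ ^ 2)
      (∫ x, deriv (fun s ↦ ψ s x ^ 2 * ‖z s x‖ ^ 2) t) t) :
    ∃ F : ℝ → 𝓢(Plane, Plane), DampedHeatFlow a ν T F ∧ ∀ t ∈ Set.Icc 0 T, z t = F t := by
  obtain ⟨κ, hκ, hκm, hκe⟩ := exists_clip hT
  choose f hf using hz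
  have hF : ∀ r, z (κ r) = f (κ r) (hκm r) := fun r ↦ funext (hf _ (hκm r))
  have hF' : ∀ r ∈ Set.Icc 0 T, z r = f (κ r) (hκm r) := fun r hr ↦ by rw [← hF, hκe r hr]
  have hlap : ∀ r x, (f (κ r) (hκm r)).vectorLaplacian x =
      ν⁻¹ • (deriv (fun s ↦ z s x) (κ r) + a • z (κ r) x) := fun r x ↦ by
    rw [SchwartzMap.vectorLaplacian_eq, ← hF, (heq _ (hκm r) x).deriv, sub_add_cancel,
      inv_smul_smul₀ hν.ne']
  have hEeq : ∀ r ∈ Set.Icc 0 T, weightedEnergy (fun r ↦ f (κ r) (hκm r)) r =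
      ∫ x, ψ r x ^ 2 * ‖z r x‖ ^ 2 := fun r hr ↦ by
    simp only [weightedEnergy, hF' r hr]
  refine ⟨fun r ↦ f (κ r) (hκm r), ⟨hT, fun x ↦ ?_, fun x ↦ ?_, fun t ht x ↦ ?_, ?_, ?_⟩, hF'⟩
  · simp only [← hF]
    exact (hz' x).continuous.comp hκ
  · simp only [hlap]
    have h1 := ((hz' x).continuous_deriv le_rfl).comp hκ
    have h2 := (hz' x).continuous.comp hκ
    exact (h1.add (h2.const_smul a)).const_smul ν⁻¹
  · have h1 := heq t ⟨ht.1.le, ht.2.le⟩ x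
    rw [hF' t ⟨ht.1.le, ht.2.le⟩, ← SchwartzMap.vectorLaplacian_eq] at h1
    refine h1.congr_of_eventuallyEq ?_
    filter_upwards [Ioo_mem_nhds ht.1 ht.2] with s hs
    rw [hF' s ⟨hs.1.le, hs.2.le⟩]
  · exact (ContinuousOn.congr (fun t ht ↦ (hE t ht).continuousAt.continuousWithinAt) hEeq)
  · intro e he
    have h0 := hE 0 ⟨le_rfl, hT.le⟩
    have h1 : ∀ x, deriv (fun s ↦ ψ s x ^ 2 * ‖z s x‖ ^ 2) 0 = 0 := fun x ↦ by
      rw [(hasDerivAt_ψ_sq_mul_norm_sq (heq 0 ⟨le_rfl, hT.le⟩ x) x).deriv, ψ_zero]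
      simp
    simp only [h1, integral_zero] at h0
    have h2 := (hasDerivAt_iff_isLittleO_nhds_zero.1 h0).bound he
    simp only [ψ_zero, zero_add] at h2
    obtain ⟨δ, hδ, h3⟩ := Metric.eventually_nhds_iff.1 h2
    refine ⟨min (δ / 2) T, lt_min (half_pos hδ) hT, fun t ht ↦ ?_⟩
    have h4 : t ≤ T := ht.2.trans (min_le_right _ _)
    have h5 : t ≤ δ / 2 := ht.2.trans (min_le_left _ _)
    have h6 := h3 (y := t) (by rw [Real.dist_0_eq_abs, abs_of_pos ht.1]; linarith)
    rw [hEeq t ⟨ht.1.le, h4⟩]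
    rw [Real.norm_eq_abs t, abs_of_pos ht.1] at h6
    refine le_trans (le_trans (le_abs_self _) ?_) h6
    simp

lemma weightedEnergy_add_integral_le {e' G N E : ℝ → ℝ} {c C s t : ℝ} (hc : 0 ≤ c) (hst : s ≤ t)
    (hE : ∀ r ∈ Set.Icc s t, HasDerivAt E (e' r) r) (hG : ∀ r, 0 ≤ G r)
    (hN : IntegrableOn N (Set.Icc s t)) (h : ∀ r ∈ Set.Icc s t, e' r ≤ -(c * G r) + C * N r) :
    E t + c * ∫ r in s..t, G r ≤ E s + C * ∫ r in s..t, N r := by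
  have hcont : ContinuousOn E (Set.Icc s t) := fun r hr ↦ (hE r hr).continuousAt.continuousWithinAt
  have hd : ∀ r ∈ Set.Ioo s t, HasDerivWithinAt E (e' r) (Set.Ioi r) r := fun r hr ↦
    (hE r ⟨hr.1.le, hr.2.le⟩).hasDerivWithinAt
  by_cases hi : IntervalIntegrable G volume s t
  · have hi' : IntegrableOn G (Set.Icc s t) :=
      (intervalIntegrable_iff_integrableOn_Icc_of_le hst).1 hi
    have h1 := intervalIntegral.sub_le_integral_of_hasDeriv_right_of_le hst hcont hd
      ((hi'.const_mul c).neg.add (hN.const_mul C)) fun r hr ↦ h r ⟨hr.1.le, hr.2.le⟩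
    have hN' := (intervalIntegrable_iff_integrableOn_Icc_of_le hst).2 hN
    have h2 := intervalIntegral.integral_add (hi.const_mul c).neg (hN'.const_mul C)
    simp only [Pi.add_apply, Pi.neg_apply, intervalIntegral.integral_neg,
      intervalIntegral.integral_const_mul] at h1 h2
    linarith
  · have h1 := intervalIntegral.sub_le_integral_of_hasDeriv_right_of_le hst hcont hd
      (hN.const_mul C) fun r hr ↦ by
        have h2 := h r ⟨hr.1.le, hr.2.le⟩
        have h3 := mul_nonneg hc (hG r)
        linarith
    rw [intervalIntegral.integral_const_mul] at h1
    rw [intervalIntegral.integral_undef hi]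
    linarith

end

end

/-- Weighted energy estimate for the damped heat equation `∂ₜ z = νΔz − a z`:
for `a, ν > 0` there are constants `c, C > 0` (depending only on `a, ν`) such that for
any `T > 0` and any `z` which is Schwartz in space, `C¹` in time, solves the equation
pointwise, and for which time differentiation of the weighted spatial energy integral
can be interchanged with the spatial integral, one has for all `0 ≤ s ≤ t ≤ T`:
`∫ ψ(t)²|z(t)|² + c ∫ₛᵗ (∫ ψ(r)²|z(r)|² + ∫ ψ(r)²|∇z(r)|²) dr
  ≤ ∫ ψ(s)²|z(s)|² + C ∫ₛᵗ ∫ |z(r)|² dr`. -/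
theorem damped_heat_weighted_energy_estimate (a ν : ℝ) (ha : 0 < a) (hν : 0 < ν) :
    ∃ c > 0, ∃ C > 0, ∀ T : ℝ, 0 < T →
      ∀ z : ℝ → EuclideanSpace ℝ (Fin 2) → EuclideanSpace ℝ (Fin 2),
        -- `z` is Schwartz-class in the space variable:
        (∀ t ∈ Set.Icc (0 : ℝ) T,
          ∃ f : SchwartzMap (EuclideanSpace ℝ (Fin 2)) (EuclideanSpace ℝ (Fin 2)),
            ∀ x, z t x = f x) →
        -- `z` is continuously differentiable in time:
        (∀ x, ContDiff ℝ 1 (fun s => z s x)) →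
        -- `z` solves the damped heat equation `∂ₜ z = νΔz − a z` pointwise:
        (∀ t ∈ Set.Icc (0 : ℝ) T, ∀ x,
          HasDerivAt (fun s => z s x)
            (ν • (pdv 0 (pdv 0 (z t)) x + pdv 1 (pdv 1 (z t)) x) - a • z t x) t) →
        -- time derivatives of spatial integrals are interchangeable:
        (∀ t ∈ Set.Icc (0 : ℝ) T,
          HasDerivAt (fun s => ∫ x, ψ s x ^ 2 * ‖z s x‖ ^ 2)
            (∫ x, deriv (fun s => ψ s x ^ 2 * ‖z s x‖ ^ 2) t) t) →
        ∀ s t : ℝ, 0 ≤ s → s ≤ t → t ≤ T →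
          (∫ x, ψ t x ^ 2 * ‖z t x‖ ^ 2) +
            c * ∫ r in s..t, ((∫ x, ψ r x ^ 2 * ‖z r x‖ ^ 2) +
              (∫ x, ψ r x ^ 2 *
                ∑ i : Fin 2, ‖fderiv ℝ (z r) x (EuclideanSpace.single i 1)‖ ^ 2)) ≤
          (∫ x, ψ s x ^ 2 * ‖z s x‖ ^ 2) + C * ∫ r in s..t, (∫ x, ‖z r x‖ ^ 2) := by
  refine ⟨min a ν, lt_min ha hν, 1 / a + 8 * ν, by positivity, ?_⟩
  intro T hT z hz hz' heq hE s t hs hst ht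
  obtain ⟨F, hF, hzF⟩ := exists_dampedHeatFlow hν hT hz hz' heq hE
  have hsub : Set.Icc s t ⊆ Set.Icc 0 T := Set.Icc_subset_Icc hs ht
  have hN : IntegrableOn (fun r ↦ ∫ x, ‖z r x‖ ^ 2) (Set.Icc s t) :=
    (hF.integrableOn_integral_norm_sq ha hν hs ht).congr_fun
      (fun r hr ↦ by simp only [hzF r (hsub hr)]) measurableSet_Icc
  refine weightedEnergy_add_integral_le (lt_min ha hν).le hst (fun r hr ↦ hE r (hsub hr))
    (fun r ↦ by positivity) hN fun r hr ↦ ?_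
  have h1 : ∀ x, deriv (fun s ↦ ψ s x ^ 2 * ‖z s x‖ ^ 2) r = _ := fun x ↦
    (hasDerivAt_ψ_sq_mul_norm_sq (heq r (hsub hr) x) x).deriv
  simp only [h1, hzF r (hsub hr), SchwartzMap.pdv_eq, ← SchwartzMap.partialDeriv_apply]
  exact (F r).integral_energy_deriv_le ha hν (hs.trans hr.1)
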